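/- arXiv:2003.07035 — 2 statements merged into one kernel-verified Lean document; each statement's English description precedes it below -/
import Mathlib

section
/- Let k be a perfect field of characteristic p > 0, R = k[X₁,…,X_d] a polynomial ring with d ≥ 2, and G a finite group acting linearly on R (by degree-preserving k-algebra automorphisms induced by a linear action on the degree-one part). Let R^G be the ring of invariants and I ⊆ R^G a homogeneous ideal of finite colength, so that (R^G, I) is a graded pair. Then the HK density function f_{R^G,I} is a piecewise polynomial function of degree d−1. -/
open Filter MeasureTheory Topology

set_option synthInstance.maxHeartbeats 1000000
set_option maxHeartbeats 1000000

noncomputable section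

/-- The `q`-th Frobenius bracket power `I^{[q]}` of an ideal `I`. -/
def Ideal.frobeniusPow {R : Type*} [CommSemiring R] (I : Ideal R) (q : ℕ) : Ideal R :=
  Ideal.span ((· ^ q) '' (I : Set R))

/-- `dim_k` of the degree-`j` graded piece of `M ⧸ N`, for a graded `k`-module `M`
with grading `ℳ` and a `k`-submodule `N ≤ M`. -/
def gradedPieceLen (k : Type*) [Field k] {M : Type*} [AddCommGroup M] [Module k M]
    (ℳ : ℕ → Submodule k M) (N : Submodule k M) (j : ℕ) : ℕ :=
  Module.finrank k (↥(ℳ j) ⧸ (N.comap (ℳ j).subtype))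

/-- The step function `f_n(M_R, I)` of a graded pair, for a graded module `M`. -/
def hkStep (k : Type*) [Field k] {R M : Type*} [CommRing R] [AddCommGroup M] [Module R M]
    [Module k M] [SMul k R] [IsScalarTower k R M]
    (ℳ : ℕ → Submodule k M) (I : Ideal R) (d n₀ p n : ℕ) (x : ℝ) : ℝ :=
  (∑ i ∈ Finset.range n₀,
      (gradedPieceLen k ℳ ((I.frobeniusPow (p ^ n) • (⊤ : Submodule R M)).restrictScalars k)
        (⌊x * (p ^ n : ℕ)⌋₊ * n₀ + i) : ℝ)) / ((p : ℝ) ^ n) ^ (d - 1)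

/-- The interpolated function `g_n(M_R, I)` of a graded pair. -/
def hkStepG (k : Type*) [Field k] {R M : Type*} [CommRing R] [AddCommGroup M] [Module R M]
    [Module k M] [SMul k R] [IsScalarTower k R M]
    (ℳ : ℕ → Submodule k M) (I : Ideal R) (d n₀ p n : ℕ) (x : ℝ) : ℝ :=
  (1 - (x * (p ^ n : ℕ) - ⌊x * (p ^ n : ℕ)⌋₊)) *
      hkStep k ℳ I d n₀ p n ((⌊x * (p ^ n : ℕ)⌋₊ : ℝ) / (p ^ n : ℕ))
    + (x * (p ^ n : ℕ) - ⌊x * (p ^ n : ℕ)⌋₊) *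
      hkStep k ℳ I d n₀ p n ((⌊x * (p ^ n : ℕ)⌋₊ + 1 : ℝ) / (p ^ n : ℕ))

/-- A real function is a piecewise polynomial function of degree `e` on `[0, ∞)`. -/
def IsPiecewisePolyOfDegree (F : ℝ → ℝ) (e : ℕ) : Prop :=
  ∃ (N : ℕ) (a : ℕ → ℝ) (P : ℕ → Polynomial ℝ),
    a 0 = 0 ∧ (∀ i < N, a i < a (i + 1)) ∧
    (∀ i < N, ∀ x ∈ Set.Icc (a i) (a (i + 1)), F x = (P i).eval x) ∧
    (∀ x : ℝ, a N ≤ x → F x = 0) ∧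
    (∀ i < N, (P i).natDegree ≤ e)

/-- The ring of invariants `R^G` of a group acting on a `k`-algebra `R`. -/
def fixedSubalgebra (k R G : Type*) [CommSemiring k] [Semiring R] [Algebra k R] [Group G]
    (ρ : G →* (R ≃ₐ[k] R)) : Subalgebra k R :=
  ⨅ g : G, AlgHom.equalizer (ρ g).toAlgHom (AlgHom.id k R)

/-- The induced grading on the ring of invariants of a finite group acting
(degree-preservingly) on a polynomial ring. -/
def fixedGrading (k : Type*) [Field k] (d : ℕ) (G : Type*) [Group G]
    (ρ : G →* (MvPolynomial (Fin d) k ≃ₐ[k] MvPolynomial (Fin d) k)) (n : ℕ) :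
    Submodule k ↥(fixedSubalgebra k (MvPolynomial (Fin d) k) G ρ) :=
  (MvPolynomial.homogeneousSubmodule (Fin d) k n).comap
    (fixedSubalgebra k (MvPolynomial (Fin d) k) G ρ).val.toLinearMap

namespace MvPolynomial

variable {k : Type*} [Field k] {d : ℕ}

/-- The Hilbert function of a `k`-subspace of a polynomial ring. -/
def hilbertFn (V : Submodule k (MvPolynomial (Fin d) k)) (m : ℕ) : ℕ :=
  Module.finrank k ↥(V ⊓ homogeneousSubmodule (Fin d) k m)

instance finite_homogeneousSubmodule (m : ℕ) :
    Module.Finite k ↥(homogeneousSubmodule (Fin d) k m) :=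
  Module.Finite.iff_fg.mpr (homogeneousSubmodule_fg _ _ m)

instance finite_inf_homogeneousSubmodule (V : Submodule k (MvPolynomial (Fin d) k)) (m : ℕ) :
    Module.Finite k ↥(V ⊓ homogeneousSubmodule (Fin d) k m) :=
  Submodule.finiteDimensional_of_le (inf_le_right)

theorem hilbertFn_mono {V W : Submodule k (MvPolynomial (Fin d) k)} (h : V ≤ W) (m : ℕ) :
    hilbertFn V m ≤ hilbertFn W m :=
  Submodule.finrank_mono (inf_le_inf_right _ h)

theorem hilbertFn_top (hd : 0 < d) (m : ℕ) :
    hilbertFn (⊤ : Submodule k (MvPolynomial (Fin d) k)) m = (d - 1 + m).choose (d - 1) := by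
  have hset : {u : Fin d →₀ ℕ | u.degree = m} =
      ↑((Finset.univ : Finset (Fin d)).finsuppAntidiag m) := by
    ext u
    simp [Finset.mem_finsuppAntidiag, Finsupp.degree_eq_sum]
  have hs : homogeneousSubmodule (Fin d) k m =
      Submodule.span k (Set.range fun u : (Finset.univ : Finset (Fin d)).finsuppAntidiag m =>
        basisMonomials (Fin d) k u.1) := by
    rw [homogeneousSubmodule_eq_finsupp_supported, hset]
    rw [AddMonoidAlgebra.supported_eq_span_single]
    congr 1
    ext x
    simp only [Set.mem_image, Set.mem_range, Subtype.exists]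
    constructor
    · rintro ⟨u, hu, rfl⟩; exact ⟨u, hu, rfl⟩
    · rintro ⟨u, hu, rfl⟩; exact ⟨u, hu, rfl⟩
  have hli : LinearIndependent k
      (fun u : (Finset.univ : Finset (Fin d)).finsuppAntidiag m =>
        basisMonomials (Fin d) k u.1) :=
    (basisMonomials (Fin d) k).linearIndependent.comp _ Subtype.val_injective
  rw [hilbertFn, top_inf_eq, hs, finrank_span_eq_card hli, Fintype.card_coe,
    Finset.card_finsuppAntidiag_nat_eq_choose, Finset.card_univ, Fintype.card_fin,
    show d + m - 1 = d - 1 + m by omega, Nat.choose_symm_add]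

/-- The exponent vector of a point of the box `[0, q)^d`. -/
def boxExponent {q : ℕ} (a : Fin d → Fin q) : Fin d →₀ ℕ :=
  Finsupp.equivFunOnFinite.symm fun i => (a i : ℕ)

@[simp]
theorem boxExponent_apply {q : ℕ} (a : Fin d → Fin q) (i : Fin d) :
    boxExponent a i = a i := rfl

theorem degree_boxExponent {q : ℕ} (a : Fin d → Fin q) :
    (boxExponent a).degree = ∑ i, (a i : ℕ) := by
  simp [Finsupp.degree_eq_sum]

/-- The coordinate at `X ^ a` of a polynomial over the subring of polynomials in the `X_i ^ q`. -/
def boxCoord {q : ℕ} (a : Fin d → Fin q) :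
    MvPolynomial (Fin d) k →ₗ[k] MvPolynomial (Fin d) k :=
  (basisMonomials (Fin d) k).constr k fun u =>
    if ∀ i, u i % q = a i then monomial (u.mapRange (· / q) (Nat.zero_div q)) 1 else 0

theorem boxCoord_monomial {q : ℕ} (a : Fin d → Fin q) (u : Fin d →₀ ℕ) (c : k) :
    boxCoord a (monomial u c) =
      if ∀ i, u i % q = a i then monomial (u.mapRange (· / q) (Nat.zero_div q)) c else 0 := by
  have h : (monomial u c : MvPolynomial (Fin d) k) = c • basisMonomials (Fin d) k u := by
    simp [smul_monomial]
  rw [h, map_smul, boxCoord, Module.Basis.constr_basis]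
  split_ifs <;> simp [smul_monomial]

theorem coeff_boxCoord {q : ℕ} (a : Fin d → Fin q) (v : Fin d →₀ ℕ)
    (f : MvPolynomial (Fin d) k) :
    coeff v (boxCoord a f) = coeff (boxExponent a + q • v) f := by
  classical
  induction f using MvPolynomial.induction_on' with
  | add f g hf hg => simp [hf, hg]
  | monomial u c =>
    rw [boxCoord_monomial, coeff_monomial]
    by_cases hu : u = boxExponent a + q • v
    · have hq : ∀ i, 0 < q := fun i => (Nat.zero_le _).trans_lt (a i).2
      have h1 : ∀ i, u i % q = a i := by
        intro i
        simp [hu, Nat.mod_eq_of_lt (a i).2]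
      have h2 : u.mapRange (· / q) (Nat.zero_div q) = v := by
        ext i
        simp [hu, Nat.add_mul_div_left _ _ (hq i), Nat.div_eq_of_lt (a i).2]
      rw [if_pos h1, if_pos hu, h2, coeff_monomial, if_pos rfl]
    · rw [if_neg hu]
      split_ifs with h1
      · rw [coeff_monomial, if_neg]
        rintro rfl
        refine hu ?_
        ext i
        have := Nat.mod_add_div (u i) q
        rw [h1 i] at this
        simpa using this.symm
      · simp

theorem boxCoord_mul_expand {q : ℕ} (a : Fin d → Fin q) (f g : MvPolynomial (Fin d) k) :
    boxCoord a (f * expand q g) = boxCoord a f * g := by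
  induction f using MvPolynomial.induction_on' with
  | add f f' hf hf' => simp [add_mul, hf, hf']
  | monomial u c =>
    induction g using MvPolynomial.induction_on' with
    | add g g' hg hg' => simp [mul_add, hg, hg']
    | monomial v e =>
      have hq : ∀ i, 0 < q := fun i => (Nat.zero_le _).trans_lt (a i).2
      rw [expand_monomial, monomial_mul, boxCoord_monomial, boxCoord_monomial]
      have h1 : (∀ i, (u + q • v) i % q = a i) ↔ ∀ i, u i % q = a i := by
        refine forall_congr' fun i => ?_
        simp
      have h2 : (u + q • v).mapRange (· / q) (Nat.zero_div q) =
          u.mapRange (· / q) (Nat.zero_div q) + v := by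
        ext i
        simp [Nat.add_mul_div_left _ _ (hq i)]
      simp only [h1, h2]
      split_ifs <;> simp [monomial_mul]

theorem sum_monomial_mul_expand_boxCoord {q : ℕ} (hq : 0 < q) (f : MvPolynomial (Fin d) k) :
    ∑ a : Fin d → Fin q, monomial (boxExponent a) 1 * expand q (boxCoord a f) = f := by
  induction f using MvPolynomial.induction_on' with
  | add f g hf hg =>
    simp only [map_add, mul_add, Finset.sum_add_distrib, hf, hg]
  | monomial u c =>
    let b : Fin d → Fin q := fun i => ⟨u i % q, Nat.mod_lt _ hq⟩
    rw [Finset.sum_eq_single b]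
    · rw [boxCoord_monomial, if_pos (fun i => rfl), expand_monomial, monomial_mul, one_mul]
      congr 2
      ext i
      simp [b, Nat.mod_add_div]
    · intro a _ hab
      rw [boxCoord_monomial, if_neg, map_zero, mul_zero]
      intro h
      exact hab (_root_.funext fun i => Fin.ext (h i).symm)
    · simp

theorem boxCoord_boxExponent {q : ℕ} (a b : Fin d → Fin q) :
    boxCoord a (monomial (boxExponent b) (1 : k)) = if a = b then 1 else 0 := by
  rw [boxCoord_monomial]
  have h : (∀ i, boxExponent b i % q = a i) ↔ a = b := by
    simp only [boxExponent_apply, Nat.mod_eq_of_lt (b _).2]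
    exact ⟨fun h => _root_.funext fun i => Fin.ext (h i).symm, fun h i => by rw [h]⟩
  simp only [h]
  split_ifs with hab
  · have : (boxExponent b).mapRange (· / q) (Nat.zero_div q) = 0 := by
      ext i
      simp [Nat.div_eq_of_lt (b i).2]
    rw [this]; rfl
  · rfl

theorem mem_map_expand_iff {q : ℕ} (hq : 0 < q) (I : Ideal (MvPolynomial (Fin d) k))
    (f : MvPolynomial (Fin d) k) :
    f ∈ I.map (expand q : MvPolynomial (Fin d) k →ₐ[k] MvPolynomial (Fin d) k) ↔
      ∀ a : Fin d → Fin q, boxCoord a f ∈ I := by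
  constructor
  · intro hf a
    suffices h : ∀ r, boxCoord a (r * f) ∈ I by simpa using h 1
    induction hf using Submodule.span_induction with
    | mem x hx =>
      obtain ⟨g, hg, rfl⟩ := hx
      intro r
      exact (congrArg (· ∈ I) (boxCoord_mul_expand a r g)).mpr (I.mul_mem_left _ hg)
    | zero => simp
    | add x y _ _ hx hy =>
      intro r
      rw [mul_add, map_add]
      exact I.add_mem (hx r) (hy r)
    | smul s x _ hx =>
      intro r
      rw [smul_eq_mul, ← mul_assoc]
      exact hx _
  · intro h
    rw [← sum_monomial_mul_expand_boxCoord hq f]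
    exact Ideal.sum_mem _ fun a _ => Ideal.mul_mem_left _ _ (Ideal.mem_map_of_mem _ (h a))

theorem IsHomogeneous.expand {f : MvPolynomial (Fin d) k} {n : ℕ} (q : ℕ)
    (hf : f.IsHomogeneous n) : (expand q f).IsHomogeneous (q * n) := by
  have h := hf.aeval (S := k) (fun i => (X i : MvPolynomial (Fin d) k) ^ q) (n := q)
    (fun i => isHomogeneous_X_pow i q)
  exact h

theorem IsHomogeneous.boxCoord {q : ℕ} (hq : 0 < q) (a : Fin d → Fin q)
    {f : MvPolynomial (Fin d) k} {n : ℕ}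
    (hf : f.IsHomogeneous ((boxExponent a).degree + q * n)) : (boxCoord a f).IsHomogeneous n := by
  intro v hv
  rw [coeff_boxCoord] at hv
  by_contra hne
  refine hv (hf.coeff_eq_zero ?_)
  rw [Pi.one_def, ← Finsupp.degree_eq_weight_one] at hne
  rw [map_add, map_nsmul, smul_eq_mul]
  intro h
  exact hne (Nat.eq_of_mul_eq_mul_left hq (Nat.add_left_cancel h))

theorem boxCoord_eq_zero {q : ℕ} (a : Fin d → Fin q)
    {f : MvPolynomial (Fin d) k} {m : ℕ} (hf : f.IsHomogeneous m)
    (hm : ¬ ((boxExponent a).degree ≤ m ∧ q ∣ m - (boxExponent a).degree)) :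
    boxCoord a f = 0 := by
  ext v
  rw [coeff_boxCoord, coeff_zero]
  refine hf.coeff_eq_zero fun h => hm ?_
  rw [map_add, map_nsmul, smul_eq_mul] at h
  exact ⟨by omega, v.degree, by omega⟩

theorem hilbertFn_map_expand {q : ℕ} (hq : 0 < q) (I : Ideal (MvPolynomial (Fin d) k)) (m : ℕ) :
    hilbertFn ((I.map (expand q : MvPolynomial (Fin d) k →ₐ[k] MvPolynomial (Fin d) k)).restrictScalars
      k) m =
      ∑ a : Fin d → Fin q,
        if (boxExponent a).degree ≤ m ∧ q ∣ m - (boxExponent a).degree then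
          hilbertFn (I.restrictScalars k) ((m - (boxExponent a).degree) / q) else 0 := by
  let W : (Fin d → Fin q) → Submodule k (MvPolynomial (Fin d) k) := fun a =>
    if (boxExponent a).degree ≤ m ∧ q ∣ m - (boxExponent a).degree then
      I.restrictScalars k ⊓ homogeneousSubmodule (Fin d) k ((m - (boxExponent a).degree) / q) else ⊥
  have hWpos : ∀ a, ((boxExponent a).degree ≤ m ∧ q ∣ m - (boxExponent a).degree) → W a =
      I.restrictScalars k ⊓ homogeneousSubmodule (Fin d) k ((m - (boxExponent a).degree) / q) :=
    fun a h => if_pos h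
  have hWneg : ∀ a, ¬ ((boxExponent a).degree ≤ m ∧ q ∣ m - (boxExponent a).degree) → W a = ⊥ :=
    fun a h => if_neg h
  clear_value W
  have hW : ∀ a, Module.finrank k (W a) =
      if (boxExponent a).degree ≤ m ∧ q ∣ m - (boxExponent a).degree then
        hilbertFn (I.restrictScalars k) ((m - (boxExponent a).degree) / q) else 0 := by
    intro a
    split_ifs with h
    · rw [hWpos a h]; rfl
    · rw [hWneg a h]; exact finrank_bot _ _
  have hWfin : ∀ a, Module.Finite k (W a) := by
    intro a
    by_cases h : (boxExponent a).degree ≤ m ∧ q ∣ m - (boxExponent a).degree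
    · rw [hWpos a h]; infer_instance
    · rw [hWneg a h]; infer_instance
  simp only [← hW]
  rw [← Module.finrank_pi_fintype]
  set V := (I.map (expand q : MvPolynomial (Fin d) k →ₐ[k] MvPolynomial (Fin d) k)).restrictScalars
      k ⊓ homogeneousSubmodule (Fin d) k m with hV
  have hmem : ∀ f ∈ V, ∀ a, boxCoord a f ∈ W a := by
    intro f hf a
    have h1 := (mem_map_expand_iff hq I f).1 hf.1 a
    have h2 : f.IsHomogeneous m := hf.2
    by_cases h : (boxExponent a).degree ≤ m ∧ q ∣ m - (boxExponent a).degree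
    · rw [hWpos a h]
      refine ⟨h1, IsHomogeneous.boxCoord hq a ?_⟩
      rwa [Nat.mul_div_cancel' h.2, Nat.add_sub_cancel' h.1]
    · rw [hWneg a h]
      exact (Submodule.mem_bot k).2 (boxCoord_eq_zero a h2 h)
  let Φ : V →ₗ[k] (∀ a, W a) := LinearMap.pi fun a =>
    ((boxCoord a).comp V.subtype).codRestrict (W a) fun f => hmem f f.2 a
  have hΦ : ∀ f a, (Φ f a : MvPolynomial (Fin d) k) = boxCoord a f := fun f a => rfl
  refine LinearEquiv.finrank_eq (LinearEquiv.ofBijective Φ ⟨?_, ?_⟩)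
  · intro f g hfg
    ext1
    rw [← sum_monomial_mul_expand_boxCoord hq (f : MvPolynomial (Fin d) k),
      ← sum_monomial_mul_expand_boxCoord hq (g : MvPolynomial (Fin d) k)]
    simp only [← hΦ, hfg]
  · intro w
    have hwI : ∀ a, (w a : MvPolynomial (Fin d) k) ∈ I := by
      intro a
      by_cases h : (boxExponent a).degree ≤ m ∧ q ∣ m - (boxExponent a).degree
      · have := (hWpos a h).le (w a).2
        exact this.1
      · have := (hWneg a h).le (w a).2
        rw [(Submodule.mem_bot k).1 this]
        exact I.zero_mem
    have hwh : ∀ a, (monomial (boxExponent a) (1 : k) *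
        expand q (w a : MvPolynomial (Fin d) k)).IsHomogeneous m := by
      intro a
      by_cases h : (boxExponent a).degree ≤ m ∧ q ∣ m - (boxExponent a).degree
      · have := (hWpos a h).le (w a).2
        obtain ⟨h3, c, hc⟩ := h
        have h4 : (w a : MvPolynomial (Fin d) k).IsHomogeneous
          ((m - (boxExponent a).degree) / q) := this.2
        rw [hc, Nat.mul_div_cancel_left _ hq] at h4
        have h5 := (isHomogeneous_monomial (1 : k) (rfl : (boxExponent a).degree = _)).mul
          (h4.expand q)
        rwa [← hc, Nat.add_sub_cancel' h3] at h5
      · have := (hWneg a h).le (w a).2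
        rw [(Submodule.mem_bot k).1 this, map_zero, mul_zero]
        exact isHomogeneous_zero _ _ _
    have hcoord : ∀ a, boxCoord a (∑ b, monomial (boxExponent b) (1 : k) *
        expand q (w b : MvPolynomial (Fin d) k)) = w a := by
      intro a
      rw [map_sum, Finset.sum_eq_single a]
      · rw [boxCoord_mul_expand, boxCoord_boxExponent, if_pos rfl, one_mul]
      · intro b _ hb
        rw [boxCoord_mul_expand, boxCoord_boxExponent, if_neg hb.symm, zero_mul]
      · simp
    refine ⟨⟨∑ a, monomial (boxExponent a) 1 * expand q (w a : MvPolynomial (Fin d) k), ?_, ?_⟩, ?_⟩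
    · refine Ideal.sum_mem _ fun a _ => Ideal.mul_mem_left _ _ (Ideal.mem_map_of_mem _ (hwI a))
    · exact IsHomogeneous.sum _ _ _ fun a _ => hwh a
    · funext a
      ext1
      rw [hΦ]
      exact hcoord a

theorem hilbertFn_map_map (e : k ≃+* k) (I : Ideal (MvPolynomial (Fin d) k)) (m : ℕ) :
    hilbertFn ((I.map (mapEquiv (Fin d) e)).restrictScalars k) m =
      hilbertFn (I.restrictScalars k) m := by
  have hmem : ∀ f, f ∈ I.restrictScalars k ⊓ homogeneousSubmodule (Fin d) k m ↔
      mapEquiv (Fin d) e f ∈ (I.map (mapEquiv (Fin d) e)).restrictScalars k ⊓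
        homogeneousSubmodule (Fin d) k m := by
    intro f
    refine and_congr ?_ ?_
    · refine ⟨fun h => Ideal.mem_map_of_mem _ h, fun h => ?_⟩
      obtain ⟨x, hx, hxf⟩ := (Ideal.mem_map_of_equiv _ _).1 h
      rwa [← (mapEquiv (Fin d) e).injective hxf]
    · exact ⟨fun h => h.map _, fun h => h.of_map e.injective⟩
  let E : ↥(I.restrictScalars k ⊓ homogeneousSubmodule (Fin d) k m) ≃+
      ↥((I.map (mapEquiv (Fin d) e)).restrictScalars k ⊓ homogeneousSubmodule (Fin d) k m) :=
    { (mapEquiv (Fin d) e).toEquiv.subtypeEquiv hmem with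
      map_add' := fun x y => Subtype.ext (map_add (mapEquiv (Fin d) e) x.1 y.1) }
  have h := rank_eq_of_equiv_equiv (R := k) (R' := k) e E e.bijective (by
    intro c x
    refine Subtype.ext ?_
    change mapEquiv (Fin d) e (c • x.1) = e c • mapEquiv (Fin d) e x.1
    simp [smul_eq_C_mul])
  exact (congrArg Cardinal.toNat h).symm

theorem map_iterateFrobenius (p : ℕ) [Fact p.Prime] [CharP k p] [PerfectField k] (n : ℕ)
    (I : Ideal (MvPolynomial (Fin d) k)) :
    I.map (iterateFrobenius (MvPolynomial (Fin d) k) p n) =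
      (I.map (mapEquiv (Fin d) (iterateFrobeniusEquiv k p n) : MvPolynomial (Fin d) k →+* MvPolynomial (Fin d) k)).map
        (expand (p ^ n) : MvPolynomial (Fin d) k →ₐ[k] MvPolynomial (Fin d) k).toRingHom := by
  rw [Ideal.map_map]
  congr 1
  refine ringHom_ext (fun c => ?_) fun i => ?_
  · simp [iterateFrobenius_def]
  · simp [iterateFrobenius_def]

theorem hilbertFn_map_iterateFrobenius (p : ℕ) [Fact p.Prime] [CharP k p] [PerfectField k] (n : ℕ)
    (I : Ideal (MvPolynomial (Fin d) k)) (m : ℕ) :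
    hilbertFn ((I.map (iterateFrobenius (MvPolynomial (Fin d) k) p n)).restrictScalars k) m =
      ∑ a : Fin d → Fin (p ^ n),
        if (boxExponent a).degree ≤ m ∧ p ^ n ∣ m - (boxExponent a).degree then
          hilbertFn (I.restrictScalars k) ((m - (boxExponent a).degree) / p ^ n) else 0 := by
  rw [map_iterateFrobenius]
  refine (hilbertFn_map_expand (pow_pos (Fact.out : p.Prime).pos n) _ m).trans ?_
  refine Finset.sum_congr rfl fun a _ => ?_
  split_ifs
  · exact hilbertFn_map_map _ _ _
  · rfl

theorem hilbertFn_top_eq_sum (p : ℕ) [Fact p.Prime] [CharP k p] [PerfectField k] (n : ℕ) (m : ℕ) :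
    hilbertFn (⊤ : Submodule k (MvPolynomial (Fin d) k)) m =
      ∑ a : Fin d → Fin (p ^ n),
        if (boxExponent a).degree ≤ m ∧ p ^ n ∣ m - (boxExponent a).degree then
          hilbertFn (⊤ : Submodule k (MvPolynomial (Fin d) k))
            ((m - (boxExponent a).degree) / p ^ n) else 0 := by
  have h := hilbertFn_map_iterateFrobenius (k := k) (d := d) p n ⊤ m
  rwa [Ideal.map_top] at h

theorem hilbertFn_colength_eq_coeff (p : ℕ) [Fact p.Prime] [CharP k p] [PerfectField k]
    (I : Ideal (MvPolynomial (Fin d) k)) (h : Polynomial ℤ)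
    (hh : ∀ j, h.coeff j = (hilbertFn (⊤ : Submodule k (MvPolynomial (Fin d) k)) j : ℤ) -
      hilbertFn (I.restrictScalars k) j) (n m : ℕ) :
    (hilbertFn (⊤ : Submodule k (MvPolynomial (Fin d) k)) m : ℤ) -
      hilbertFn ((I.map (iterateFrobenius (MvPolynomial (Fin d) k) p n)).restrictScalars k) m =
    ((∑ i ∈ Finset.range (p ^ n), Polynomial.X ^ i) ^ d *
      Polynomial.expand ℤ (p ^ n) h).coeff m := by
  have hq : 0 < p ^ n := pow_pos (Fact.out : p.Prime).pos n
  rw [Finset.sum_range, Fintype.sum_pow, Finset.sum_mul, Polynomial.finsetSum_coeff,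
    hilbertFn_top_eq_sum p n m, hilbertFn_map_iterateFrobenius]
  push_cast
  rw [← Finset.sum_sub_distrib]
  refine Finset.sum_congr rfl fun a _ => ?_
  rw [Finset.prod_pow_eq_pow_sum, ← degree_boxExponent, Polynomial.coeff_X_pow_mul',
    Polynomial.coeff_expand hq, hh]
  by_cases h1 : (boxExponent a).degree ≤ m <;>
    by_cases h2 : p ^ n ∣ m - (boxExponent a).degree <;> simp [h1, h2]

end MvPolynomial

namespace Polynomial

theorem coeff_geomSum_pow_mul_expand (e q : ℕ) (h : Polynomial ℤ) (m : ℕ) :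
    ((∑ i ∈ Finset.range q, X ^ i) ^ (e + 1) * expand ℤ q h).coeff m =
      ∑ j ∈ Finset.range (((1 - X) ^ (e + 1) * h).natDegree + 1),
        ((1 - X) ^ (e + 1) * h).coeff j * if q * j ≤ m then ((e + (m - q * j)).choose e : ℤ) else 0 := by
  set K := (1 - X) ^ (e + 1) * h with hK
  have h1 : (1 - X) ^ (e + 1) * ((∑ i ∈ Finset.range q, X ^ i) ^ (e + 1) * expand ℤ q h) =
      expand ℤ q K := by
    rw [hK, map_mul, map_pow, map_sub, map_one, expand_X, ← mul_assoc, ← mul_pow,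
      mul_neg_geom_sum]
  set P := (∑ i ∈ Finset.range q, X ^ i) ^ (e + 1) * expand ℤ q h
  have h2 : (P : PowerSeries ℤ) =
      (PowerSeries.mk fun n ↦ ((e + n).choose e : ℤ)) * (expand ℤ q K : PowerSeries ℤ) := by
    clear_value P
    rw [← h1, coe_mul, ← mul_assoc, coe_pow, coe_sub, coe_one, coe_X,
      PowerSeries.mk_add_choose_mul_one_sub_pow_eq_one, one_mul]
  have h3 : (expand ℤ q K : PowerSeries ℤ) =
      ∑ j ∈ Finset.range (K.natDegree + 1), PowerSeries.C (K.coeff j) * PowerSeries.X ^ (q * j) := by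
    conv_lhs => rw [K.as_sum_range_C_mul_X_pow]
    rw [map_sum]
    simp only [map_mul, map_pow, expand_C, expand_X, ← pow_mul]
    rw [← coeToPowerSeries.ringHom_apply, map_sum]
    simp only [coeToPowerSeries.ringHom_apply, coe_mul, coe_C, coe_pow, coe_X]
  rw [← coeff_coe, h2, h3, Finset.mul_sum, map_sum]
  refine Finset.sum_congr rfl fun j _ => ?_
  rw [mul_left_comm, PowerSeries.coeff_C_mul, PowerSeries.coeff_mul_X_pow']
  simp

theorem coeff_geomSum_pow_mul_expand_eq_zero (d q : ℕ) (hq : 0 < q) (h : Polynomial ℤ) (m : ℕ)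
    (hm : q * (d + h.natDegree + 1) ≤ m) :
    ((∑ i ∈ Finset.range q, X ^ i) ^ d * expand ℤ q h).coeff m = 0 := by
  refine coeff_eq_zero_of_natDegree_lt (natDegree_mul_le.trans_lt ?_)
  have h1 : ((∑ i ∈ Finset.range q, (X : Polynomial ℤ) ^ i) ^ d).natDegree ≤ d * q := by
    refine natDegree_pow_le.trans (Nat.mul_le_mul_left _ ?_)
    refine natDegree_sum_le_of_forall_le _ _ fun i hi => ?_
    rw [natDegree_X_pow]
    exact (Finset.mem_range.1 hi).le
  rw [natDegree_expand]
  nlinarith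

end Polynomial

namespace MvPolynomial

variable {k : Type*} [Field k] {d : ℕ}

/-- A subspace of the polynomial ring is graded if it contains the homogeneous components of its
elements. -/
def IsGraded (V : Submodule k (MvPolynomial (Fin d) k)) : Prop :=
  ∀ f ∈ V, ∀ n, homogeneousComponent n f ∈ V

theorem isGraded_span {s : Set (MvPolynomial (Fin d) k)} (hs : ∀ f ∈ s, ∃ n, f.IsHomogeneous n) :
    IsGraded ((Ideal.span s).restrictScalars k) := by
  let _ := gradedAlgebra (σ := Fin d) (R := k)
  have h : (Ideal.span s).IsHomogeneous (homogeneousSubmodule (Fin d) k) :=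
    Ideal.homogeneous_span _ _ fun f hf => hs f hf
  intro f hf n
  have := h n hf
  rwa [← decomposition.decompose'_apply f n]

theorem exists_homogeneousSubmodule_le (I : Ideal (MvPolynomial (Fin d) k))
    (hI : IsGraded (I.restrictScalars k)) [FiniteDimensional k (MvPolynomial (Fin d) k ⧸ I)] :
    ∃ N, ∀ j, N ≤ j → homogeneousSubmodule (Fin d) k j ≤ I.restrictScalars k := by
  let T := {j | ¬ homogeneousSubmodule (Fin d) k j ≤ I.restrictScalars k}
  have hT : ∀ j : T, ∃ f ∈ homogeneousSubmodule (Fin d) k j, f ∉ I := fun j =>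
    Set.not_subset.1 j.2
  choose f hf hfI using hT
  have hli : LinearIndependent k fun j : T => Ideal.Quotient.mkₐ k I (f j) := by
    rw [linearIndependent_iff']
    intro s g hg i hi
    have h1 : ∑ i ∈ s, g i • f i ∈ I := by
      rw [← Ideal.Quotient.eq_zero_iff_mem, ← Ideal.Quotient.mkₐ_eq_mk k, map_sum]
      simpa using hg
    have h2 := hI _ h1 i
    have h3 : ∀ j ∈ s, j ≠ i → homogeneousComponent (i : ℕ) (g j • f j) = 0 := fun j _ hj => by
      rw [map_smul, homogeneousComponent_of_mem (hf j), if_neg (fun h => hj (Subtype.ext h.symm)),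
        smul_zero]
    rw [map_sum, Finset.sum_eq_single_of_mem i hi h3, map_smul,
      homogeneousComponent_of_mem (hf i), if_pos rfl] at h2
    by_contra hne
    exact hfI i ((Submodule.smul_mem_iff _ hne).1 h2)
  have hfin : T.Finite := Set.finite_coe_iff.1 hli.finite
  obtain ⟨N, hN⟩ := hfin.bddAbove
  exact ⟨N + 1, fun j hj => by_contra fun h => absurd (hN h) (by omega)⟩

theorem exists_coeff_eq_hilbertFn (I : Ideal (MvPolynomial (Fin d) k))
    (hI : IsGraded (I.restrictScalars k)) [FiniteDimensional k (MvPolynomial (Fin d) k ⧸ I)] :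
    ∃ h : Polynomial ℤ, ∀ j, h.coeff j =
      (hilbertFn (⊤ : Submodule k (MvPolynomial (Fin d) k)) j : ℤ) -
        hilbertFn (I.restrictScalars k) j := by
  obtain ⟨N, hN⟩ := exists_homogeneousSubmodule_le I hI
  refine ⟨∑ j ∈ Finset.range N, Polynomial.monomial j
    ((hilbertFn (⊤ : Submodule k (MvPolynomial (Fin d) k)) j : ℤ) -
        hilbertFn (I.restrictScalars k) j), fun j => ?_⟩
  rw [Polynomial.finsetSum_coeff]
  simp only [Polynomial.coeff_monomial, Finset.sum_ite_eq', Finset.mem_range]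
  split_ifs with hj
  · rfl
  · rw [hilbertFn, hilbertFn, inf_eq_right.2 (hN j (not_lt.1 hj)), top_inf_eq, sub_self]

end MvPolynomial

/-- The limit of the coefficients of `((1 + X + ⋯ + X ^ (q - 1)) ^ (e + 1)) * h (X ^ q)` in degrees
close to `q * y`, normalised by `q ^ e`. -/
def coeffDensity (e : ℕ) (h : Polynomial ℤ) (y : ℝ) : ℝ :=
  ∑ j ∈ Finset.range (((1 - Polynomial.X) ^ (e + 1) * h).natDegree + 1),
    (((1 - Polynomial.X) ^ (e + 1) * h).coeff j : ℝ) * (max (y - j) 0 ^ e / e.factorial)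

theorem tendsto_natCast_sub_div {ι : Type*} {l : Filter ι} {u Q : ι → ℕ} (hQ : Tendsto Q l atTop)
    {y : ℝ} (hu : Tendsto (fun n => (u n : ℝ) / Q n) l (𝓝 y)) (j : ℕ) :
    Tendsto (fun n => ((u n - Q n * j : ℕ) : ℝ) / Q n) l (𝓝 (max (y - j) 0)) := by
  refine Tendsto.congr' ?_ ((hu.sub_const (j : ℝ)).max (tendsto_const_nhds (x := (0 : ℝ))))
  filter_upwards [hQ.eventually_gt_atTop 0] with n hn
  have hn' : (0 : ℝ) < Q n := Nat.cast_pos.2 hn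
  have h1 : ((u n - Q n * j : ℕ) : ℝ) = max ((u n : ℝ) - Q n * j) 0 := by
    rcases le_total (Q n * j) (u n) with h | h
    · rw [Nat.cast_sub h, max_eq_left]
      · push_cast; rfl
      · rw [sub_nonneg]; exact_mod_cast h
    · rw [Nat.sub_eq_zero_of_le h, max_eq_right]
      · simp
      · rw [sub_nonpos]; exact_mod_cast h
  rw [h1, ← max_div_div_right hn'.le, zero_div, sub_div, mul_div_cancel_left₀ _ hn'.ne']

theorem tendsto_choose_div_pow {ι : Type*} {l : Filter ι} {u Q : ι → ℕ} (hQ : Tendsto Q l atTop)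
    {y : ℝ} (hu : Tendsto (fun n => (u n : ℝ) / Q n) l (𝓝 y)) {e : ℕ} (he : e ≠ 0) (j : ℕ) :
    Tendsto (fun n => ((if Q n * j ≤ u n then ((e + (u n - Q n * j)).choose e : ℤ) else 0 : ℤ) : ℝ)
      / (Q n : ℝ) ^ e) l (𝓝 (max (y - j) 0 ^ e / e.factorial)) := by
  have h1 := tendsto_natCast_sub_div hQ hu j
  have h2 : Tendsto (fun n => (e : ℝ) / Q n) l (𝓝 0) :=
    tendsto_const_nhds.div_atTop (tendsto_natCast_atTop_atTop.comp hQ)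
  have hup := ((h2.add h1).pow e).div_const (e.factorial : ℝ)
  rw [zero_add] at hup
  refine tendsto_of_tendsto_of_tendsto_of_le_of_le ((h1.pow e).div_const (e.factorial : ℝ)) hup
    (fun n => ?_) (fun n => ?_)
  · dsimp only
    rw [div_pow, div_right_comm]
    gcongr
    split_ifs with h
    · have := Nat.pow_le_choose (α := ℝ) e (e + (u n - Q n * j))
      rw [Int.cast_natCast]
      rw [Nat.add_assoc, Nat.add_sub_cancel_left] at this
      refine le_trans ?_ this
      gcongr
      exact Nat.le_succ _
    · rw [Nat.sub_eq_zero_of_le (by omega)]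
      simp [he]
  · dsimp only
    rw [← add_div, div_pow, div_right_comm]
    gcongr
    split_ifs with h
    · have := Nat.choose_le_pow_div (α := ℝ) e (e + (u n - Q n * j))
      rw [Int.cast_natCast]
      exact_mod_cast this
    · rw [Int.cast_zero]
      positivity

theorem tendsto_coeff_div_pow {ι : Type*} {l : Filter ι} {u Q : ι → ℕ} (hQ : Tendsto Q l atTop)
    {y : ℝ} (hu : Tendsto (fun n => (u n : ℝ) / Q n) l (𝓝 y)) {e : ℕ} (he : e ≠ 0)
    (h : Polynomial ℤ) :
    Tendsto (fun n => ((((∑ i ∈ Finset.range (Q n), Polynomial.X ^ i) ^ (e + 1) *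
      Polynomial.expand ℤ (Q n) h).coeff (u n) : ℤ) : ℝ) / (Q n : ℝ) ^ e) l
      (𝓝 (coeffDensity e h y)) := by
  simp only [Polynomial.coeff_geomSum_pow_mul_expand, Int.cast_sum, Int.cast_mul, Finset.sum_div,
    mul_div_assoc]
  exact tendsto_finsetSum _ fun j _ => (tendsto_choose_div_pow hQ hu he j).const_mul _

theorem coeffDensity_eq_zero {e : ℕ} (he : e ≠ 0) (h : Polynomial ℤ) {y : ℝ}
    (hy : ((e + 1 + h.natDegree + 1 : ℕ) : ℝ) ≤ y) : coeffDensity e h y = 0 := by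
  have hy0 : 0 ≤ y := (Nat.cast_nonneg _).trans hy
  have hu : Tendsto (fun n : ℕ => (⌈y * n⌉₊ : ℝ) / n) atTop (𝓝 y) :=
    (tendsto_nat_ceil_mul_div_atTop hy0).comp tendsto_natCast_atTop_atTop
  refine tendsto_nhds_unique (tendsto_coeff_div_pow tendsto_id hu he h)
    (tendsto_const_nhds.congr' ?_)
  filter_upwards [eventually_gt_atTop 0] with n hn
  rw [id, Polynomial.coeff_geomSum_pow_mul_expand_eq_zero (e + 1) n hn, Int.cast_zero, zero_div]
  refine Nat.cast_le (α := ℝ).1 (le_trans ?_ (Nat.le_ceil _))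
  rw [Nat.cast_mul, mul_comm]
  gcongr

theorem coeffDensity_eq_eval {e : ℕ} (he : e ≠ 0) (h : Polynomial ℤ) {i : ℕ} {y : ℝ}
    (hy : y ∈ Set.Icc (i : ℝ) (i + 1)) :
    coeffDensity e h y = (∑ j ∈ (Finset.range (((1 - Polynomial.X) ^ (e + 1) * h).natDegree + 1)).filter (· ≤ i),
      Polynomial.C ((((1 - Polynomial.X) ^ (e + 1) * h).coeff j : ℝ) / e.factorial) *
        (Polynomial.X - Polynomial.C (j : ℝ)) ^ e).eval y := by
  rw [Polynomial.eval_finsetSum, Finset.sum_filter, coeffDensity]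
  refine Finset.sum_congr rfl fun j _ => ?_
  split_ifs with hj
  · have : (j : ℝ) ≤ i := Nat.cast_le.2 hj
    rw [max_eq_left (by linarith [hy.1])]
    simp
    ring
  · have : (i : ℝ) + 1 ≤ j := by exact_mod_cast not_le.1 hj
    rw [max_eq_right (by linarith [hy.2]), zero_pow he, zero_div, mul_zero]

namespace MvPolynomial

variable {k : Type*} [Field k] {d : ℕ}

theorem IsHomogeneous.homogeneousComponent_mul {f : MvPolynomial (Fin d) k} {m : ℕ}
    (hf : f.IsHomogeneous m) (g : MvPolynomial (Fin d) k) (n : ℕ) :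
    homogeneousComponent n (g * f) =
      if m ≤ n then homogeneousComponent (n - m) g * f else 0 := by
  conv_lhs => rw [← sum_homogeneousComponent g, Finset.sum_mul, map_sum]
  have h : ∀ i, homogeneousComponent n (homogeneousComponent i g * f) =
      if n = i + m then homogeneousComponent i g * f else 0 := fun i =>
    homogeneousComponent_of_mem ((homogeneousComponent_isHomogeneous i g).mul hf)
  simp only [h]
  split_ifs with hmn
  · rw [Finset.sum_congr rfl (g := fun i => if n - m = i then
      homogeneousComponent i g * f else 0) fun i _ => if_congr (by omega) rfl rfl,
      Finset.sum_ite_eq]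
    split_ifs with hi
    · rfl
    · rw [homogeneousComponent_eq_zero _ _ (by simp at hi; omega), zero_mul]
  · exact Finset.sum_eq_zero fun i _ => if_neg (by omega)

/-- The subspace of the polynomial ring underlying an ideal of a subalgebra. -/
def idealSubmodule {A : Subalgebra k (MvPolynomial (Fin d) k)} (J : Ideal A) :
    Submodule k (MvPolynomial (Fin d) k) :=
  (J.restrictScalars k).map A.val.toLinearMap

theorem coe_mem_idealSubmodule {A : Subalgebra k (MvPolynomial (Fin d) k)} {J : Ideal A} {a : A} :
    (a : MvPolynomial (Fin d) k) ∈ idealSubmodule J ↔ a ∈ J :=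
  ⟨fun ⟨_, hb, h⟩ => Subtype.ext h ▸ hb, fun h => ⟨a, h, rfl⟩⟩

theorem exists_linearIndependent_monomial (A : Subalgebra k (MvPolynomial (Fin d) k))
    [Module.Finite A (MvPolynomial (Fin d) k)] :
    ∃ s : Finset (Fin d →₀ ℕ), s.Nonempty ∧
      LinearIndependent A (fun u : s => (monomial (u : Fin d →₀ ℕ) 1 : MvPolynomial (Fin d) k)) ∧
      ∃ c : A, c ≠ 0 ∧ ∀ f : MvPolynomial (Fin d) k, ∃ a : s → A,
        ∑ u, a u • (monomial (u : Fin d →₀ ℕ) 1 : MvPolynomial (Fin d) k) = c • f := by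
  classical
  obtain ⟨s, hs, hmax⟩ := exists_maximal_linearIndepOn A
    (fun u : Fin d →₀ ℕ => (monomial u 1 : MvPolynomial (Fin d) k))
  have hsfin : s.Finite := Set.finite_coe_iff.1 (LinearIndependent.finite hs)
  lift s to Finset (Fin d →₀ ℕ) using hsfin
  set N := Submodule.span A
    ((fun u : Fin d →₀ ℕ => (monomial u 1 : MvPolynomial (Fin d) k)) '' s) with hN
  have hex : ∀ f : MvPolynomial (Fin d) k, ∃ a : A, a ≠ 0 ∧ a • f ∈ N := by
    intro f
    induction f using MvPolynomial.induction_on' with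
    | monomial u x =>
      have h1 : ∃ a : A, a ≠ 0 ∧ a • (monomial u 1 : MvPolynomial (Fin d) k) ∈ N := by
        by_cases hu : u ∈ (s : Set (Fin d →₀ ℕ))
        · exact ⟨1, one_ne_zero, by
            rw [one_smul]; exact Submodule.subset_span ⟨u, hu, rfl⟩⟩
        · exact hmax u hu
      obtain ⟨a, ha, hau⟩ := h1
      refine ⟨a, ha, ?_⟩
      have h2 : a • (monomial u x : MvPolynomial (Fin d) k) =
          (algebraMap k A x) • a • (monomial u 1 : MvPolynomial (Fin d) k) := by
        rw [algebraMap_smul, smul_comm, smul_monomial, smul_eq_mul, mul_one]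
      rw [h2]
      exact N.smul_mem _ hau
    | add f g hf hg =>
      obtain ⟨a, ha, haf⟩ := hf
      obtain ⟨b, hb, hbg⟩ := hg
      refine ⟨a * b, mul_ne_zero ha hb, ?_⟩
      rw [smul_add]
      refine N.add_mem ?_ ?_
      · rw [mul_comm, mul_smul]; exact N.smul_mem _ haf
      · rw [mul_smul]; exact N.smul_mem _ hbg
  choose a ha haN using hex
  obtain ⟨T, hT⟩ := (Module.Finite.fg_top : (⊤ : Submodule A (MvPolynomial (Fin d) k)).FG)
  have hcN : ∀ f : MvPolynomial (Fin d) k, (∏ t ∈ T, a t) • f ∈ N := by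
    intro f
    have hf : f ∈ Submodule.span A (T : Set (MvPolynomial (Fin d) k)) := hT ▸ Submodule.mem_top
    induction hf using Submodule.span_induction with
    | mem x hx =>
      rw [← Finset.mul_prod_erase T a hx, mul_comm, mul_smul]
      exact N.smul_mem _ (haN x)
    | zero => rw [smul_zero]; exact N.zero_mem
    | add x y _ _ hx hy => rw [smul_add]; exact N.add_mem hx hy
    | smul b x _ hx => rw [smul_comm]; exact N.smul_mem _ hx
  have hc : ∏ t ∈ T, a t ≠ 0 := Finset.prod_ne_zero_iff.2 fun t _ => ha t
  generalize ∏ t ∈ T, a t = c at hc hcN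
  refine ⟨s, ?_, hs, c, hc, fun f => ?_⟩
  swap
  · obtain ⟨a, ha⟩ := (Submodule.mem_span_image_finset_iff_exists_fun A).1 (hcN f)
    exact ⟨a, ha⟩
  by_contra hempty
  rw [Finset.not_nonempty_iff_eq_empty] at hempty
  have h1 := hcN 1
  rw [hN, hempty, Finset.coe_empty, Set.image_empty, Submodule.span_empty, Submodule.mem_bot,
    Algebra.smul_def, mul_one] at h1
  exact hc (Subtype.ext h1)

theorem sum_hilbertFn_le {A : Subalgebra k (MvPolynomial (Fin d) k)} {s : Finset (Fin d →₀ ℕ)}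
    (hs : LinearIndependent A
      (fun u : s => (monomial (u : Fin d →₀ ℕ) 1 : MvPolynomial (Fin d) k)))
    (J : Ideal A) {m : ℕ} (hm : ∀ u ∈ s, u.degree ≤ m) :
    ∑ u ∈ s, hilbertFn (idealSubmodule J) (m - u.degree) ≤
      hilbertFn ((J.map (algebraMap A (MvPolynomial (Fin d) k))).restrictScalars k) m := by
  let Φ : ((u : s) → ↥(idealSubmodule J ⊓ homogeneousSubmodule (Fin d) k (m - (u : Fin d →₀ ℕ).degree))) →ₗ[k]
      MvPolynomial (Fin d) k :=
    ∑ u : s, (LinearMap.mulRight k (monomial (u : Fin d →₀ ℕ) 1 : MvPolynomial (Fin d) k)) ∘ₗ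
      Submodule.subtype _ ∘ₗ LinearMap.proj u
  have hΦ : ∀ x, Φ x = ∑ u : s, (x u : MvPolynomial (Fin d) k) * monomial (u : Fin d →₀ ℕ) 1 :=
    fun x => by simp [Φ]
  have hmem : ∀ x, Φ x ∈ (J.map (algebraMap A (MvPolynomial (Fin d) k))).restrictScalars k ⊓
      homogeneousSubmodule (Fin d) k m := by
    intro x
    rw [hΦ]
    refine Submodule.sum_mem _ fun u _ => ⟨?_, ?_⟩
    · obtain ⟨b, hb, hbx⟩ := (x u).2.1
      refine Ideal.mul_mem_right _ _ ?_
      rw [← hbx]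
      exact Ideal.mem_map_of_mem _ hb
    · have h1 := IsHomogeneous.mul (x u).2.2
        (isHomogeneous_monomial (1 : k) (rfl : (u : Fin d →₀ ℕ).degree = _))
      rwa [Nat.sub_add_cancel (hm u u.2)] at h1
  have hinj : Function.Injective (Φ.codRestrict _ hmem) := by
    rw [← LinearMap.ker_eq_bot, LinearMap.ker_codRestrict, LinearMap.ker_eq_bot']
    intro x hx
    rw [hΦ] at hx
    have h1 : ∀ u, ∃ b : A, (b : MvPolynomial (Fin d) k) = x u := fun u => by
      obtain ⟨b, _, hbx⟩ := (x u).2.1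
      exact ⟨b, hbx⟩
    choose b hb using h1
    have h2 := Fintype.linearIndependent_iff.1 hs b (by
      rw [← hx]
      exact Finset.sum_congr rfl fun u _ => by rw [Algebra.smul_def, ← hb]; rfl)
    funext u
    refine Subtype.ext ?_
    rw [← hb, h2]
    rfl
  have := LinearMap.finrank_le_finrank_of_injective hinj
  rw [Module.finrank_pi_fintype] at this
  rw [← Finset.sum_coe_sort]
  exact this

theorem hilbertFn_map_le {A : Subalgebra k (MvPolynomial (Fin d) k)} {s : Finset (Fin d →₀ ℕ)}
    {c : A} (hc0 : c ≠ 0) {γ : ℕ} (hcγ : (c : MvPolynomial (Fin d) k).IsHomogeneous γ)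
    (hc : ∀ f : MvPolynomial (Fin d) k, ∃ a : s → A,
        ∑ u, a u • (monomial (u : Fin d →₀ ℕ) 1 : MvPolynomial (Fin d) k) = c • f)
    (hγ : ∀ u ∈ s, u.degree ≤ γ)
    (J : Ideal A) (hJ : IsGraded (idealSubmodule J)) (m : ℕ) :
    hilbertFn ((J.map (algebraMap A (MvPolynomial (Fin d) k))).restrictScalars k) m ≤
      ∑ u ∈ s, hilbertFn (idealSubmodule J) (m + γ - u.degree) := by
  let Φ : ((u : s) → ↥(idealSubmodule J ⊓ homogeneousSubmodule (Fin d) k (m + γ - (u : Fin d →₀ ℕ).degree))) →ₗ[k]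
      MvPolynomial (Fin d) k :=
    ∑ u : s, (LinearMap.mulRight k (monomial (u : Fin d →₀ ℕ) 1 : MvPolynomial (Fin d) k)) ∘ₗ
      Submodule.subtype _ ∘ₗ LinearMap.proj u
  have hΦ : ∀ x, Φ x = ∑ u : s, (x u : MvPolynomial (Fin d) k) * monomial (u : Fin d →₀ ℕ) 1 :=
    fun x => by simp [Φ]
  have hcoef : ∀ f ∈ J.map (algebraMap A (MvPolynomial (Fin d) k)), ∃ a : s → A, (∀ u, a u ∈ J) ∧
      ∑ u, a u • (monomial (u : Fin d →₀ ℕ) 1 : MvPolynomial (Fin d) k) = c • f := by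
    intro f hf
    have hf' : f ∈ J • (⊤ : Submodule A (MvPolynomial (Fin d) k)) := by
      rw [Ideal.smul_top_eq_map]; exact hf
    induction hf' using Submodule.smul_induction_on' with
    | smul r hr x _ =>
      obtain ⟨a, ha⟩ := hc x
      refine ⟨fun u => r * a u, fun u => J.mul_mem_right _ hr, ?_⟩
      simp only [mul_smul]
      rw [← Finset.smul_sum, ha, smul_comm]
    | add x hx y hy hx' hy' =>
      rw [Ideal.smul_top_eq_map] at hx hy
      obtain ⟨a, ha, hax⟩ := hx' hx
      obtain ⟨b, hb, hby⟩ := hy' hy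
      refine ⟨fun u => a u + b u, fun u => J.add_mem (ha u) (hb u), ?_⟩
      simp only [add_smul, Finset.sum_add_distrib, hax, hby, smul_add]
  have hle : ((J.map (algebraMap A (MvPolynomial (Fin d) k))).restrictScalars k ⊓
      homogeneousSubmodule (Fin d) k m).map
        (LinearMap.mulLeft k (c : MvPolynomial (Fin d) k)) ≤ LinearMap.range Φ := by
    rintro _ ⟨f, ⟨hf, hfm⟩, rfl⟩
    obtain ⟨a, ha, hac⟩ := hcoef f hf
    refine ⟨fun u => ⟨homogeneousComponent (m + γ - (u : Fin d →₀ ℕ).degree) (a u).1,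
      hJ _ (coe_mem_idealSubmodule.2 (ha u)) _, homogeneousComponent_isHomogeneous _ _⟩, ?_⟩
    rw [hΦ]
    have h1 : homogeneousComponent (m + γ) (c • f) = (c : MvPolynomial (Fin d) k) * f := by
      rw [Algebra.smul_def, add_comm]
      exact homogeneousComponent_eq_self (hcγ.mul hfm)
    rw [LinearMap.mulLeft_apply, ← h1, ← hac, map_sum]
    refine Finset.sum_congr rfl fun u _ => ?_
    rw [Algebra.smul_def, (isHomogeneous_monomial (1 : k)
      (rfl : (u : Fin d →₀ ℕ).degree = _)).homogeneousComponent_mul,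
      if_pos ((hγ u u.2).trans (Nat.le_add_left _ _))]
    rfl
  have hinj : Function.Injective (LinearMap.mulLeft k (c : MvPolynomial (Fin d) k)) :=
    mul_right_injective₀ fun h => hc0 (Subtype.ext h)
  rw [hilbertFn, (Submodule.equivMapOfInjective _ hinj _).finrank_eq]
  refine (Submodule.finrank_mono hle).trans ((LinearMap.finrank_range_le Φ).trans ?_)
  rw [Module.finrank_pi_fintype]
  exact (Finset.sum_coe_sort s fun u => hilbertFn (idealSubmodule J) (m + γ - u.degree)).le

theorem exists_homogeneous_denominator {A : Subalgebra k (MvPolynomial (Fin d) k)}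
    (hA : IsGraded (Subalgebra.toSubmodule A)) {s : Finset (Fin d →₀ ℕ)} {c : A} (hc0 : c ≠ 0)
    (hc : ∀ f : MvPolynomial (Fin d) k, ∃ a : s → A,
        ∑ u, a u • (monomial (u : Fin d →₀ ℕ) 1 : MvPolynomial (Fin d) k) = c • f) :
    ∃ c' : A, c' ≠ 0 ∧ ∃ γ, (c' : MvPolynomial (Fin d) k).IsHomogeneous γ ∧
      ∀ f : MvPolynomial (Fin d) k, ∃ a : s → A,
        ∑ u, a u • (monomial (u : Fin d →₀ ℕ) 1 : MvPolynomial (Fin d) k) = c' • f := by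
  obtain ⟨γ, hγ⟩ : ∃ γ, homogeneousComponent γ (c : MvPolynomial (Fin d) k) ≠ 0 := by
    by_contra! h
    refine hc0 (Subtype.ext ?_)
    rw [← sum_homogeneousComponent (c : MvPolynomial (Fin d) k)]
    exact Finset.sum_eq_zero fun i _ => h i
  refine ⟨⟨_, hA _ c.2 γ⟩, fun h => hγ (congrArg Subtype.val h), γ,
    homogeneousComponent_isHomogeneous _ _, fun f => ?_⟩
  induction f using MvPolynomial.induction_on' with
  | monomial v x =>
    obtain ⟨a, ha⟩ := hc (monomial v x)
    refine ⟨fun u => if (u : Fin d →₀ ℕ).degree ≤ γ + v.degree then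
      ⟨_, hA _ (a u).2 (γ + v.degree - (u : Fin d →₀ ℕ).degree)⟩ else 0, ?_⟩
    have h1 := congrArg (homogeneousComponent (γ + v.degree)) ha
    rw [Algebra.smul_def, (isHomogeneous_monomial x
      (rfl : v.degree = _)).homogeneousComponent_mul, if_pos (Nat.le_add_left _ _),
      Nat.add_sub_cancel, map_sum] at h1
    rw [Algebra.smul_def]
    refine Eq.trans (Finset.sum_congr rfl fun u _ => ?_) h1
    rw [Algebra.smul_def, Algebra.smul_def, (isHomogeneous_monomial (1 : k)
      (rfl : (u : Fin d →₀ ℕ).degree = _)).homogeneousComponent_mul]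
    split_ifs with hu
    · simp only [if_pos hu]
      rfl
    · simp only [if_neg hu, map_zero, zero_mul]
  | add f g hf hg =>
    obtain ⟨a, ha⟩ := hf
    obtain ⟨b, hb⟩ := hg
    refine ⟨fun u => a u + b u, ?_⟩
    simp only [add_smul, Finset.sum_add_distrib, ha, hb, smul_add]

theorem hilbertFn_le_hilbertFn_add {A : Subalgebra k (MvPolynomial (Fin d) k)} (J : Ideal A)
    {a : A} (ha : a ≠ 0) {l : ℕ} (hal : (a : MvPolynomial (Fin d) k).IsHomogeneous l) (m : ℕ) :
    hilbertFn (idealSubmodule J) m ≤ hilbertFn (idealSubmodule J) (m + l) := by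
  have hinj : Function.Injective (LinearMap.mulLeft k (a : MvPolynomial (Fin d) k)) :=
    mul_right_injective₀ fun h => ha (Subtype.ext h)
  rw [hilbertFn, (Submodule.equivMapOfInjective _ hinj _).finrank_eq]
  refine Submodule.finrank_mono ?_
  rintro _ ⟨f, ⟨⟨b, hb, rfl⟩, hfm⟩, rfl⟩
  refine ⟨⟨a * b, J.mul_mem_left _ hb, rfl⟩, ?_⟩
  rw [add_comm]
  exact hal.mul hfm

theorem hilbertFn_idealSubmodule_eq_zero {A : Subalgebra k (MvPolynomial (Fin d) k)} {n₀ : ℕ}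
    (hdvd : ∀ (a : A) (m : ℕ), a ≠ 0 → (a : MvPolynomial (Fin d) k).IsHomogeneous m → n₀ ∣ m)
    (J : Ideal A) {m : ℕ} (hm : ¬ n₀ ∣ m) : hilbertFn (idealSubmodule J) m = 0 := by
  have h : idealSubmodule J ⊓ homogeneousSubmodule (Fin d) k m = ⊥ := by
    rw [eq_bot_iff]
    rintro _ ⟨⟨b, _, rfl⟩, hbm⟩
    by_contra hne
    exact hm (hdvd b m (fun h => hne (by rw [h]; simp)) hbm)
  rw [hilbertFn, h, finrank_bot]

theorem exists_isHomogeneous_of_dvd {A : Subalgebra k (MvPolynomial (Fin d) k)} {n₀ : ℕ}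
    (hgcd : ∀ c : ℕ, (∀ (a : A) (m : ℕ), a ≠ 0 →
      (a : MvPolynomial (Fin d) k).IsHomogeneous m → c ∣ m) → c ∣ n₀) :
    ∃ L, ∀ l, L ≤ l → n₀ ∣ l → ∃ a : A, a ≠ 0 ∧ (a : MvPolynomial (Fin d) k).IsHomogeneous l := by
  let M : AddSubmonoid ℕ :=
    { carrier := {m | ∃ a : A, a ≠ 0 ∧ (a : MvPolynomial (Fin d) k).IsHomogeneous m}
      zero_mem' := ⟨1, one_ne_zero, isHomogeneous_one _ _⟩
      add_mem' := fun ⟨a, ha, ham⟩ ⟨b, hb, hbm⟩ => ⟨a * b, mul_ne_zero ha hb, ham.mul hbm⟩ }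
  obtain ⟨L, hL⟩ := Nat.exists_mem_closure_of_ge (M : Set ℕ)
  refine ⟨L, fun l hl hdl => ?_⟩
  have h := hL l hl ((hgcd _ fun a m ha ham => Nat.setGcd_dvd_of_mem (show m ∈ (M : Set ℕ) from ⟨a, ha, ham⟩)).trans hdl)
  rwa [AddSubmonoid.closure_eq] at h

theorem _root_.Finset.sum_range_add_eq_of_not_dvd {φ : ℕ → ℕ} {n₀ : ℕ} (hn₀ : 0 < n₀)
    (hφ : ∀ m, ¬ n₀ ∣ m → φ m = 0) (m : ℕ) :
    ∑ t ∈ Finset.range n₀, φ (m + t) = φ (n₀ * ((m + n₀ - 1) / n₀)) := by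
  have h1 := Nat.div_add_mod (m + n₀ - 1) n₀
  have h2 := Nat.mod_lt (m + n₀ - 1) hn₀
  set g := (m + n₀ - 1) / n₀
  rw [Finset.sum_eq_single (n₀ * g - m)]
  · congr 1
    omega
  · intro t ht hne
    refine hφ _ fun ⟨x, hx⟩ => hne ?_
    rw [Finset.mem_range] at ht
    have h3 : x = g := by
      by_contra hxg
      rcases Nat.lt_or_gt_of_ne hxg with h | h
      · have := Nat.mul_le_mul_left n₀ h
        rw [Nat.mul_succ] at this
        omega
      · have := Nat.mul_le_mul_left n₀ h
        rw [Nat.mul_succ] at this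
        omega
    rw [← h3, ← hx]
    omega
  · intro h
    exact absurd (Finset.mem_range.2 (by omega)) h

theorem exists_sum_hilbertFn_le {A : Subalgebra k (MvPolynomial (Fin d) k)} {n₀ : ℕ}
    (hn₀ : 0 < n₀)
    (hdvd : ∀ (a : A) (m : ℕ), a ≠ 0 → (a : MvPolynomial (Fin d) k).IsHomogeneous m → n₀ ∣ m)
    (hgcd : ∀ c : ℕ, (∀ (a : A) (m : ℕ), a ≠ 0 →
      (a : MvPolynomial (Fin d) k).IsHomogeneous m → c ∣ m) → c ∣ n₀) :
    ∃ s₀, ∀ (J : Ideal A) (m m' : ℕ), m + s₀ ≤ m' →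
      ∑ t ∈ Finset.range n₀, hilbertFn (idealSubmodule J) (m + t) ≤
        ∑ t ∈ Finset.range n₀, hilbertFn (idealSubmodule J) (m' + t) := by
  obtain ⟨L, hL⟩ := exists_isHomogeneous_of_dvd hgcd
  refine ⟨L + n₀, fun J m m' hmm => ?_⟩
  rw [Finset.sum_range_add_eq_of_not_dvd hn₀ fun j hj => hilbertFn_idealSubmodule_eq_zero hdvd J hj,
    Finset.sum_range_add_eq_of_not_dvd hn₀ fun j hj => hilbertFn_idealSubmodule_eq_zero hdvd J hj]
  have h1 := Nat.div_add_mod (m + n₀ - 1) n₀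
  have h2 := Nat.mod_lt (m + n₀ - 1) hn₀
  have h3 := Nat.div_add_mod (m' + n₀ - 1) n₀
  have h4 := Nat.mod_lt (m' + n₀ - 1) hn₀
  set g := (m + n₀ - 1) / n₀
  set g' := (m' + n₀ - 1) / n₀
  obtain ⟨a, ha, hal⟩ := hL (n₀ * g' - n₀ * g) (by omega)
    (Nat.dvd_sub (dvd_mul_right _ _) (dvd_mul_right _ _))
  have h5 := hilbertFn_le_hilbertFn_add J ha hal (n₀ * g)
  rwa [Nat.add_sub_cancel' (by omega)] at h5

theorem exists_hilbertFn_bounds {A : Subalgebra k (MvPolynomial (Fin d) k)}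
    [Module.Finite A (MvPolynomial (Fin d) k)]
    (hA : IsGraded (Subalgebra.toSubmodule A)) {n₀ : ℕ} (hn₀ : 0 < n₀)
    (hdvd : ∀ (a : A) (m : ℕ), a ≠ 0 → (a : MvPolynomial (Fin d) k).IsHomogeneous m → n₀ ∣ m)
    (hgcd : ∀ c : ℕ, (∀ (a : A) (m : ℕ), a ≠ 0 →
      (a : MvPolynomial (Fin d) k).IsHomogeneous m → c ∣ m) → c ∣ n₀) :
    ∃ r C₁ C₂ B : ℕ, 0 < r ∧ ∀ J : Ideal A, IsGraded (idealSubmodule J) → ∀ m,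
      r * ∑ t ∈ Finset.range n₀, hilbertFn (idealSubmodule J) (m + t) ≤
        ∑ t ∈ Finset.range n₀, hilbertFn
          ((J.map (algebraMap A (MvPolynomial (Fin d) k))).restrictScalars k) (m + C₁ + t) ∧
      ∑ t ∈ Finset.range n₀, hilbertFn
          ((J.map (algebraMap A (MvPolynomial (Fin d) k))).restrictScalars k) (m - C₂ + t) ≤
        r * (∑ t ∈ Finset.range n₀, hilbertFn (idealSubmodule J) (m + t)) + B := by
  obtain ⟨s, hsne, hs, c₁, hc₁, hc₁s⟩ := exists_linearIndependent_monomial A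
  obtain ⟨c₂, hc₂, γ₂, hγ₂, hc₂s⟩ := exists_homogeneous_denominator hA hc₁ hc₁s
  obtain ⟨s₀, hs₀⟩ := exists_sum_hilbertFn_le hn₀ hdvd hgcd
  obtain ⟨L, hL⟩ := exists_isHomogeneous_of_dvd hgcd
  set E := s.sup fun u => u.degree with hE
  have hEs : ∀ u ∈ s, u.degree ≤ E := fun u hu => Finset.le_sup (f := fun u => u.degree) hu
  obtain ⟨a, ha, hal⟩ := hL (n₀ * (L + E))
    ((Nat.le_add_right _ _).trans (Nat.le_mul_of_pos_left _ hn₀)) (dvd_mul_right _ _)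
  set γ := n₀ * (L + E) + γ₂ with hγ
  have hγE : E ≤ γ := by
    have := Nat.le_mul_of_pos_left (L + E) hn₀
    omega
  have hcs : ∀ f : MvPolynomial (Fin d) k, ∃ b : s → A,
      ∑ u, b u • (monomial (u : Fin d →₀ ℕ) 1 : MvPolynomial (Fin d) k) = (a * c₂) • f := by
    intro f
    obtain ⟨b, hb⟩ := hc₂s f
    refine ⟨fun u => a * b u, ?_⟩
    simp only [mul_smul, ← Finset.smul_sum, hb]
  refine ⟨s.card, E + s₀, γ + s₀,
    ∑ t ∈ Finset.range n₀, hilbertFn (⊤ : Submodule k (MvPolynomial (Fin d) k)) t,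
    hsne.card_pos, fun J hJ m => ⟨?_, ?_⟩⟩
  · calc s.card * ∑ t ∈ Finset.range n₀, hilbertFn (idealSubmodule J) (m + t)
        ≤ ∑ u ∈ s, ∑ t ∈ Finset.range n₀,
            hilbertFn (idealSubmodule J) (m + (E + s₀) - u.degree + t) := by
          rw [← smul_eq_mul]
          refine Finset.card_nsmul_le_sum _ _ _ fun u hu => hs₀ J _ _ ?_
          have := hEs u hu
          omega
      _ = ∑ t ∈ Finset.range n₀, ∑ u ∈ s,
            hilbertFn (idealSubmodule J) (m + (E + s₀) + t - u.degree) := by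
          rw [Finset.sum_comm]
          refine Finset.sum_congr rfl fun t _ => Finset.sum_congr rfl fun u hu => ?_
          have := hEs u hu
          congr 1
          omega
      _ ≤ _ := Finset.sum_le_sum fun t _ => sum_hilbertFn_le hs J fun u hu => by
          have := hEs u hu
          omega
  · rcases le_total (γ + s₀) m with hm | hm
    · refine le_trans ?_ (Nat.le_add_right _ _)
      calc ∑ t ∈ Finset.range n₀, hilbertFn
            ((J.map (algebraMap A (MvPolynomial (Fin d) k))).restrictScalars k)
              (m - (γ + s₀) + t)
          ≤ ∑ t ∈ Finset.range n₀, ∑ u ∈ s,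
              hilbertFn (idealSubmodule J) (m - (γ + s₀) + t + γ - u.degree) :=
            Finset.sum_le_sum fun t _ => hilbertFn_map_le (mul_ne_zero ha hc₂) (hal.mul hγ₂) hcs
              (fun u hu => (hEs u hu).trans hγE) J hJ _
        _ = ∑ u ∈ s, ∑ t ∈ Finset.range n₀,
              hilbertFn (idealSubmodule J) (m - (γ + s₀) + γ - u.degree + t) := by
            rw [Finset.sum_comm]
            refine Finset.sum_congr rfl fun u hu => Finset.sum_congr rfl fun t _ => ?_
            have := hEs u hu
            congr 1
            omega
        _ ≤ s.card * ∑ t ∈ Finset.range n₀, hilbertFn (idealSubmodule J) (m + t) := by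
            rw [← smul_eq_mul]
            refine Finset.sum_le_card_nsmul _ _ _ fun u hu => hs₀ J _ _ ?_
            omega
    · rw [Nat.sub_eq_zero_of_le hm]
      refine le_trans (Finset.sum_le_sum fun t _ => ?_) (Nat.le_add_left _ _)
      rw [zero_add]
      exact hilbertFn_mono le_top t

end MvPolynomial

theorem Ideal.finite_quotient_map {k A S : Type*} [CommRing k] [CommRing A] [CommRing S]
    [Algebra k A] [Algebra A S] [Algebra k S] [IsScalarTower k A S] [Module.Finite A S]
    (I : Ideal A) [Module.Finite k (A ⧸ I)] :
    Module.Finite k (S ⧸ I.map (algebraMap A S)) := by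
  let _ : Algebra (A ⧸ I) (S ⧸ I.map (algebraMap A S)) :=
    Ideal.Quotient.algebraQuotientOfLEComap Ideal.le_comap_map
  have : IsScalarTower A (A ⧸ I) (S ⧸ I.map (algebraMap A S)) :=
    IsScalarTower.of_algebraMap_eq' rfl
  have : Module.Finite (A ⧸ I) (S ⧸ I.map (algebraMap A S)) :=
    Module.Finite.of_restrictScalars_finite A _ _
  have : IsScalarTower k (A ⧸ I) (S ⧸ I.map (algebraMap A S)) := by
    refine IsScalarTower.of_algebraMap_eq fun x => ?_
    change Ideal.Quotient.mk _ (algebraMap k S x) =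
      Ideal.Quotient.mk _ (algebraMap A S (algebraMap k A x))
    rw [← IsScalarTower.algebraMap_apply]
  exact Module.Finite.trans (A ⧸ I) _

theorem gradedPieceLen_add_finrank {k M : Type*} [Field k] [AddCommGroup M] [Module k M]
    (ℳ : ℕ → Submodule k M) (N : Submodule k M) (j : ℕ) [Module.Finite k (ℳ j)] :
    gradedPieceLen k ℳ N j + Module.finrank k ↥(N ⊓ ℳ j) = Module.finrank k (ℳ j) := by
  have h := Submodule.finrank_quotient_add_finrank (N.comap (ℳ j).subtype)
  rwa [(Submodule.equivMapOfInjective (ℳ j).subtype (ℳ j).injective_subtype _).finrank_eq,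
    Submodule.map_comap_subtype, inf_comm] at h

namespace MvPolynomial

variable {k : Type*} [Field k] {d : ℕ}

theorem isGraded_idealSubmodule_span {A : Subalgebra k (MvPolynomial (Fin d) k)}
    (hA : IsGraded (Subalgebra.toSubmodule A)) {s : Set A}
    (hs : ∀ a ∈ s, ∃ n, (a : MvPolynomial (Fin d) k).IsHomogeneous n) :
    IsGraded (idealSubmodule (Ideal.span s)) := by
  rintro _ ⟨a, ha, rfl⟩ n
  change homogeneousComponent n (a : MvPolynomial (Fin d) k) ∈ _
  replace ha : a ∈ Ideal.span s := ha
  induction ha using Submodule.span_induction generalizing n with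
  | mem a ha =>
    obtain ⟨m, hm⟩ := hs a ha
    rw [homogeneousComponent_of_mem hm]
    split_ifs
    · exact coe_mem_idealSubmodule.2 (Ideal.subset_span ha)
    · exact zero_mem _
  | zero => simp
  | add a b _ _ ha hb =>
    rw [Subalgebra.coe_add, map_add]
    exact add_mem (ha n) (hb n)
  | smul b a _ ha =>
    rw [smul_eq_mul, Subalgebra.coe_mul, ← sum_homogeneousComponent (a : MvPolynomial (Fin d) k),
      Finset.mul_sum, map_sum]
    refine sum_mem fun i _ => ?_
    rw [(homogeneousComponent_isHomogeneous i _).homogeneousComponent_mul]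
    split_ifs
    · obtain ⟨x, hx, hxi⟩ := ha i
      rw [← hxi]
      exact coe_mem_idealSubmodule.2
        (Ideal.mul_mem_left _ (⟨_, hA _ b.2 (n - i)⟩ : A) hx)
    · exact zero_mem _

theorem map_frobeniusPow (p : ℕ) [Fact p.Prime] [CharP k p] (n : ℕ)
    {A : Subalgebra k (MvPolynomial (Fin d) k)} (I : Ideal A) :
    (I.frobeniusPow (p ^ n)).map (algebraMap A (MvPolynomial (Fin d) k)) =
      (I.map (algebraMap A (MvPolynomial (Fin d) k))).map
        (iterateFrobenius (MvPolynomial (Fin d) k) p n) := by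
  rw [Ideal.map_map, Ideal.frobeniusPow, Ideal.map_span, Ideal.map, Set.image_image]
  refine congrArg Ideal.span (Set.image_congr fun a _ => ?_)
  rw [RingHom.comp_apply, iterateFrobenius_def, map_pow]

theorem frobeniusPow_span (p : ℕ) [Fact p.Prime] [CharP k p] (n : ℕ)
    {A : Subalgebra k (MvPolynomial (Fin d) k)} (s : Set A) :
    (Ideal.span s).frobeniusPow (p ^ n) = Ideal.span ((· ^ p ^ n) '' s) := by
  have : CharP A p := charP_of_injective_algebraMap (algebraMap k A).injective p
  exact Ideal.map_span (iterateFrobenius A p n) s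

theorem isGraded_frobeniusPow_span (p : ℕ) [Fact p.Prime] [CharP k p] (n : ℕ)
    {A : Subalgebra k (MvPolynomial (Fin d) k)}
    (hA : IsGraded (Subalgebra.toSubmodule A)) {s : Set A}
    (hs : ∀ a ∈ s, ∃ n, (a : MvPolynomial (Fin d) k).IsHomogeneous n) :
    IsGraded (idealSubmodule ((Ideal.span s).frobeniusPow (p ^ n))) := by
  rw [frobeniusPow_span]
  refine isGraded_idealSubmodule_span hA ?_
  rintro _ ⟨a, ha, rfl⟩
  obtain ⟨m, hm⟩ := hs a ha
  exact ⟨m * p ^ n, hm.pow _⟩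

theorem isGraded_map_span {A : Subalgebra k (MvPolynomial (Fin d) k)} {s : Set A}
    (hs : ∀ a ∈ s, ∃ n, (a : MvPolynomial (Fin d) k).IsHomogeneous n) :
    IsGraded (((Ideal.span s).map (algebraMap A (MvPolynomial (Fin d) k))).restrictScalars k) := by
  rw [Ideal.map_span]
  refine isGraded_span ?_
  rintro _ ⟨a, ha, rfl⟩
  exact hs a ha

theorem gradedPieceLen_eq {A : Subalgebra k (MvPolynomial (Fin d) k)} (J : Ideal A) (m : ℕ) :
    (gradedPieceLen k
      (fun n => (homogeneousSubmodule (Fin d) k n).comap A.val.toLinearMap)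
      ((J • (⊤ : Submodule A A)).restrictScalars k) m : ℝ) =
      hilbertFn (idealSubmodule (⊤ : Ideal A)) m - hilbertFn (idealSubmodule J) m := by
  have hinj : Function.Injective A.val.toLinearMap := Subtype.val_injective
  set V := (homogeneousSubmodule (Fin d) k m).comap A.val.toLinearMap with hV
  have hmap : ∀ K : Ideal A, (K.restrictScalars k ⊓ V).map A.val.toLinearMap =
      idealSubmodule K ⊓ homogeneousSubmodule (Fin d) k m := fun K => by
    rw [hV]
    exact (Submodule.map_inf_eq_map_inf_comap).symm
  have hfr : ∀ K : Ideal A, Module.finrank k ↥(K.restrictScalars k ⊓ V) =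
      hilbertFn (idealSubmodule K) m := fun K => by
    rw [hilbertFn, ← hmap, ← (Submodule.equivMapOfInjective _ hinj _).finrank_eq]
  have : Module.Finite k V := by
    have h1 : V.map A.val.toLinearMap ≤ homogeneousSubmodule (Fin d) k m :=
      Submodule.map_comap_le _ _
    have : Module.Finite k (V.map A.val.toLinearMap) := Submodule.finiteDimensional_of_le h1
    exact Module.Finite.equiv (Submodule.equivMapOfInjective _ hinj V).symm
  rw [Ideal.smul_eq_mul, Ideal.mul_top]
  have h1 := gradedPieceLen_add_finrank
    (fun n => (homogeneousSubmodule (Fin d) k n).comap A.val.toLinearMap) (J.restrictScalars k) m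
  have h2 := hfr ⊤
  have h3 : (⊤ : Ideal A).restrictScalars k ⊓ V = V := top_inf_eq V
  rw [h3] at h2
  rw [hfr, h2] at h1
  rw [← h1]
  push_cast
  ring

theorem homogeneousComponent_algEquiv
    (φ : MvPolynomial (Fin d) k →ₐ[k] MvPolynomial (Fin d) k)
    (hφ : ∀ i, (φ (X i)).IsHomogeneous 1) (f : MvPolynomial (Fin d) k) (n : ℕ) :
    homogeneousComponent n (φ f) = φ (homogeneousComponent n f) := by
  have hhom : ∀ (g : MvPolynomial (Fin d) k) (m : ℕ), g.IsHomogeneous m →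
      (φ g).IsHomogeneous m := fun g m hg => by
    have h := hg.aeval (fun i => φ (X i)) (n := 1) hφ
    rw [one_mul] at h
    rw [aeval_unique φ]
    exact h
  conv_lhs => rw [← sum_homogeneousComponent f, map_sum, map_sum]
  rw [Finset.sum_congr rfl fun i _ =>
    homogeneousComponent_of_mem (hhom _ _ (homogeneousComponent_isHomogeneous i f))]
  rw [Finset.sum_ite_eq]
  split_ifs with h
  · rfl
  · rw [homogeneousComponent_eq_zero, map_zero]
    simpa using h

end MvPolynomial

theorem mem_fixedSubalgebra {k R G : Type*} [CommSemiring k] [Semiring R] [Algebra k R] [Group G]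
    {ρ : G →* (R ≃ₐ[k] R)} {x : R} : x ∈ fixedSubalgebra k R G ρ ↔ ∀ g, ρ g x = x := by
  rw [fixedSubalgebra, Algebra.mem_iInf]
  rfl

theorem finite_fixedSubalgebra {k R G : Type*} [CommRing k] [CommRing R] [Algebra k R]
    [Algebra.FiniteType k R] [Group G] [Finite G] (ρ : G →* (R ≃ₐ[k] R)) :
    Module.Finite (fixedSubalgebra k R G ρ) R := by
  let _ : MulSemiringAction G R := MulSemiringAction.compHom R ρ
  have hsmul : ∀ (g : G) (x : R), g • x = ρ g x := fun _ _ => rfl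
  have : SMulCommClass G (fixedSubalgebra k R G ρ) R := ⟨fun g a x => by
    rw [hsmul, hsmul, Algebra.smul_def, Algebra.smul_def, map_mul]
    exact congrArg (· * _) (mem_fixedSubalgebra.1 a.2 g)⟩
  have : Algebra.IsInvariant (fixedSubalgebra k R G ρ) R G :=
    ⟨fun b hb => ⟨⟨b, mem_fixedSubalgebra.2 hb⟩, rfl⟩⟩
  have := Algebra.IsInvariant.isIntegral (fixedSubalgebra k R G ρ) R G
  have : Algebra.FiniteType (fixedSubalgebra k R G ρ) R :=
    Algebra.FiniteType.of_restrictScalars_finiteType k _ _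
  exact Algebra.IsIntegral.finite

namespace MvPolynomial

variable {k : Type*} [Field k] {d : ℕ}

theorem isGraded_fixedSubalgebra {G : Type*} [Group G]
    (ρ : G →* (MvPolynomial (Fin d) k ≃ₐ[k] MvPolynomial (Fin d) k))
    (hlin : ∀ (g : G) (i : Fin d), ρ g (X i) ∈ homogeneousSubmodule (Fin d) k 1) :
    IsGraded (Subalgebra.toSubmodule (fixedSubalgebra k (MvPolynomial (Fin d) k) G ρ)) := by
  intro f hf n
  refine mem_fixedSubalgebra.2 fun g => ?_
  have h := homogeneousComponent_algEquiv (ρ g).toAlgHom (hlin g) f n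
  rw [show (ρ g).toAlgHom f = f from mem_fixedSubalgebra.1 hf g] at h
  exact h.symm

theorem fixedGrading_ne_bot_iff {G : Type*} [Group G]
    {ρ : G →* (MvPolynomial (Fin d) k ≃ₐ[k] MvPolynomial (Fin d) k)} {m : ℕ} :
    fixedGrading k d G ρ m ≠ ⊥ ↔ ∃ a : fixedSubalgebra k (MvPolynomial (Fin d) k) G ρ,
      a ≠ 0 ∧ (a : MvPolynomial (Fin d) k).IsHomogeneous m := by
  rw [Submodule.ne_bot_iff]
  exact exists_congr fun a => and_comm

end MvPolynomial

theorem tendsto_natCast_add_div {ι : Type*} {l : Filter ι} {u Q : ι → ℕ} (hQ : Tendsto Q l atTop)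
    {y : ℝ} (hu : Tendsto (fun n => (u n : ℝ) / Q n) l (𝓝 y)) (c : ℕ) :
    Tendsto (fun n => ((u n + c : ℕ) : ℝ) / Q n) l (𝓝 y) := by
  have h := hu.add (tendsto_const_nhds.div_atTop
    (tendsto_natCast_atTop_atTop.comp hQ) : Tendsto (fun n => (c : ℝ) / Q n) l (𝓝 0))
  rw [add_zero] at h
  refine h.congr fun n => ?_
  push_cast
  ring

theorem tendsto_natCast_tsub_div {ι : Type*} {l : Filter ι} {u Q : ι → ℕ}
    (hQ : Tendsto Q l atTop)
    {y : ℝ} (hu : Tendsto (fun n => (u n : ℝ) / Q n) l (𝓝 y)) (c : ℕ) :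
    Tendsto (fun n => ((u n - c : ℕ) : ℝ) / Q n) l (𝓝 y) := by
  have h := hu.sub (tendsto_const_nhds.div_atTop
    (tendsto_natCast_atTop_atTop.comp hQ) : Tendsto (fun n => (c : ℝ) / Q n) l (𝓝 0))
  rw [sub_zero] at h
  refine tendsto_of_tendsto_of_tendsto_of_le_of_le h hu (fun n => ?_) fun n => ?_
  · change (u n : ℝ) / Q n - c / Q n ≤ _
    rw [← sub_div]
    gcongr
    rw [sub_le_iff_le_add]
    exact_mod_cast le_tsub_add
  · change ((u n - c : ℕ) : ℝ) / Q n ≤ (u n : ℝ) / Q n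
    gcongr
    exact Nat.sub_le _ _

theorem tendsto_natFloor_mul_div {ι : Type*} {l : Filter ι} {Q : ι → ℕ} (hQ : Tendsto Q l atTop)
    {x : ℝ} (hx : 0 ≤ x) (n₀ : ℕ) :
    Tendsto (fun n => ((⌊x * Q n⌋₊ * n₀ : ℕ) : ℝ) / Q n) l (𝓝 (n₀ * x)) := by
  have h := ((tendsto_nat_floor_mul_div_atTop hx).comp
    (tendsto_natCast_atTop_atTop.comp hQ)).const_mul (n₀ : ℝ)
  refine h.congr fun n => ?_
  simp only [Function.comp_apply]
  push_cast
  ring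

theorem isPiecewisePolyOfDegree_coeffDensity {e : ℕ} (he : e ≠ 0) (h : Polynomial ℤ)
    {n₀ : ℕ} (hn₀ : 0 < n₀) (c : ℝ) :
    IsPiecewisePolyOfDegree (fun x => c * coeffDensity e h (n₀ * x)) e := by
  have hn₀' : (0 : ℝ) < n₀ := Nat.cast_pos.2 hn₀
  refine ⟨e + 1 + h.natDegree + 1, fun i => i / n₀, fun i => Polynomial.C c *
    (∑ j ∈ (Finset.range (((1 - Polynomial.X) ^ (e + 1) * h).natDegree + 1)).filter (· ≤ i),
      Polynomial.C ((((1 - Polynomial.X) ^ (e + 1) * h).coeff j : ℝ) / e.factorial) *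
        (Polynomial.X - Polynomial.C (j : ℝ)) ^ e).comp (Polynomial.C (n₀ : ℝ) * Polynomial.X),
    by simp, fun i _ => ?_, fun i _ x hx => ?_, fun x hx => ?_, fun i _ => ?_⟩
  · change (i : ℝ) / n₀ < ((i + 1 : ℕ) : ℝ) / n₀
    gcongr
    exact Nat.lt_succ_self i
  · have hx' : (n₀ : ℝ) * x ∈ Set.Icc (i : ℝ) (i + 1) := by
      obtain ⟨h1, h2⟩ := hx
      rw [div_le_iff₀' hn₀'] at h1
      rw [le_div_iff₀' hn₀', Nat.cast_succ] at h2
      exact ⟨h1, h2⟩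
    change c * _ = _
    rw [Polynomial.eval_mul, Polynomial.eval_comp, Polynomial.eval_C, Polynomial.eval_mul,
      Polynomial.eval_C, Polynomial.eval_X, coeffDensity_eq_eval he h hx']
  · rw [div_le_iff₀' hn₀'] at hx
    change c * _ = 0
    rw [coeffDensity_eq_zero he h hx, mul_zero]
  · refine (Polynomial.natDegree_C_mul_le _ _).trans (Polynomial.natDegree_comp_le.trans ?_)
    refine (Nat.mul_le_mul (Polynomial.natDegree_sum_le_of_forall_le _ _ (n := e) fun j _ => ?_)
      (Polynomial.natDegree_C_mul_le _ _)).trans (by simp)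
    refine (Polynomial.natDegree_C_mul_le _ _).trans (Polynomial.natDegree_pow_le.trans ?_)
    rw [Polynomial.natDegree_X_sub_C, mul_one]

namespace MvPolynomial

variable {k : Type*} [Field k] {d : ℕ}

theorem tendsto_sum_hilbertFn_top_div_pow (hd : 2 ≤ d) {ι : Type*} {l : Filter ι} {u Q : ι → ℕ}
    (hQ : Tendsto Q l atTop) {y : ℝ} (hu : Tendsto (fun n => (u n : ℝ) / Q n) l (𝓝 y)) (n₀ : ℕ) :
    Tendsto (fun n => (∑ t ∈ Finset.range n₀,
      (hilbertFn (⊤ : Submodule k (MvPolynomial (Fin d) k)) (u n + t) : ℝ)) / (Q n : ℝ) ^ (d - 1)) l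
      (𝓝 (n₀ * (max y 0 ^ (d - 1) / (d - 1).factorial))) := by
  simp only [Finset.sum_div]
  rw [← nsmul_eq_mul, ← Finset.card_range n₀, ← Finset.sum_const, Finset.card_range]
  refine tendsto_finsetSum _ fun t _ => ?_
  have h := tendsto_choose_div_pow hQ (tendsto_natCast_add_div hQ hu t)
    (e := d - 1) (by omega) 0
  simpa [hilbertFn_top (show 0 < d by omega)] using h

theorem tendsto_sum_hilbertFn_sub_div_pow (p : ℕ) [Fact p.Prime] [CharP k p] [PerfectField k]
    (hd : 2 ≤ d) (I : Ideal (MvPolynomial (Fin d) k)) (h : Polynomial ℤ)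
    (hh : ∀ j, h.coeff j = (hilbertFn (⊤ : Submodule k (MvPolynomial (Fin d) k)) j : ℤ) -
      hilbertFn (I.restrictScalars k) j) {u : ℕ → ℕ}
    {y : ℝ} (hu : Tendsto (fun n => (u n : ℝ) / (p ^ n : ℕ)) atTop (𝓝 y)) (n₀ : ℕ) :
    Tendsto (fun n => (∑ t ∈ Finset.range n₀,
      ((hilbertFn (⊤ : Submodule k (MvPolynomial (Fin d) k)) (u n + t) : ℝ) - hilbertFn
        ((I.map (iterateFrobenius (MvPolynomial (Fin d) k) p n)).restrictScalars k) (u n + t))) /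
      ((p ^ n : ℕ) : ℝ) ^ (d - 1)) atTop (𝓝 (n₀ * coeffDensity (d - 1) h y)) := by
  have hQ : Tendsto (fun n => p ^ n) atTop atTop :=
    tendsto_pow_atTop_atTop_of_one_lt (Fact.out : p.Prime).one_lt
  simp only [Finset.sum_div]
  rw [← nsmul_eq_mul, ← Finset.card_range n₀, ← Finset.sum_const, Finset.card_range]
  refine tendsto_finsetSum _ fun t _ => ?_
  refine (tendsto_coeff_div_pow hQ (tendsto_natCast_add_div hQ hu t)
    (e := d - 1) (by omega) h).congr fun n => ?_
  rw [show d - 1 + 1 = d by omega, ← hilbertFn_colength_eq_coeff p I h hh n]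
  push_cast
  rfl

theorem tendsto_hkStep (p : ℕ) [Fact p.Prime] [CharP k p] [PerfectField k] (hd : 2 ≤ d)
    {A : Subalgebra k (MvPolynomial (Fin d) k)} [Module.Finite A (MvPolynomial (Fin d) k)]
    (hA : IsGraded (Subalgebra.toSubmodule A)) {n₀ : ℕ} (hn₀ : 0 < n₀)
    (hdvd : ∀ (a : A) (m : ℕ), a ≠ 0 → (a : MvPolynomial (Fin d) k).IsHomogeneous m → n₀ ∣ m)
    (hgcd : ∀ c : ℕ, (∀ (a : A) (m : ℕ), a ≠ 0 →
      (a : MvPolynomial (Fin d) k).IsHomogeneous m → c ∣ m) → c ∣ n₀)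
    {s : Set A} (hs : ∀ a ∈ s, ∃ n, (a : MvPolynomial (Fin d) k).IsHomogeneous n)
    [FiniteDimensional k (A ⧸ Ideal.span s)] :
    ∃ (r : ℝ) (h : Polynomial ℤ), ∀ x : ℝ, 0 ≤ x → Tendsto (fun n => hkStep k
      (fun n => (homogeneousSubmodule (Fin d) k n).comap A.val.toLinearMap)
      (Ideal.span s) d n₀ p n x) atTop (𝓝 (r * coeffDensity (d - 1) h (n₀ * x))) := by
  obtain ⟨r, C₁, C₂, B, hr, hJ⟩ := exists_hilbertFn_bounds hA hn₀ hdvd hgcd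
  have : FiniteDimensional k (MvPolynomial (Fin d) k ⧸
      (Ideal.span s).map (algebraMap A (MvPolynomial (Fin d) k))) :=
    Ideal.finite_quotient_map _
  obtain ⟨h, hh⟩ := exists_coeff_eq_hilbertFn _ (isGraded_map_span hs)
  refine ⟨(r : ℝ)⁻¹ * n₀, h, fun x hx => ?_⟩
  have hQ : Tendsto (fun n => p ^ n) atTop atTop :=
    tendsto_pow_atTop_atTop_of_one_lt (Fact.out : p.Prime).one_lt
  have hr' : (0 : ℝ) < r := Nat.cast_pos.2 hr
  have hm := tendsto_natFloor_mul_div hQ hx n₀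
  have hm₁ := tendsto_natCast_add_div hQ hm C₁
  have hm₂ := tendsto_natCast_tsub_div hQ hm C₂
  have ht₁ := tendsto_sum_hilbertFn_top_div_pow (k := k) hd hQ hm₁ n₀
  have ht₂ := tendsto_sum_hilbertFn_top_div_pow (k := k) hd hQ hm₂ n₀
  have hc₁ := tendsto_sum_hilbertFn_sub_div_pow p hd _ h hh hm₁ n₀
  have hc₂ := tendsto_sum_hilbertFn_sub_div_pow p hd _ h hh hm₂ n₀
  have hB : Tendsto (fun n => (B : ℝ) / ((p ^ n : ℕ) : ℝ) ^ (d - 1)) atTop (𝓝 0) :=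
    tendsto_const_nhds.div_atTop ((tendsto_pow_atTop (by omega)).comp
      (tendsto_natCast_atTop_atTop.comp hQ))
  have hlow := (((ht₂.sub ht₁).add hc₁).sub hB).const_mul (r : ℝ)⁻¹
  have hup := (((ht₁.sub ht₂).add hc₂).add hB).const_mul (r : ℝ)⁻¹
  rw [sub_self, zero_add, sub_zero, ← mul_assoc] at hlow
  rw [sub_self, zero_add, add_zero, ← mul_assoc] at hup
  have htop : IsGraded (idealSubmodule (⊤ : Ideal A)) := by
    rw [← Ideal.span_singleton_one]
    refine isGraded_idealSubmodule_span hA ?_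
    rintro _ rfl
    exact ⟨0, isHomogeneous_one _ _⟩
  have hmaptop : ((⊤ : Ideal A).map (algebraMap A (MvPolynomial (Fin d) k))).restrictScalars k =
      ⊤ := by
    rw [Ideal.map_top]
    rfl
  refine tendsto_of_tendsto_of_tendsto_of_le_of_le hlow hup (fun n => ?_) fun n => ?_
  all_goals
    have h₁ := hJ ⊤ htop (⌊x * (p ^ n : ℕ)⌋₊ * n₀)
    have h₂ := hJ _ (isGraded_frobeniusPow_span p n hA hs)
      (⌊x * (p ^ n : ℕ)⌋₊ * n₀)
    rw [hmaptop] at h₁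
    rw [map_frobeniusPow] at h₂
    obtain ⟨h₁, h₁'⟩ := h₁
    obtain ⟨h₂, h₂'⟩ := h₂
    replace h₁ := (Nat.cast_le (α := ℝ)).2 h₁
    replace h₁' := (Nat.cast_le (α := ℝ)).2 h₁'
    replace h₂ := (Nat.cast_le (α := ℝ)).2 h₂
    replace h₂' := (Nat.cast_le (α := ℝ)).2 h₂'
    rw [Nat.cast_mul, Nat.cast_sum, Nat.cast_sum] at h₁ h₂
    rw [Nat.cast_add, Nat.cast_mul, Nat.cast_sum, Nat.cast_sum] at h₁' h₂'
    simp only [hkStep, gradedPieceLen_eq]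
    rw [← Nat.cast_pow p n, ← sub_div, ← add_div, Finset.sum_sub_distrib, Finset.sum_sub_distrib]
  · rw [← sub_div, ← mul_div_assoc]
    refine div_le_div_of_nonneg_right ?_ (by positivity)
    rw [inv_mul_le_iff₀ hr', mul_sub]
    linarith
  · rw [← add_div, ← mul_div_assoc]
    refine div_le_div_of_nonneg_right ?_ (by positivity)
    rw [le_inv_mul_iff₀ hr', mul_sub]
    linarith

end MvPolynomial

/-- Let `k` be a perfect field of characteristic `p > 0`,
`R = k[X₁, …, X_d]` with `d ≥ 2`, and `G` a finite group acting linearly on `R`.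
For any homogeneous ideal `I ⊆ R^G` of finite colength, the HK density function
`f_{R^G, I}` is a piecewise polynomial function of degree `d - 1`. -/
theorem statement4
    (k : Type*) [Field k] [PerfectField k] (p : ℕ) [Fact p.Prime] [CharP k p]
    (d : ℕ) (hd : 2 ≤ d)
    (G : Type*) [Group G] [Finite G]
    (ρ : G →* (MvPolynomial (Fin d) k ≃ₐ[k] MvPolynomial (Fin d) k))
    (hlin : ∀ (g : G) (i : Fin d),
      ρ g (MvPolynomial.X i) ∈ MvPolynomial.homogeneousSubmodule (Fin d) k 1)
    (I : Ideal ↥(fixedSubalgebra k (MvPolynomial (Fin d) k) G ρ))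
    (hIhom : ∃ gens : Set ↥(fixedSubalgebra k (MvPolynomial (Fin d) k) G ρ),
      (∀ f ∈ gens, ∃ n : ℕ, f ∈ fixedGrading k d G ρ n) ∧ I = Ideal.span gens)
    (hIcolen : FiniteDimensional k (↥(fixedSubalgebra k (MvPolynomial (Fin d) k) G ρ) ⧸ I))
    (n₀ : ℕ) (hn₀pos : 0 < n₀)
    (hn₀dvd : ∀ m, 0 < m → fixedGrading k d G ρ m ≠ ⊥ → n₀ ∣ m)
    (hn₀gcd : ∀ c : ℕ, (∀ m, 0 < m → fixedGrading k d G ρ m ≠ ⊥ → c ∣ m) → c ∣ n₀) :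
    ∃ F : ℝ → ℝ,
      (∀ x : ℝ, 0 ≤ x →
        Tendsto (fun n => hkStep k (fixedGrading k d G ρ) I d n₀ p n x) atTop (𝓝 (F x))) ∧
      IsPiecewisePolyOfDegree F (d - 1) := by
  obtain ⟨gens, hgens, rfl⟩ := hIhom
  have := finite_fixedSubalgebra ρ
  have hdvd : ∀ (a : fixedSubalgebra k (MvPolynomial (Fin d) k) G ρ) (m : ℕ), a ≠ 0 →
      (a : MvPolynomial (Fin d) k).IsHomogeneous m → n₀ ∣ m := fun a m ha ham => by
    rcases Nat.eq_zero_or_pos m with rfl | hm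
    · exact dvd_zero _
    · exact hn₀dvd m hm (MvPolynomial.fixedGrading_ne_bot_iff.2 ⟨a, ha, ham⟩)
  have hgcd : ∀ c : ℕ, (∀ (a : fixedSubalgebra k (MvPolynomial (Fin d) k) G ρ) (m : ℕ), a ≠ 0 →
      (a : MvPolynomial (Fin d) k).IsHomogeneous m → c ∣ m) → c ∣ n₀ := fun c hc =>
    hn₀gcd c fun m _ hm => by
      obtain ⟨a, ha, ham⟩ := MvPolynomial.fixedGrading_ne_bot_iff.1 hm
      exact hc a m ha ham
  obtain ⟨r, h, hrh⟩ := MvPolynomial.tendsto_hkStep p hd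
    (MvPolynomial.isGraded_fixedSubalgebra ρ hlin) hn₀pos hdvd hgcd hgens
  exact ⟨_, hrh, isPiecewisePolyOfDegree_coeffDensity (by omega) h hn₀pos r⟩
end
end

section
/- Let (R, I) be a graded pair such that R is a normal domain and gcd{n > 0 : R_n ≠ 0} = 1. Then the sequence of step functions {f_n(R,I)}_{n∈ℕ} converges uniformly on [0,∞). -/
open Filter MeasureTheory Topology

noncomputable section

lemma finrank_iSup_le_sum {k M ι : Type*} [Field k] [AddCommGroup M] [Module k M] [Fintype ι]
    (W : ι → Submodule k M) [∀ i, FiniteDimensional k (W i)] :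
    Module.finrank k (⨆ i, W i : Submodule k M) ≤ ∑ i, Module.finrank k (W i) := by
  classical
  rw [← Finset.sup_univ_eq_iSup]
  refine Finset.induction_on (Finset.univ : Finset ι) (by simp) fun i s hi ih => ?_
  rw [Finset.sup_insert, Finset.sum_insert hi]
  exact (Submodule.finrank_add_le_finrank_add_finrank _ _).trans (Nat.add_le_add_left ih _)

/-- An injective integral extension preserves Krull dimension. -/
lemma ringKrullDim_eq_of_isIntegral_of_injective {S A : Type*} [CommRing S] [CommRing A]
    (g : S →+* A) (hg : Function.Injective g) (hint : g.IsIntegral) :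
    ringKrullDim S = ringKrullDim A := by
  algebraize [g]
  have hI : Algebra.IsIntegral S A := ⟨hint⟩
  have hinj : FaithfulSMul S A := (faithfulSMul_iff_algebraMap_injective S A).2 hg
  apply le_antisymm
  · refine iSup_le fun l => ?_
    obtain ⟨⟨P, hP, hlo⟩⟩ := Ideal.nonempty_primesOver (S := A) (RelSeries.head l).asIdeal
    obtain ⟨L, hL, -⟩ := Ideal.exists_ltSeries_of_hasGoingUp l P
    rw [← hL]
    exact Order.LTSeries.length_le_krullDim L
  · refine Order.krullDim_le_of_strictMono (PrimeSpectrum.comap (algebraMap S A)) ?_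
    intro P Q h
    exact Ideal.IsIntegral.comap_lt_comap (R := S) (A := A) (I := P.asIdeal) (J := Q.asIdeal) h

/-- The number of variables in a Noether normalization is the Krull dimension. -/
lemma exists_finite_inj_algHom_ringKrullDim (k A : Type*) [Field k] [CommRing A] [Nontrivial A]
    [Algebra k A] [Algebra.FiniteType k A] :
    ∃ s : ℕ, ringKrullDim A = s ∧ ∃ g : MvPolynomial (Fin s) k →ₐ[k] A,
      Function.Injective g ∧ g.Finite := by
  obtain ⟨s, g, hg, hf⟩ := exists_finite_inj_algHom_of_fg k A
  refine ⟨s, ?_, g, hg, hf⟩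
  rw [← ringKrullDim_eq_of_isIntegral_of_injective g.toRingHom hg
    (RingHom.IsIntegral.of_finite (f := g.toRingHom) hf)]
  simp [MvPolynomial.ringKrullDim_of_isNoetherianRing, ringKrullDim_eq_zero_of_field]

namespace MvPolynomial

variable {σ k : Type*} [Field k]

lemma mul_mem_restrictDegree {a b : ℕ} {f g : MvPolynomial σ k}
    (hf : f ∈ restrictDegree σ k a) (hg : g ∈ restrictDegree σ k b) :
    f * g ∈ restrictDegree σ k (a + b) := by
  classical
  rw [mem_restrictDegree_iff_sup] at *
  intro i
  have h1 := Multiset.count_le_of_le i (degrees_mul_le (p := f) (q := g))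
  rw [Multiset.count_add] at h1
  exact h1.trans (add_le_add (hf i) (hg i))

lemma restrictDegree_mono {a b : ℕ} (h : a ≤ b) :
    restrictDegree σ k a ≤ restrictDegree σ k b := by
  intro f hf
  rw [mem_restrictDegree] at *
  exact fun s hs i => (hf s hs i).trans h

lemma exists_mem_restrictDegree (f : MvPolynomial σ k) : ∃ a, f ∈ restrictDegree σ k a := by
  classical
  refine ⟨f.totalDegree, ?_⟩
  rw [mem_restrictDegree]
  intro s hs i
  exact (Finsupp.le_degree i s).trans (le_totalDegree hs)

lemma restrictDegree_eq_span [Fintype σ] (N : ℕ) :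
    restrictDegree σ k N = Submodule.span k (Set.range fun e : σ → Fin (N + 1) =>
      monomial (Finsupp.equivFunOnFinite.symm fun i => (e i : ℕ)) (1 : k)) := by
  apply le_antisymm
  · intro f hf
    rw [mem_restrictDegree] at hf
    rw [f.as_sum]
    refine Submodule.sum_mem _ fun s hs => ?_
    have : monomial s (f.coeff s) = f.coeff s • monomial s (1 : k) := by
      rw [smul_monomial, smul_eq_mul, mul_one]
    rw [this]
    refine Submodule.smul_mem _ _ (Submodule.subset_span ?_)
    refine ⟨fun i => ⟨s i, Nat.lt_succ_of_le (hf s hs i)⟩, ?_⟩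
    exact congrArg (fun v => monomial v (1 : k)) (Finsupp.ext fun i => rfl)
  · rw [Submodule.span_le]
    rintro _ ⟨e, rfl⟩
    rw [SetLike.mem_coe, mem_restrictDegree]
    intro s hs i
    have := Finset.mem_singleton.1 (support_monomial_subset hs)
    subst this
    exact Nat.lt_succ_iff.1 (e i).2

lemma finrank_restrictDegree_le [Fintype σ] (N : ℕ) :
    Module.finrank k (restrictDegree σ k N) ≤ (N + 1) ^ Fintype.card σ := by
  classical
  rw [restrictDegree_eq_span]
  refine (finrank_range_le_card _).trans ?_
  simp

instance [Fintype σ] (N : ℕ) : FiniteDimensional k (restrictDegree σ k N) := by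
  rw [restrictDegree_eq_span]
  exact FiniteDimensional.span_of_finite k (Set.finite_range _)

lemma le_finrank_of_restrictDegree_le {A : Type*} [CommRing A] [Algebra k A] [Fintype σ]
    (g : MvPolynomial σ k →ₐ[k] A) (hg : Function.Injective g) (N : ℕ) (W : Submodule k A)
    [FiniteDimensional k W] (h : (restrictDegree σ k N).map g.toLinearMap ≤ W) :
    (N + 1) ^ Fintype.card σ ≤ Module.finrank k W := by
  classical
  have hli : LinearIndependent k (fun e : σ → Fin (N + 1) =>
      g (monomial (Finsupp.equivFunOnFinite.symm fun i => (e i : ℕ)) (1 : k))) := by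
    have h1 : LinearIndependent k (fun s : σ →₀ ℕ => (monomial s (1 : k))) := by
      simpa [coe_basisMonomials] using (basisMonomials σ k).linearIndependent
    have h2 := h1.map' g.toLinearMap (LinearMap.ker_eq_bot.2 hg)
    refine h2.comp (fun e : σ → Fin (N + 1) =>
      Finsupp.equivFunOnFinite.symm fun i => (e i : ℕ)) ?_
    intro e e' hee
    ext i
    exact congrFun (Finsupp.equivFunOnFinite.symm.injective hee) i
  have hmem : ∀ e : σ → Fin (N + 1),
      g (monomial (Finsupp.equivFunOnFinite.symm fun i => (e i : ℕ)) (1 : k)) ∈ W := by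
    intro e
    apply h
    refine ⟨_, ?_, rfl⟩
    rw [restrictDegree_eq_span]
    exact Submodule.subset_span ⟨e, rfl⟩
  have hli' : LinearIndependent k (fun e : σ → Fin (N + 1) =>
      (⟨_, hmem e⟩ : W)) := LinearIndependent.of_comp W.subtype hli
  simpa using hli'.fintype_card_le_finrank

end MvPolynomial

open MvPolynomial in
/-- Powers of a finite-dimensional subspace of an affine algebra of Krull dimension `e` grow at most
like a polynomial of degree `e`. -/
lemma exists_finrank_pow_le {k A : Type*} [Field k] [CommRing A] [Nontrivial A] [Algebra k A]
    [Algebra.FiniteType k A] (e : ℕ) (he : ringKrullDim A ≤ e) (W : Submodule k A) (hW : W.FG) :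
    ∃ C : ℕ, ∀ n : ℕ, ∀ U : Submodule k A, U ≤ W ^ n →
      FiniteDimensional k U ∧ Module.finrank k U ≤ C * (n + 1) ^ e := by
  classical
  obtain ⟨s, hs, g, hg, hfin⟩ := exists_finite_inj_algHom_ringKrullDim k A
  have hse : s ≤ e := by
    rw [hs] at he
    exact_mod_cast he
  let D : ℕ → Submodule k A := fun N => (restrictDegree (Fin s) k N).map g.toLinearMap
  have hDfin : ∀ N, FiniteDimensional k (D N) := fun N => inferInstance
  have hDrank : ∀ N, Module.finrank k (D N) ≤ (N + 1) ^ s := fun N => by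
    refine (Submodule.finrank_map_le _ _).trans ?_
    simpa using finrank_restrictDegree_le (σ := Fin s) (k := k) N
  have hDmul : ∀ a b, D a * D b ≤ D (a + b) := fun a b => by
    rw [Submodule.mul_le]
    rintro _ ⟨x, hx, rfl⟩ _ ⟨y, hy, rfl⟩
    exact ⟨x * y, mul_mem_restrictDegree hx hy, by simp⟩
  have hDmono : ∀ a b, a ≤ b → D a ≤ D b := fun a b h =>
    Submodule.map_mono (restrictDegree_mono h)
  obtain ⟨T, hT⟩ : ∃ T : Finset A, ∀ x : A, ∃ c : A → MvPolynomial (Fin s) k,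
      x = ∑ t ∈ T, g (c t) * t := by
    let := g.toRingHom.toAlgebra
    have hmf : Module.Finite (MvPolynomial (Fin s) k) A := hfin
    obtain ⟨T, hT⟩ := hmf.fg_top
    refine ⟨T, fun x => ?_⟩
    have hx : x ∈ Submodule.span (MvPolynomial (Fin s) k) (T : Set A) := hT ▸ trivial
    obtain ⟨c, -, hc⟩ := Submodule.mem_span_finset.1 hx
    exact ⟨c, hc.symm⟩
  let V : Submodule k A := Submodule.span k (T : Set A)
  have hVfin : FiniteDimensional k V := FiniteDimensional.span_finset k T
  have hex : ∀ x : A, ∃ N, x ∈ D N * V := by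
    intro x
    obtain ⟨c, hc⟩ := hT x
    choose a ha using fun t => exists_mem_restrictDegree (c t)
    refine ⟨∑ t ∈ T, a t, ?_⟩
    rw [hc]
    refine Submodule.sum_mem _ fun t ht => Submodule.mul_mem_mul ?_ (Submodule.subset_span ht)
    exact ⟨c t, restrictDegree_mono (Finset.single_le_sum (f := a) (fun _ _ => Nat.zero_le _) ht)
      (ha t), rfl⟩
  have hfg : ∀ X : Submodule k A, X.FG → ∃ N, X ≤ D N * V := by
    rintro _ ⟨F, rfl⟩
    choose a ha using hex
    refine ⟨∑ x ∈ F, a x, Submodule.span_le.2 fun x hx => ?_⟩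
    exact mul_le_mul' (hDmono _ _ (Finset.single_le_sum (f := a)
      (fun _ _ => Nat.zero_le _) hx)) le_rfl (ha x)
  obtain ⟨E₁, hE₁⟩ := hfg 1 (Submodule.one_eq_span (R := k) (A := A) ▸ Submodule.fg_span_singleton 1)
  obtain ⟨E₂, hE₂⟩ := hfg (W * V) (hW.mul (Submodule.fg_span T.finite_toSet))
  have hpow : ∀ n, W ^ n ≤ D (E₁ + n * E₂) * V := by
    have key : ∀ n a, W ^ n * (D a * V) ≤ D (a + n * E₂) * V := by
      intro n
      induction n with
      | zero => intro a; simp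
      | succ n ih =>
        intro a
        calc W ^ (n + 1) * (D a * V) = W ^ n * (D a * (W * V)) := by ring
          _ ≤ W ^ n * (D a * (D E₂ * V)) := by gcongr
          _ = W ^ n * ((D a * D E₂) * V) := by ring
          _ ≤ W ^ n * (D (a + E₂) * V) := by gcongr; exact hDmul _ _
          _ ≤ D (a + E₂ + n * E₂) * V := ih _
          _ = D (a + (n + 1) * E₂) * V := by congr 2; ring
    intro n
    calc W ^ n = W ^ n * 1 := (mul_one _).symm
      _ ≤ W ^ n * (D E₁ * V) := by gcongr
      _ ≤ _ := key n E₁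
  refine ⟨T.card * (E₁ + E₂ + 1) ^ e, fun n U hU => ?_⟩
  have hle := hU.trans (hpow n)
  have hspan : D (E₁ + n * E₂) * V = ⨆ t : T, (D (E₁ + n * E₂)).map (LinearMap.mulRight k (t : A)) := by
    apply le_antisymm
    · rw [Submodule.mul_le]
      intro x hx y hy
      obtain ⟨c, -, rfl⟩ := Submodule.mem_span_finset.1 hy
      rw [Finset.mul_sum]
      refine Submodule.sum_mem _ fun t ht => ?_
      refine Submodule.mem_iSup_of_mem ⟨t, ht⟩ ⟨c t • x, Submodule.smul_mem _ _ hx, ?_⟩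
      simp
    · refine iSup_le fun t => ?_
      rintro _ ⟨x, hx, rfl⟩
      exact Submodule.mul_mem_mul hx (Submodule.subset_span t.2)
  have hfd : FiniteDimensional k (D (E₁ + n * E₂) * V : Submodule k A) := by
    rw [hspan]; infer_instance
  refine ⟨Submodule.finiteDimensional_of_le hle, (Submodule.finrank_mono hle).trans ?_⟩
  rw [hspan]
  calc _ ≤ ∑ t : T, Module.finrank k ((D (E₁ + n * E₂)).map (LinearMap.mulRight k (t : A))) :=
        finrank_iSup_le_sum _
    _ ≤ ∑ t : T, (E₁ + n * E₂ + 1) ^ s :=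
        Finset.sum_le_sum fun t _ => (Submodule.finrank_map_le _ _).trans (hDrank _)
    _ = T.card * (E₁ + n * E₂ + 1) ^ s := by simp
    _ ≤ T.card * (E₁ + n * E₂ + 1) ^ e := by gcongr; omega
    _ ≤ T.card * ((E₁ + E₂ + 1) * (n + 1)) ^ e := by gcongr; nlinarith
    _ = _ := by rw [mul_pow, mul_assoc]

section GradedPieces

variable {k : Type*} [Field k]

lemma gradedPieceLen_eq_finrank_map {M : Type*} [AddCommGroup M] [Module k M]
    (ℳ : ℕ → Submodule k M) (N : Submodule k M) (n : ℕ) :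
    gradedPieceLen k ℳ N n = Module.finrank k ((ℳ n).map N.mkQ) := by
  have h1 : LinearMap.ker (N.mkQ ∘ₗ (ℳ n).subtype) = N.comap (ℳ n).subtype := by
    rw [LinearMap.ker_comp, Submodule.ker_mkQ]
  have h2 : LinearMap.range (N.mkQ ∘ₗ (ℳ n).subtype) = (ℳ n).map N.mkQ := by
    rw [LinearMap.range_comp, Submodule.range_subtype]
  rw [gradedPieceLen, ← h1, ← h2]
  exact (LinearMap.quotKerEquivRange _).finrank_eq

lemma gradedPieceLen_add_finrank_inf {M : Type*} [AddCommGroup M] [Module k M]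
    (ℳ : ℕ → Submodule k M) (N : Submodule k M) (n : ℕ) [FiniteDimensional k (ℳ n)] :
    gradedPieceLen k ℳ N n + Module.finrank k (ℳ n ⊓ N : Submodule k M)
      = Module.finrank k (ℳ n) := by
  rw [gradedPieceLen, ← Submodule.finrank_quotient_add_finrank (N.comap (ℳ n).subtype)]
  congr 1
  rw [← Submodule.map_comap_subtype, Submodule.finrank_map_subtype_eq]

lemma gradedPieceLen_le_of_le_sup {M : Type*} [AddCommGroup M] [Module k M]
    (ℳ : ℕ → Submodule k M) (N W : Submodule k M) (n : ℕ) [FiniteDimensional k W]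
    (h : ℳ n ≤ W ⊔ N) : gradedPieceLen k ℳ N n ≤ Module.finrank k W := by
  rw [gradedPieceLen_eq_finrank_map]
  refine (Submodule.finrank_mono (t := W.map N.mkQ) ?_).trans (Submodule.finrank_map_le _ _)
  refine (Submodule.map_mono h).trans ?_
  rw [Submodule.map_sup]
  simp

lemma exists_complement_finrank_eq_gradedPieceLen {M : Type*} [AddCommGroup M] [Module k M]
    (ℳ : ℕ → Submodule k M) (N : Submodule k M) (n : ℕ) [FiniteDimensional k (ℳ n)] :
    ∃ W ≤ ℳ n, ℳ n ≤ W ⊔ (ℳ n ⊓ N) ∧ Module.finrank k W = gradedPieceLen k ℳ N n := by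
  obtain ⟨W, hW⟩ := Submodule.exists_isCompl (N.comap (ℳ n).subtype)
  refine ⟨W.map (ℳ n).subtype, Submodule.map_subtype_le _ _, ?_, ?_⟩
  · rw [inf_comm, inf_comm, ← Submodule.map_comap_subtype, ← Submodule.map_sup, sup_comm,
      hW.sup_eq_top, Submodule.map_subtype_top]
  · rw [Submodule.finrank_map_subtype_eq]
    have h1 := Submodule.finrank_add_eq_of_isCompl hW
    have h2 := gradedPieceLen_add_finrank_inf ℳ N n
    rw [← Submodule.map_comap_subtype, Submodule.finrank_map_subtype_eq] at h2
    omega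

end GradedPieces

section GradedAlgebra

variable {k R : Type*} [Field k] [CommRing R] [Algebra k R] (𝒜 : ℕ → Submodule k R)
  [GradedAlgebra 𝒜]

lemma GradedAlgebra.proj_mem (n : ℕ) (x : R) : GradedAlgebra.proj 𝒜 n x ∈ 𝒜 n := by
  rw [GradedAlgebra.proj_apply]
  exact SetLike.coe_mem _

lemma GradedAlgebra.proj_of_mem {n : ℕ} {x : R} (hx : x ∈ 𝒜 n) : GradedAlgebra.proj 𝒜 n x = x := by
  rw [GradedAlgebra.proj_apply, DirectSum.decompose_of_mem_same 𝒜 hx]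

lemma GradedAlgebra.proj_of_mem_ne {n m : ℕ} {x : R} (hx : x ∈ 𝒜 n) (h : n ≠ m) :
    GradedAlgebra.proj 𝒜 m x = 0 := by
  rw [GradedAlgebra.proj_apply, DirectSum.decompose_of_mem_ne 𝒜 hx h]

lemma GradedAlgebra.proj_mem_ideal {J : Ideal R} (hJ : J.IsHomogeneous 𝒜) (n : ℕ) {x : R}
    (hx : x ∈ J) : GradedAlgebra.proj 𝒜 n x ∈ J := by
  rw [GradedAlgebra.proj_apply]
  exact hJ n hx

lemma GradedAlgebra.proj_mul_left {a n : ℕ} {x : R} (hx : x ∈ 𝒜 a) (y : R) :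
    GradedAlgebra.proj 𝒜 n (x * y) = if a ≤ n then x * GradedAlgebra.proj 𝒜 (n - a) y else 0 := by
  simp only [GradedAlgebra.proj_apply]
  split_ifs with h
  · exact DirectSum.coe_decompose_mul_of_left_mem_of_le 𝒜 hx h
  · exact DirectSum.coe_decompose_mul_of_left_mem_of_not_le 𝒜 hx h

lemma GradedAlgebra.sum_proj (x : R) : ∃ B, x = ∑ n ∈ Finset.range B, GradedAlgebra.proj 𝒜 n x := by
  classical
  obtain ⟨B, hB⟩ := (DirectSum.decompose 𝒜 x).support.exists_nat_subset_range
  refine ⟨B, ?_⟩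
  conv_lhs => rw [← DirectSum.sum_support_decompose 𝒜 x]
  refine Finset.sum_subset hB fun n _ hn => ?_
  simpa using hn

lemma GradedAlgebra.exists_fg_le_pow [Algebra.FiniteType k R] (h0 : 𝒜 0 ≤ Submodule.span k {1}) :
    ∃ V : Submodule k R, V.FG ∧ 1 ≤ V ∧ ∀ n, 𝒜 n ≤ V ^ n := by
  classical
  obtain ⟨S, hS⟩ := (Algebra.FiniteType.out : (⊤ : Subalgebra k R).FG)
  choose B hB using GradedAlgebra.sum_proj 𝒜
  let G : Set R := insert 1 (⋃ s ∈ S, (fun i => GradedAlgebra.proj 𝒜 i s) '' Set.univ)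
  have hfin : G.Finite := by
    refine Set.Finite.insert _ (Set.Finite.biUnion S.finite_toSet fun s _ => ?_)
    refine (((DirectSum.decompose 𝒜 s).support.finite_toSet.image
      fun i => GradedAlgebra.proj 𝒜 i s).insert 0).subset ?_
    rintro _ ⟨i, -, rfl⟩
    by_cases hi : i ∈ (DirectSum.decompose 𝒜 s).support
    · exact Or.inr ⟨i, hi, rfl⟩
    · left
      simpa using hi
  let V := Submodule.span k G
  have h1V : (1 : Submodule k R) ≤ V := by
    rw [Submodule.one_eq_span, Submodule.span_le]
    rintro _ rfl
    exact Submodule.subset_span (Set.mem_insert _ _)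
  refine ⟨V, Submodule.fg_span hfin, h1V, ?_⟩
  have h01 : 𝒜 0 ≤ 1 := by rwa [Submodule.one_eq_span]
  have key : ∀ x : R, ∀ n, GradedAlgebra.proj 𝒜 n x ∈ V ^ n := by
    intro x
    have hx : x ∈ Algebra.adjoin k (S : Set R) := hS ▸ trivial
    induction hx using Algebra.adjoin_induction with
    | mem x hx =>
      intro n
      rcases Nat.eq_zero_or_pos n with rfl | hn
      · simpa using h01 (GradedAlgebra.proj_mem 𝒜 0 x)
      · have : V ^ 1 ≤ V ^ n := pow_le_pow_right' h1V hn
        rw [pow_one] at this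
        apply this
        refine Submodule.subset_span (Or.inr ?_)
        exact Set.mem_biUnion hx ⟨n, trivial, rfl⟩
    | algebraMap r =>
      intro n
      have hr : algebraMap k R r ∈ 𝒜 0 := SetLike.algebraMap_mem_graded 𝒜 r
      rcases Nat.eq_zero_or_pos n with rfl | hn
      · rw [pow_zero]
        exact h01 (GradedAlgebra.proj_mem 𝒜 0 _)
      · rw [GradedAlgebra.proj_of_mem_ne 𝒜 hr hn.ne]
        exact Submodule.zero_mem _
    | add x y _ _ hx hy =>
      intro n
      rw [map_add]
      exact Submodule.add_mem _ (hx n) (hy n)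
    | mul x y _ _ hx hy =>
      intro n
      conv in x * y => rw [hB x]
      rw [Finset.sum_mul, map_sum]
      refine Submodule.sum_mem _ fun i _ => ?_
      rw [GradedAlgebra.proj_mul_left 𝒜 (GradedAlgebra.proj_mem 𝒜 i x)]
      split_ifs with h
      · obtain ⟨j, rfl⟩ := Nat.exists_eq_add_of_le h
        rw [pow_add, Nat.add_sub_cancel_left]
        exact Submodule.mul_mem_mul (hx i) (hy j)
      · exact Submodule.zero_mem _
  intro n x hx
  rw [← GradedAlgebra.proj_of_mem 𝒜 hx]
  exact key x n

lemma finiteDimensional_gradedPiece [Nontrivial R] [Algebra.FiniteType k R]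
    (h0 : 𝒜 0 ≤ Submodule.span k {1}) (n : ℕ) : FiniteDimensional k (𝒜 n) := by
  obtain ⟨V, hV, -, hle⟩ := GradedAlgebra.exists_fg_le_pow 𝒜 h0
  obtain ⟨s, hs, -⟩ := exists_finite_inj_algHom_ringKrullDim k R
  obtain ⟨C, hC⟩ := exists_finrank_pow_le s hs.le V hV
  exact (hC n _ (hle n)).1

lemma sum_gradedPieceLen_le {J : Ideal R} (hJ : J.IsHomogeneous 𝒜)
    [∀ n, FiniteDimensional k (𝒜 n)] (N : ℕ) :
    ∑ m ∈ Finset.range N, gradedPieceLen k 𝒜 (J.restrictScalars k) m ≤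
      Module.finrank k (((Finset.range N).sup 𝒜).map (J.restrictScalars k).mkQ) := by
  induction N with
  | zero => simp
  | succ N ih =>
    rw [Finset.sum_range_succ, Finset.range_add_one, Finset.sup_insert, Submodule.map_sup,
      gradedPieceLen_eq_finrank_map]
    have h := Submodule.finrank_sup_add_finrank_inf_eq ((𝒜 N).map (J.restrictScalars k).mkQ)
      (((Finset.range N).sup 𝒜).map (J.restrictScalars k).mkQ)
    have hdis : (𝒜 N).map (J.restrictScalars k).mkQ ⊓
        ((Finset.range N).sup 𝒜).map (J.restrictScalars k).mkQ = ⊥ := by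
      rw [eq_bot_iff]
      rintro _ ⟨⟨x, hx, rfl⟩, y, hy, hxy⟩
      have hker : (Finset.range N).sup 𝒜 ≤ LinearMap.ker (GradedAlgebra.proj 𝒜 N) := by
        refine Finset.sup_le fun m hm z hz => ?_
        exact GradedAlgebra.proj_of_mem_ne 𝒜 hz (Finset.mem_range.1 hm).ne
      have hy0 : GradedAlgebra.proj 𝒜 N y = 0 := hker hy
      have hmem : y - x ∈ J := by
        have := (Submodule.Quotient.eq _).1 hxy
        simpa using this
      have h2 := GradedAlgebra.proj_mem_ideal 𝒜 hJ N hmem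
      rw [map_sub, hy0, GradedAlgebra.proj_of_mem 𝒜 hx, zero_sub, neg_mem_iff] at h2
      simpa using h2
    rw [hdis, finrank_bot] at h
    omega

lemma exists_sum_gradedPieceLen_le [Algebra.FiniteType k R] [Nontrivial R]
    (h0 : 𝒜 0 ≤ Submodule.span k {1})
    {J : Ideal R} (hJ : J.IsHomogeneous 𝒜) (hJt : J ≠ ⊤) (e : ℕ) (he : ringKrullDim (R ⧸ J) ≤ e) :
    ∃ C : ℕ, ∀ N, ∑ m ∈ Finset.range (N + 1), gradedPieceLen k 𝒜 (J.restrictScalars k) m ≤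
      C * (N + 1) ^ e := by
  have hfd := finiteDimensional_gradedPiece 𝒜 h0
  have : Nontrivial (R ⧸ J) := Ideal.Quotient.nontrivial_iff.2 hJt
  obtain ⟨V, hV, h1V, hle⟩ := GradedAlgebra.exists_fg_le_pow 𝒜 h0
  obtain ⟨C, hC⟩ := exists_finrank_pow_le (k := k) (A := R ⧸ J) e he
    (V.map (Ideal.Quotient.mkₐ k J).toLinearMap) (hV.map _)
  refine ⟨C, fun N => (sum_gradedPieceLen_le 𝒜 hJ _).trans ?_⟩
  have hle' : (Finset.range (N + 1)).sup 𝒜 ≤ V ^ N :=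
    Finset.sup_le fun m hm => (hle m).trans
      (pow_le_pow_right' h1V (Nat.lt_succ_iff.1 (Finset.mem_range.1 hm)))
  have h2 := (hC N (((Finset.range (N + 1)).sup 𝒜).map (Ideal.Quotient.mkₐ k J).toLinearMap)
    (by rw [← Submodule.map_pow]; exact Submodule.map_mono hle')).2
  exact h2

lemma gradedPieceLen_le_add {J : Ideal R} (hJ : J.IsHomogeneous 𝒜)
    [∀ n, FiniteDimensional k (𝒜 n)] {a : ℕ} {x y : R} (hx : x ∈ 𝒜 a) (hxy : x * y ∈ J) (n : ℕ) :
    gradedPieceLen k 𝒜 (J.restrictScalars k) n ≤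
      gradedPieceLen k 𝒜 ((J ⊔ Ideal.span {x}).restrictScalars k) n +
      gradedPieceLen k 𝒜 ((J ⊔ Ideal.span {y}).restrictScalars k) (n - a) := by
  obtain ⟨W, hW, hWle, hWr⟩ := exists_complement_finrank_eq_gradedPieceLen 𝒜
    ((J ⊔ Ideal.span {x}).restrictScalars k) n
  obtain ⟨X, hX, hXle, hXr⟩ := exists_complement_finrank_eq_gradedPieceLen 𝒜
    ((J ⊔ Ideal.span {y}).restrictScalars k) (n - a)
  have := Submodule.finiteDimensional_of_le hW
  have := Submodule.finiteDimensional_of_le hX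
  rw [← hWr, ← hXr]
  refine (gradedPieceLen_le_of_le_sup 𝒜 _ (W ⊔ X.map (LinearMap.mulLeft k x)) n ?_).trans
    ((Submodule.finrank_add_le_finrank_add_finrank _ _).trans
      (Nat.add_le_add_left (Submodule.finrank_map_le _ _) _))
  intro z hz
  obtain ⟨w, hw, z', ⟨hz'n, hz'⟩, rfl⟩ := Submodule.mem_sup.1 (hWle hz)
  rw [sup_assoc]
  refine Submodule.add_mem_sup hw ?_
  obtain ⟨j, hj, t, ht, rfl⟩ := Submodule.mem_sup.1 (show z' ∈ J ⊔ Ideal.span {x} from hz')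
  obtain ⟨b, rfl⟩ := Ideal.mem_span_singleton'.1 ht
  rw [← GradedAlgebra.proj_of_mem 𝒜 hz'n, map_add, mul_comm, GradedAlgebra.proj_mul_left 𝒜 hx]
  rw [add_comm]
  have hjn : GradedAlgebra.proj 𝒜 n j ∈ J.restrictScalars k :=
    GradedAlgebra.proj_mem_ideal 𝒜 hJ n hj
  refine Submodule.add_mem _ ?_ (Submodule.mem_sup_right hjn)
  split_ifs with h
  · obtain ⟨c, hc, c', ⟨-, hc'⟩, hcc⟩ :=
      Submodule.mem_sup.1 (hXle (GradedAlgebra.proj_mem 𝒜 (n - a) b))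
    rw [← hcc, mul_add]
    refine Submodule.add_mem_sup ⟨c, hc, rfl⟩ ?_
    obtain ⟨i, hi, t, ht, rfl⟩ := Submodule.mem_sup.1 (show c' ∈ J ⊔ Ideal.span {y} from hc')
    obtain ⟨b', rfl⟩ := Ideal.mem_span_singleton'.1 ht
    change x * (i + b' * y) ∈ J
    have h3 : x * (i + b' * y) = x * i + b' * (x * y) := by ring
    rw [h3]
    exact J.add_mem (J.mul_mem_left _ hi) (J.mul_mem_left _ hxy)
  · exact Submodule.zero_mem _

lemma gradedPieceLen_le_of_mul_mem {J : Ideal R} [∀ n, FiniteDimensional k (𝒜 n)]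
    {a : ℕ} {g : R} (hg : g ∈ 𝒜 a) (hinj : ∀ x, g * x ∈ J → x ∈ J) (n : ℕ) :
    gradedPieceLen k 𝒜 (J.restrictScalars k) n ≤
      gradedPieceLen k 𝒜 (J.restrictScalars k) (a + n) := by
  rw [gradedPieceLen_eq_finrank_map, gradedPieceLen_eq_finrank_map]
  let f : (R ⧸ J) →ₗ[k] (R ⧸ J) := LinearMap.mulLeft k (Ideal.Quotient.mk J g)
  have hf : Function.Injective f := by
    rw [injective_iff_map_eq_zero]
    intro x
    obtain ⟨x, rfl⟩ := Ideal.Quotient.mk_surjective x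
    intro hx
    have h1 : Ideal.Quotient.mk J (g * x) = 0 := by simpa [f] using hx
    exact Ideal.Quotient.eq_zero_iff_mem.2 (hinj x (Ideal.Quotient.eq_zero_iff_mem.1 h1))
  let X : Submodule k (R ⧸ J) := (𝒜 n).map (Ideal.Quotient.mkₐ k J).toLinearMap
  let Y : Submodule k (R ⧸ J) := (𝒜 (a + n)).map (Ideal.Quotient.mkₐ k J).toLinearMap
  change Module.finrank k X ≤ Module.finrank k Y
  rw [(Submodule.equivMapOfInjective f hf X).finrank_eq]
  refine Submodule.finrank_mono ?_
  rintro _ ⟨_, ⟨x, hx, rfl⟩, rfl⟩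
  exact ⟨g * x, SetLike.mul_mem_graded hg hx, by simp [f]⟩

/-- The Hilbert function of a proper graded quotient of a `d`-dimensional graded domain is bounded
by a polynomial of degree `d - 2`. -/
lemma exists_gradedPieceLen_le [Algebra.FiniteType k R] [IsDomain R] [IsNoetherianRing R]
    (h0 : 𝒜 0 ≤ Submodule.span k {1}) (d : ℕ) (hd : 2 ≤ d) (hdim : ringKrullDim R = d)
    (J : Ideal R) (hJ : J.IsHomogeneous 𝒜) (hJ0 : J ≠ ⊥) :
    ∃ C : ℕ, ∀ n, gradedPieceLen k 𝒜 (J.restrictScalars k) n ≤ C * (n + 1) ^ (d - 2) := by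
  have hfd := finiteDimensional_gradedPiece 𝒜 h0
  revert hJ hJ0
  refine IsNoetherian.induction (P := fun J : Ideal R => J.IsHomogeneous 𝒜 → J ≠ ⊥ →
    ∃ C : ℕ, ∀ n, gradedPieceLen k 𝒜 (J.restrictScalars k) n ≤ C * (n + 1) ^ (d - 2)) ?_ J
  intro (J : Ideal R) ih hJ hJ0
  by_cases hJt : J = ⊤
  · refine ⟨0, fun n => ?_⟩
    refine (gradedPieceLen_le_of_le_sup 𝒜 _ ⊥ n ?_).trans (by simp)
    subst hJt
    simp
  by_cases hP : J.IsPrime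
  · have hdim' : ringKrullDim (R ⧸ J) ≤ (d - 1 : ℕ) := by
      obtain ⟨r, hrJ, hr⟩ := Submodule.exists_mem_ne_zero_of_ne_bot hJ0
      have h1 := ringKrullDim_succ_le_of_surjective (Ideal.Quotient.mk J)
        Ideal.Quotient.mk_surjective (r := r) (mem_nonZeroDivisors_of_ne_zero hr)
        (Ideal.Quotient.eq_zero_iff_mem.2 hrJ)
      rw [hdim] at h1
      have : Nontrivial (R ⧸ J) := Ideal.Quotient.nontrivial_iff.2 hJt
      obtain ⟨s, hs, -⟩ := exists_finite_inj_algHom_ringKrullDim k (R ⧸ J)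
      rw [hs] at h1 ⊢
      have h2 : s + 1 ≤ d := by exact_mod_cast h1
      have h3 : s ≤ d - 1 := by omega
      exact_mod_cast h3
    by_cases hpos : ∀ a, 0 < a → 𝒜 a ≤ J.restrictScalars k
    · refine ⟨gradedPieceLen k 𝒜 (J.restrictScalars k) 0, fun n => ?_⟩
      rcases Nat.eq_zero_or_pos n with rfl | hn
      · simp
      · refine (gradedPieceLen_le_of_le_sup 𝒜 _ ⊥ n ?_).trans (by simp)
        simpa using hpos n hn
    · push Not at hpos
      obtain ⟨a, ha, hle⟩ := hpos
      obtain ⟨g, hg, hgJ⟩ := SetLike.not_le_iff_exists.1 hle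
      have hmono : ∀ n i, gradedPieceLen k 𝒜 (J.restrictScalars k) n ≤
          gradedPieceLen k 𝒜 (J.restrictScalars k) (n + a * i) := by
        intro n i
        induction i with
        | zero => simp
        | succ i ihi =>
          refine ihi.trans ((gradedPieceLen_le_of_mul_mem 𝒜 hg
            (fun x hx => (hP.mem_or_mem hx).resolve_left hgJ) _).trans_eq ?_)
          congr 1
          ring
      obtain ⟨C, hC⟩ := exists_sum_gradedPieceLen_le 𝒜 h0 hJ hJt (d - 1) hdim'
      refine ⟨C * (a + 1) ^ (d - 1), fun n => ?_⟩
      have h1 : (n + 1) * gradedPieceLen k 𝒜 (J.restrictScalars k) n ≤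
          C * (n + a * n + 1) ^ (d - 1) := by
        refine le_trans ?_ (hC (n + a * n))
        have hinj : Function.Injective fun i => n + a * i := by
          intro i j hij
          exact Nat.eq_of_mul_eq_mul_left ha (Nat.add_left_cancel hij)
        calc (n + 1) * gradedPieceLen k 𝒜 (J.restrictScalars k) n
            = ∑ i ∈ Finset.range (n + 1), gradedPieceLen k 𝒜 (J.restrictScalars k) n := by simp
          _ ≤ ∑ i ∈ Finset.range (n + 1), gradedPieceLen k 𝒜 (J.restrictScalars k) (n + a * i) :=
              Finset.sum_le_sum fun i _ => hmono n i
          _ = ∑ m ∈ (Finset.range (n + 1)).image (fun i => n + a * i),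
                gradedPieceLen k 𝒜 (J.restrictScalars k) m :=
              (Finset.sum_image fun i _ j _ h => hinj h).symm
          _ ≤ _ := by
              refine Finset.sum_le_sum_of_subset fun m hm => ?_
              obtain ⟨i, hi, rfl⟩ := Finset.mem_image.1 hm
              have := Finset.mem_range.1 hi
              have : a * i ≤ a * n := Nat.mul_le_mul_left _ (by omega)
              exact Finset.mem_range.2 (by omega)
      have h2 : C * (n + a * n + 1) ^ (d - 1) ≤
          (n + 1) * (C * (a + 1) ^ (d - 1) * (n + 1) ^ (d - 2)) := by
        have h3 : (n + 1) * (C * (a + 1) ^ (d - 1) * (n + 1) ^ (d - 2)) =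
            C * ((a + 1) * (n + 1)) ^ (d - 1) := by
          obtain ⟨e, rfl⟩ := Nat.exists_eq_add_of_le hd
          rw [mul_pow, show 2 + e - 1 = e + 1 by omega, show 2 + e - 2 = e by omega]
          ring
        rw [h3]
        gcongr
        nlinarith
      exact Nat.le_of_mul_le_mul_left (h1.trans h2) (Nat.succ_pos n)
  · have hxy : ∃ x y : R, SetLike.IsHomogeneousElem 𝒜 x ∧ SetLike.IsHomogeneousElem 𝒜 y ∧
        x * y ∈ J ∧ x ∉ J ∧ y ∉ J := by
      by_contra! h
      refine hP (Ideal.IsHomogeneous.isPrime_of_homogeneous_mem_or_mem hJ hJt ?_)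
      intro x y hx hy hxy
      by_cases hxJ : x ∈ J
      · exact Or.inl hxJ
      · exact Or.inr (h x y hx hy hxy hxJ)
    obtain ⟨x, y, ⟨a, hx⟩, ⟨b, hy⟩, hxy, hxJ, hyJ⟩ := hxy
    have aux : ∀ z ∉ J, SetLike.IsHomogeneousElem 𝒜 z → ∃ C : ℕ, ∀ n,
        gradedPieceLen k 𝒜 ((J ⊔ Ideal.span {z}).restrictScalars k) n ≤ C * (n + 1) ^ (d - 2) := by
      intro z hz hzh
      refine ih _ ?_ ?_ ?_
      · refine lt_of_le_of_ne le_sup_left fun h => hz ?_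
        rw [h]
        exact Ideal.mem_sup_right (Ideal.mem_span_singleton_self z)
      · refine hJ.sup (Ideal.homogeneous_span 𝒜 _ ?_)
        rintro _ rfl
        exact hzh
      · exact fun h => hJ0 (eq_bot_iff.2 (le_sup_left.trans h.le))
    obtain ⟨C₁, h₁⟩ := aux x hxJ ⟨a, hx⟩
    obtain ⟨C₂, h₂⟩ := aux y hyJ ⟨b, hy⟩
    refine ⟨C₁ + C₂, fun n => (gradedPieceLen_le_add 𝒜 hJ hx hxy n).trans ?_⟩
    rw [add_mul]
    refine add_le_add (h₁ n) ((h₂ (n - a)).trans ?_)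
    gcongr
    omega

end GradedAlgebra

section Frobenius

variable {k R : Type*} [Field k] [CommRing R] [Algebra k R] (𝒜 : ℕ → Submodule k R)
  [GradedAlgebra 𝒜] (p : ℕ) [Fact p.Prime] [CharP R p]

lemma frobenius_finite [PerfectField k] [CharP k p] [Algebra.FiniteType k R] :
    (frobenius R p).Finite := by
  refine RingHom.IsIntegral.to_finite ?_ ?_
  · intro x
    refine ⟨Polynomial.X ^ p - Polynomial.C x,
      Polynomial.monic_X_pow_sub_C x (Fact.out : p.Prime).ne_zero, ?_⟩
    simp [frobenius_def]
  · have hk : ((frobenius R p).comp (algebraMap k R)).FiniteType := by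
      have h1 : (frobenius R p).comp (algebraMap k R) = (algebraMap k R).comp (frobenius k p) := by
        ext x
        simp [frobenius_def]
      rw [h1]
      refine RingHom.FiniteType.comp (RingHom.finiteType_algebraMap.2 inferInstance)
        (RingHom.FiniteType.of_surjective _ ?_)
      have := PerfectField.toPerfectRing (K := k) p
      exact (bijective_frobenius k p).2
    exact hk.of_comp_finiteType

lemma GradedAlgebra.pow_mem {i : ℕ} {x : R} (hx : x ∈ 𝒜 i) (n : ℕ) : x ^ n ∈ 𝒜 (n * i) :=
  SetLike.pow_mem_graded n hx

lemma GradedAlgebra.proj_mul_of_mem {m n i : ℕ} {v : R} (hv : v ∈ 𝒜 m) (hn : i + m = n) (c : R) :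
    GradedAlgebra.proj 𝒜 n (c * v) = GradedAlgebra.proj 𝒜 i c * v := by
  subst hn
  rw [mul_comm, GradedAlgebra.proj_mul_left 𝒜 hv, if_pos (Nat.le_add_left _ _),
    Nat.add_sub_cancel, mul_comm]

lemma GradedAlgebra.proj_pow_char (n : ℕ) (x : R) :
    GradedAlgebra.proj 𝒜 (p * n) (x ^ p) = GradedAlgebra.proj 𝒜 n x ^ p := by
  obtain ⟨B, hB⟩ := GradedAlgebra.sum_proj 𝒜 x
  have hp : p ≠ 0 := (Fact.out : p.Prime).ne_zero
  conv_lhs => rw [hB]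
  rw [sum_pow_char p, map_sum, Finset.sum_eq_single n]
  · exact GradedAlgebra.proj_of_mem 𝒜 (GradedAlgebra.pow_mem 𝒜 (GradedAlgebra.proj_mem 𝒜 n x) p)
  · intro i _ hi
    exact GradedAlgebra.proj_of_mem_ne 𝒜
      (GradedAlgebra.pow_mem 𝒜 (GradedAlgebra.proj_mem 𝒜 i x) p)
      (fun h => hi (Nat.eq_of_mul_eq_mul_left (Nat.pos_of_ne_zero hp) h))
  · intro hn
    have h0 : GradedAlgebra.proj 𝒜 n x = 0 := by
      conv_lhs => rw [hB]
      rw [map_sum]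
      refine Finset.sum_eq_zero fun i hi => ?_
      refine GradedAlgebra.proj_of_mem_ne 𝒜 (GradedAlgebra.proj_mem 𝒜 i x) ?_
      rintro rfl
      exact hn hi
    rw [h0, zero_pow hp, map_zero]

lemma GradedAlgebra.proj_pow_char_of_not_dvd {n : ℕ} (hn : ¬ p ∣ n) (x : R) :
    GradedAlgebra.proj 𝒜 n (x ^ p) = 0 := by
  obtain ⟨B, hB⟩ := GradedAlgebra.sum_proj 𝒜 x
  rw [hB, sum_pow_char p, map_sum]
  refine Finset.sum_eq_zero fun i _ => ?_
  refine GradedAlgebra.proj_of_mem_ne 𝒜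
      (GradedAlgebra.pow_mem 𝒜 (GradedAlgebra.proj_mem 𝒜 i x) p) ?_
  rintro rfl
  exact hn (dvd_mul_right _ _)

lemma GradedAlgebra.exists_proj_pow_mul {m : ℕ} {v : R} (hv : v ∈ 𝒜 m) (c : R) (n : ℕ) :
    ∃ c' : R, GradedAlgebra.proj 𝒜 n (c ^ p * v) = c' ^ p * v ∧
      (c' = 0 ∨ ∃ i, p * i + m = n ∧ c' ∈ 𝒜 i) := by
  have hp : p ≠ 0 := (Fact.out : p.Prime).ne_zero
  by_cases hmn : m ≤ n
  · obtain ⟨j, rfl⟩ := Nat.exists_eq_add_of_le' hmn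
    rw [GradedAlgebra.proj_mul_of_mem 𝒜 hv rfl]
    by_cases hj : p ∣ j
    · obtain ⟨i, rfl⟩ := hj
      rw [GradedAlgebra.proj_pow_char]
      exact ⟨_, rfl, Or.inr ⟨i, rfl, GradedAlgebra.proj_mem 𝒜 i c⟩⟩
    · rw [GradedAlgebra.proj_pow_char_of_not_dvd 𝒜 p hj]
      exact ⟨0, by simp [hp], Or.inl rfl⟩
  · rw [mul_comm, GradedAlgebra.proj_mul_left 𝒜 hv, if_neg hmn]
    exact ⟨0, by simp [hp], Or.inl rfl⟩

lemma frobenius_range_finite (hF : (frobenius R p).Finite) :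
    Module.Finite (frobenius R p).range R := by
  have h : ((frobenius R p).range.subtype.comp (frobenius R p).rangeRestrict).Finite := hF
  exact RingHom.finite_algebraMap.1 h.of_comp_finite

lemma exists_homogeneous_frobenius_generators (hF : (frobenius R p).Finite) :
    ∃ (N : ℕ) (u : Fin N → R) (b : Fin N → ℕ), (∀ i, u i ∈ 𝒜 (b i)) ∧
      ∀ x : R, ∃ z : Fin N → R, x = ∑ i, z i ^ p * u i := by
  classical
  have := frobenius_range_finite p hF
  let S := (frobenius R p).range
  let H : Set R := {x | SetLike.IsHomogeneousElem 𝒜 x}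
  have hH : Submodule.span S H = ⊤ := by
    rw [eq_top_iff]
    rintro x -
    rw [(GradedAlgebra.sum_proj 𝒜 x).choose_spec]
    exact Submodule.sum_mem _ fun i _ =>
      Submodule.subset_span ⟨i, GradedAlgebra.proj_mem 𝒜 i x⟩
  obtain ⟨T, hTH, hT⟩ := (Submodule.fg_span_iff_fg_span_finset_subset (R := S) H).1
    (hH ▸ Module.Finite.fg_top)
  choose b hb using fun t : T => hTH t.2
  let e := T.equivFin
  refine ⟨T.card, fun i => e.symm i, fun i => b (e.symm i), fun i => hb _, fun x => ?_⟩
  have hx : x ∈ Submodule.span S (Set.range (fun t : T => (t : R))) := by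
    rw [Subtype.range_coe_subtype, Finset.setOfPred_mem, ← hT, hH]
    trivial
  obtain ⟨c, hc⟩ := (Submodule.mem_span_range_iff_exists_fun S).1 hx
  choose z hz using fun t => (c t).2
  refine ⟨fun i => z (e.symm i), ?_⟩
  rw [← hc, ← e.symm.sum_comp]
  refine Finset.sum_congr rfl fun i _ => ?_
  rw [Subring.smul_def, ← hz, smul_eq_mul, frobenius_def]

omit [GradedAlgebra 𝒜] in
lemma exists_frobenius_basis [IsDomain R] [IsNoetherianRing R] (hF : (frobenius R p).Finite) :
    ∃ (r : ℕ) (v : Fin r → R) (a : Fin r → ℕ), (∀ j, v j ∈ 𝒜 (p * a j)) ∧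
      (∀ c : Fin r → R, ∑ j, c j ^ p * v j = 0 → c = 0) ∧
      ∀ i, ∀ x ∈ 𝒜 (p * i), ∃ h : R, h ≠ 0 ∧ ∃ c : Fin r → R, h ^ p * x = ∑ j, c j ^ p * v j := by
  classical
  have := frobenius_range_finite p hF
  have hp : p ≠ 0 := (Fact.out : p.Prime).ne_zero
  let S := (frobenius R p).range
  have hSN : IsNoetherianRing S :=
    isNoetherianRing_of_surjective R S (frobenius R p).rangeRestrict
      (frobenius R p).rangeRestrict_surjective
  let ι := {x : R // ∃ i, x ∈ 𝒜 (p * i)}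
  obtain ⟨s, hs, hmax⟩ := exists_maximal_linearIndepOn S (fun x : ι => (x : R))
  have hsfin : Finite s := hs.linearIndependent.finite_of_isNoetherian
  have := Fintype.ofFinite s
  let e := Fintype.equivFin s
  choose a ha using fun x : s => x.1.2
  refine ⟨Fintype.card s, fun j => ((e.symm j).1 : R), fun j => a (e.symm j), fun j => ha _,
    fun c hc => ?_, fun i x hx => ?_⟩
  · have hli := Fintype.linearIndependent_iff.1 hs.linearIndependent
      (fun x => (frobenius R p).rangeRestrict (c (e x))) (by
        rw [← hc, ← e.symm.sum_comp]
        refine Finset.sum_congr rfl fun j _ => ?_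
        rw [Subring.smul_def]
        simp [frobenius_def])
    funext j
    have h1 := congrArg Subtype.val (hli (e.symm j))
    have h2 : c j ^ p = 0 := by simpa [frobenius_def] using h1
    exact pow_eq_zero_iff hp |>.1 h2
  · have key : ∃ h : S, h ≠ 0 ∧ h • x ∈ Submodule.span S ((fun x : ι => (x : R)) '' s) := by
      by_cases hxs : (⟨x, i, hx⟩ : ι) ∈ s
      · exact ⟨1, one_ne_zero, by
          rw [one_smul]
          exact Submodule.subset_span ⟨_, hxs, rfl⟩⟩
      · exact hmax _ hxs
    obtain ⟨⟨_, h, rfl⟩, hh0, hh⟩ := key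
    rw [Set.image_eq_range] at hh
    obtain ⟨c, hc⟩ := (Submodule.mem_span_range_iff_exists_fun S).1 hh
    choose z hz using fun t => (c t).2
    refine ⟨h, ?_, fun j => z (e.symm j), ?_⟩
    · rintro rfl
      exact hh0 (Subtype.ext (map_zero _))
    · have hc' : ∑ i, c i • ((i : ι) : R) = h ^ p * x := hc
      rw [← hc', ← e.symm.sum_comp]
      refine Finset.sum_congr rfl fun j _ => ?_
      rw [Subring.smul_def, ← hz, smul_eq_mul, frobenius_def]

end Frobenius

section FrobeniusStructure

variable {k R : Type*} [Field k] [CommRing R] [Algebra k R] (𝒜 : ℕ → Submodule k R)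
  [GradedAlgebra 𝒜]

lemma GradedAlgebra.exists_forall_ge_ne_bot [IsDomain R]
    (hgcd : ∀ c : ℕ, (∀ m, 0 < m → 𝒜 m ≠ ⊥ → c ∣ m) → c = 1) :
    ∃ B, ∀ n ≥ B, ∃ w ∈ 𝒜 n, w ≠ 0 := by
  let M : Set ℕ := {m | 0 < m ∧ 𝒜 m ≠ ⊥}
  obtain ⟨B, hB⟩ := Nat.exists_mem_closure_of_ge M
  refine ⟨B, fun n hn => ?_⟩
  have h1 : Nat.setGcd M = 1 := hgcd _ fun m hm hm' => Nat.setGcd_dvd_of_mem ⟨hm, hm'⟩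
  have hmem := hB n hn (h1 ▸ one_dvd n)
  clear hn
  induction hmem using AddSubmonoid.closure_induction with
  | mem m hm => exact Submodule.exists_mem_ne_zero_of_ne_bot hm.2
  | zero => exact ⟨1, SetLike.one_mem_graded 𝒜, one_ne_zero⟩
  | add x y _ _ hx hy =>
    obtain ⟨v, hv, hv0⟩ := hx
    obtain ⟨w, hw, hw0⟩ := hy
    exact ⟨v * w, SetLike.mul_mem_graded hv hw, mul_ne_zero hv0 hw0⟩

variable (p : ℕ) [Fact p.Prime] [CharP R p]

lemma exists_frobenius_structure [IsDomain R] [IsNoetherianRing R] (hF : (frobenius R p).Finite)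
    (hgcd : ∀ c : ℕ, (∀ m, 0 < m → 𝒜 m ≠ ⊥ → c ∣ m) → c = 1)
    {N : ℕ} (u : Fin N → R) (b : Fin N → ℕ) (hu : ∀ i, u i ∈ 𝒜 (b i)) :
    ∃ r A₀ : ℕ, 0 < r ∧ ∀ A ≥ A₀, ∃ m : Fin r → R, (∀ j, m j ∈ 𝒜 (p * A)) ∧
      (∀ c : Fin r → R, ∑ j, c j ^ p * m j = 0 → c = 0) ∧
      ∃ (a : ℕ) (h : R), h ∈ 𝒜 a ∧ h ≠ 0 ∧
        ∀ i b', b i = p * b' → ∃ c : Fin r → R, h ^ p * u i = ∑ j, c j ^ p * m j := by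
  classical
  have hp : p ≠ 0 := (Fact.out : p.Prime).ne_zero
  obtain ⟨r, v, a, hv, hind, hspan⟩ := exists_frobenius_basis 𝒜 p hF
  obtain ⟨B, hB⟩ := GradedAlgebra.exists_forall_ge_ne_bot 𝒜 hgcd
  refine ⟨r, B + ∑ j, a j, ?_, fun A hA => ?_⟩
  · obtain ⟨h, hh, c, hc⟩ := hspan 0 1 (SetLike.one_mem_graded 𝒜)
    refine Nat.pos_of_ne_zero ?_
    rintro rfl
    exact pow_ne_zero p hh (by simpa using hc)
  have ha : ∀ j, a j + B ≤ A := fun j => by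
    have := Finset.single_le_sum (f := a) (fun _ _ => Nat.zero_le _) (Finset.mem_univ j)
    omega
  choose w hw hw0 using fun j => hB (A - a j) (by have := ha j; omega)
  let m : Fin r → R := fun j => w j ^ p * v j
  have hm : ∀ j, m j ∈ 𝒜 (p * A) := fun j => by
    have h1 := SetLike.mul_mem_graded (GradedAlgebra.pow_mem 𝒜 (hw j) p) (hv j)
    have h2 : p * (A - a j) + p * a j = p * A := by
      rw [← mul_add, Nat.sub_add_cancel (by have := ha j; omega)]
    rwa [h2] at h1
  have hW0 : ∏ j, w j ≠ 0 := Finset.prod_ne_zero_iff.2 fun j _ => hw0 j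
  have hspan' : ∀ i, ∀ x ∈ 𝒜 (p * i),
      ∃ h : R, h ≠ 0 ∧ ∃ c : Fin r → R, h ^ p * x = ∑ j, c j ^ p * m j := by
    intro i x hx
    obtain ⟨h, hh, c, hc⟩ := hspan i x hx
    refine ⟨(∏ j, w j) * h, mul_ne_zero hW0 hh, fun j => c j * ∏ i ∈ Finset.univ.erase j, w i, ?_⟩
    rw [mul_pow, mul_assoc, hc, Finset.mul_sum]
    refine Finset.sum_congr rfl fun j _ => ?_
    rw [← Finset.mul_prod_erase Finset.univ w (Finset.mem_univ j)]
    ring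
  refine ⟨m, hm, fun c hc => ?_, ?_⟩
  · have h1 := hind (fun j => c j * w j) (by
      rw [← hc]
      refine Finset.sum_congr rfl fun j _ => ?_
      rw [mul_pow, mul_assoc])
    funext j
    exact (mul_eq_zero.1 (congrFun h1 j)).resolve_right (hw0 j)
  · have key : ∃ h : R, h ≠ 0 ∧ ∀ i b', b i = p * b' →
        ∃ c : Fin r → R, h ^ p * u i = ∑ j, c j ^ p * m j := by
      have h1 : ∀ i, ∃ h : R, h ≠ 0 ∧ ∀ b', b i = p * b' →
          ∃ c : Fin r → R, h ^ p * u i = ∑ j, c j ^ p * m j := by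
        intro i
        by_cases hb : p ∣ b i
        · obtain ⟨b', hb'⟩ := hb
          obtain ⟨h, hh, hc⟩ := hspan' b' (u i) (hb' ▸ hu i)
          exact ⟨h, hh, fun _ _ => hc⟩
        · exact ⟨1, one_ne_zero, fun b' hb' => absurd (hb' ▸ dvd_mul_right p b') hb⟩
      choose h hh hc using h1
      refine ⟨∏ i, h i, Finset.prod_ne_zero_iff.2 fun i _ => hh i, fun i b' hb' => ?_⟩
      obtain ⟨c, hc⟩ := hc i b' hb'
      refine ⟨fun j => (∏ l ∈ Finset.univ.erase i, h l) * c j, ?_⟩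
      rw [← Finset.mul_prod_erase Finset.univ h (Finset.mem_univ i)]
      calc _ = (∏ l ∈ Finset.univ.erase i, h l) ^ p * (h i ^ p * u i) := by ring
        _ = _ := by
          rw [hc, Finset.mul_sum]
          refine Finset.sum_congr rfl fun j _ => ?_
          ring
    obtain ⟨h, hh, hc⟩ := key
    have hex : ∃ n, GradedAlgebra.proj 𝒜 n h ≠ 0 := by
      by_contra! h0
      obtain ⟨B, hB⟩ := GradedAlgebra.sum_proj 𝒜 h
      exact hh (by rw [hB]; exact Finset.sum_eq_zero fun i _ => h0 i)
    obtain ⟨n, hn⟩ := hex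
    refine ⟨n, _, GradedAlgebra.proj_mem 𝒜 n h, hn, fun i b' hb' => ?_⟩
    obtain ⟨c, hc⟩ := hc i b' hb'
    have h2 : GradedAlgebra.proj 𝒜 (p * n + b i) (h ^ p * u i) =
        GradedAlgebra.proj 𝒜 n h ^ p * u i := by
      rw [GradedAlgebra.proj_mul_of_mem 𝒜 (hu i) rfl, GradedAlgebra.proj_pow_char]
    choose c' hc' _ using fun j => GradedAlgebra.exists_proj_pow_mul 𝒜 p (hm j) (c j) (p * n + b i)
    refine ⟨c', ?_⟩
    rw [← h2, hc, map_sum]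
    exact Finset.sum_congr rfl fun j _ => hc' j

/-- The ideal generated by the `q`-th powers of a finite family. -/
def powSpan {M : ℕ} (f : Fin M → R) (q : ℕ) : Ideal R := Ideal.span (Set.range fun t => f t ^ q)

/-- The dimension of the degree-`n` piece of the ideal generated by the `q`-th powers of a finite
family. -/
def powSpanDim {M : ℕ} (f : Fin M → R) (q n : ℕ) : ℕ :=
  Module.finrank k (𝒜 n ⊓ (powSpan f q).restrictScalars k : Submodule k R)

lemma powSpan_isHomogeneous {M : ℕ} {f : Fin M → R} {δ : Fin M → ℕ} (hf : ∀ t, f t ∈ 𝒜 (δ t))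
    (q : ℕ) : (powSpan f q).IsHomogeneous 𝒜 := by
  refine Ideal.homogeneous_span 𝒜 _ ?_
  rintro _ ⟨t, rfl⟩
  exact ⟨_, GradedAlgebra.pow_mem 𝒜 (hf t) q⟩

omit [Fact p.Prime] [CharP R p] in
lemma pow_char_mem_powSpan [ExpChar R p] {M : ℕ} (f : Fin M → R) (q : ℕ) {x : R}
    (hx : x ∈ powSpan f q) : x ^ p ∈ powSpan f (p * q) := by
  have h : powSpan f q ≤ (powSpan f (p * q)).comap (frobenius R p) := by
    refine Ideal.span_le.2 ?_
    rintro _ ⟨t, rfl⟩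
    change (f t ^ q) ^ p ∈ powSpan f (p * q)
    rw [← pow_mul, mul_comm]
    exact Ideal.subset_span ⟨t, rfl⟩
  exact h hx

lemma mul_powSpanDim_le [PerfectField k] [CharP k p] [∀ n, FiniteDimensional k (𝒜 n)]
    {M r A : ℕ} (f : Fin M → R) (m : Fin r → R) (hm : ∀ j, m j ∈ 𝒜 (p * A))
    (hind : ∀ c : Fin r → R, ∑ j, c j ^ p * m j = 0 → c = 0) (q n : ℕ) :
    r * powSpanDim 𝒜 f q n ≤ powSpanDim 𝒜 f (p * q) (p * (n + A)) := by
  have hp : p ≠ 0 := (Fact.out : p.Prime).ne_zero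
  let X : Submodule k R := 𝒜 n ⊓ (powSpan f q).restrictScalars k
  let Y : Submodule k R := 𝒜 (p * (n + A)) ⊓ (powSpan f (p * q)).restrictScalars k
  have hX : FiniteDimensional k X := Submodule.finiteDimensional_of_le inf_le_left
  have hY : FiniteDimensional k Y := Submodule.finiteDimensional_of_le inf_le_left
  have hmem : ∀ x : Fin r → X, ∑ j, (x j : R) ^ p * m j ∈ Y := by
    intro x
    refine Submodule.sum_mem _ fun j _ => ⟨?_, ?_⟩
    · have h1 := SetLike.mul_mem_graded (GradedAlgebra.pow_mem 𝒜 (x j).2.1 p) (hm j)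
      rwa [← mul_add] at h1
    · exact Ideal.mul_mem_right _ _ (pow_char_mem_powSpan p f q (x j).2.2)
  let φ : (Fin r → X) →+ Y :=
    { toFun := fun x => ⟨_, hmem x⟩
      map_zero' := by
        ext
        simp [hp]
      map_add' := fun x y => by
        ext
        simp [add_pow_char, add_mul, Finset.sum_add_distrib] }
  have hφ : Function.Injective φ := by
    rw [injective_iff_map_eq_zero]
    intro x hx
    have h1 := hind (fun j => (x j : R)) (congrArg Subtype.val hx)
    funext j
    exact Subtype.ext (congrFun h1 j)
  have : PerfectRing k p := PerfectField.toPerfectRing p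
  have hrank := rank_le_of_surjective_injective (frobenius k p) φ (bijective_frobenius k p).2
    hφ (fun c x => by
      ext
      simp [φ, frobenius_def, smul_pow, Finset.smul_sum])
  have hfin := Module.finrank_le_finrank_of_rank_le_rank (Cardinal.lift_le.2 hrank)
    (Module.rank_lt_aleph0 k Y)
  rw [Module.finrank_pi_fintype] at hfin
  simpa [powSpanDim] using hfin

lemma exists_pow_char_mul_mem [CharP k p] (W : Submodule k R) [FiniteDimensional k W] (v : R) :
    ∃ W' : Submodule k R, FiniteDimensional k W' ∧ Module.finrank k W' ≤ Module.finrank k W ∧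
      ∀ x ∈ W, x ^ p * v ∈ W' := by
  let B := Module.finBasis k W
  refine ⟨Submodule.span k (Set.range fun i => (B i : R) ^ p * v),
    FiniteDimensional.span_of_finite k (Set.finite_range _), ?_, fun x hx => ?_⟩
  · exact (finrank_range_le_card _).trans (by simp)
  · have h1 : x = ∑ i, B.repr ⟨x, hx⟩ i • (B i : R) := by
      have h2 := congrArg W.subtype (B.sum_repr ⟨x, hx⟩)
      rw [map_sum] at h2
      exact h2.symm
    rw [h1, sum_pow_char p, Finset.sum_mul]
    refine Submodule.sum_mem _ fun i _ => ?_
    rw [smul_pow, smul_mul_assoc]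
    exact Submodule.smul_mem _ _ (Submodule.subset_span ⟨i, rfl⟩)

lemma powSpanDim_le_mul_add [CharP k p] [∀ n, FiniteDimensional k (𝒜 n)]
    {N : ℕ} (u : Fin N → R) (b : Fin N → ℕ) (hu : ∀ i, u i ∈ 𝒜 (b i))
    (hgen : ∀ x : R, ∃ z : Fin N → R, x = ∑ i, z i ^ p * u i)
    {r A : ℕ} (m : Fin r → R) (hm : ∀ j, m j ∈ 𝒜 (p * A)) (h : R)
    (hspan : ∀ i b', b i = p * b' → ∃ c : Fin r → R, h ^ p * u i = ∑ j, c j ^ p * m j)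
    {M : ℕ} {f : Fin M → R} {δ : Fin M → ℕ} (hf : ∀ t, f t ∈ 𝒜 (δ t)) (C D : ℕ)
    (hC : ∀ n, gradedPieceLen k 𝒜 ((Ideal.span {h}).restrictScalars k) n ≤ C * (n + 1) ^ D)
    (q n : ℕ) :
    powSpanDim 𝒜 f (p * q) (p * (n + A)) ≤
      r * powSpanDim 𝒜 f q n + M * N * (C * (n + A + 1) ^ D) := by
  classical
  have hp : p ≠ 0 := (Fact.out : p.Prime).ne_zero
  have hp0 : 0 < p := Nat.pos_of_ne_zero hp
  have hfq : ∀ t, f t ^ q ∈ 𝒜 (q * δ t) := fun t => GradedAlgebra.pow_mem 𝒜 (hf t) q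
  let κ : Fin M × Fin N → ℕ := fun s => n + A - b s.2 / p - q * δ s.1
  let v : Fin M × Fin N → R := fun s => (f s.1 ^ q) ^ p * u s.2
  have hv : ∀ s, v s ∈ 𝒜 (p * (q * δ s.1) + b s.2) := fun s =>
    SetLike.mul_mem_graded (GradedAlgebra.pow_mem 𝒜 (hfq s.1) p) (hu s.2)
  choose Y hYle hY hYr using fun s => exists_complement_finrank_eq_gradedPieceLen 𝒜
    ((Ideal.span {h}).restrictScalars k) (κ s)
  have hYfin : ∀ s, FiniteDimensional k (Y s) := fun s =>
    Submodule.finiteDimensional_of_le (hYle s)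
  choose Y' hY'fin hY'r hY' using fun s => exists_pow_char_mul_mem p (Y s) (v s)
  let X : Submodule k R := 𝒜 n ⊓ (powSpan f q).restrictScalars k
  have hXfin : FiniteDimensional k X := Submodule.finiteDimensional_of_le inf_le_left
  choose X' hX'fin hX'r hX' using fun j => exists_pow_char_mul_mem p X (m j)
  have key : 𝒜 (p * (n + A)) ⊓ (powSpan f (p * q)).restrictScalars k ≤
      (⨆ j, X' j) ⊔ ⨆ s, Y' s := by
    rintro z ⟨hzA, hz⟩
    obtain ⟨g, rfl⟩ := (Ideal.mem_span_range_iff_exists_fun (R := R)).1 hz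
    choose c hc using fun t => hgen (g t)
    have hz1 : ∑ t, g t * f t ^ (p * q) = ∑ s : Fin M × Fin N, c s.1 s.2 ^ p * v s := by
      rw [Fintype.sum_prod_type]
      refine Finset.sum_congr rfl fun t _ => ?_
      rw [hc t, Finset.sum_mul]
      refine Finset.sum_congr rfl fun i _ => ?_
      simp only [v]
      ring
    choose y hy hy' using fun s => GradedAlgebra.exists_proj_pow_mul 𝒜 p (hv s) (c s.1 s.2)
      (p * (n + A))
    rw [← GradedAlgebra.proj_of_mem 𝒜 hzA, hz1, map_sum]
    refine Submodule.sum_mem _ fun s _ => ?_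
    rw [hy]
    rcases hy' s with h0 | ⟨i, hi, hyi⟩
    · rw [h0, zero_pow hp, zero_mul]
      exact Submodule.zero_mem _
    have hb : p ∣ b s.2 := by
      have h1 : p ∣ p * i + p * (q * δ s.1) + b s.2 := by
        rw [add_assoc, hi]
        exact dvd_mul_right _ _
      exact (Nat.dvd_add_right (by rw [← mul_add]; exact dvd_mul_right _ _)).1 h1
    obtain ⟨b', hb'⟩ := hb
    have hκ : κ s = i := by
      have h1 : i + (q * δ s.1 + b') = n + A := by
        apply Nat.eq_of_mul_eq_mul_left hp0
        rw [← hi, hb']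
        ring
      have h2 : b s.2 / p = b' := by rw [hb', Nat.mul_div_cancel_left _ hp0]
      simp only [κ, h2]
      omega
    have hys : y s ∈ 𝒜 (κ s) := hκ ▸ hyi
    obtain ⟨y₁, hy₁, y₂, ⟨hy₂, hy₂h⟩, hyy⟩ := Submodule.mem_sup.1 (hY s hys)
    obtain ⟨w, rfl⟩ := Ideal.mem_span_singleton'.1 hy₂h
    rw [← hyy, add_pow_char, add_mul]
    refine Submodule.add_mem _ (Submodule.mem_sup_right (Submodule.mem_iSup_of_mem s (hY' s _ hy₁)))
      (Submodule.mem_sup_left ?_)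
    have hdeg : (w * h) ^ p * v s ∈ 𝒜 (p * (n + A)) := by
      have h1 := SetLike.mul_mem_graded (GradedAlgebra.pow_mem 𝒜 hy₂ p) (hv s)
      rwa [hκ, hi] at h1
    obtain ⟨e, he⟩ := hspan s.2 b' hb'
    have h3 : (w * h) ^ p * v s = ∑ j, (w * f s.1 ^ q * e j) ^ p * m j := by
      calc (w * h) ^ p * v s = (w * f s.1 ^ q) ^ p * (h ^ p * u s.2) := by simp only [v]; ring
        _ = _ := by
          rw [he, Finset.mul_sum]
          exact Finset.sum_congr rfl fun j _ => by ring
    rw [← GradedAlgebra.proj_of_mem 𝒜 hdeg, h3, map_sum]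
    refine Submodule.sum_mem _ fun j _ => Submodule.mem_iSup_of_mem j ?_
    rw [GradedAlgebra.proj_mul_of_mem 𝒜 (hm j) (mul_add p n A).symm, GradedAlgebra.proj_pow_char]
    refine hX' j _ ⟨GradedAlgebra.proj_mem 𝒜 _ _, ?_⟩
    refine GradedAlgebra.proj_mem_ideal 𝒜 (powSpan_isHomogeneous 𝒜 hf q) n ?_
    exact Ideal.mul_mem_right _ _ (Ideal.mul_mem_left _ _ (Ideal.subset_span ⟨_, rfl⟩))
  calc powSpanDim 𝒜 f (p * q) (p * (n + A))
      ≤ Module.finrank k ((⨆ j, X' j) ⊔ ⨆ s, Y' s : Submodule k R) := Submodule.finrank_mono key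
    _ ≤ Module.finrank k (⨆ j, X' j : Submodule k R) + Module.finrank k (⨆ s, Y' s : Submodule k R) :=
        Submodule.finrank_add_le_finrank_add_finrank _ _
    _ ≤ ∑ j : Fin r, powSpanDim 𝒜 f q n + ∑ s : Fin M × Fin N, C * (n + A + 1) ^ D := by
        refine add_le_add ((finrank_iSup_le_sum _).trans (Finset.sum_le_sum fun j _ => hX'r j))
          ((finrank_iSup_le_sum _).trans (Finset.sum_le_sum fun s _ => ?_))
        refine (hY'r s).trans ((hYr s).trans_le ((hC _).trans ?_))
        gcongr
        exact (Nat.sub_le _ _).trans (Nat.sub_le _ _)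
    _ = _ := by simp

end FrobeniusStructure

section Recursion

lemma exists_abs_sub_le_of_two_shifts (α : ℕ → ℕ → ℝ) (r : ℝ) (hr : 1 ≤ r) (p A D : ℕ) (C : ℝ)
    (hC : 0 ≤ C)
    (h₁ : ∀ q n, |α (p * q) (p * (n + A)) - r * α q n| ≤ C * (n + 1) ^ D)
    (h₂ : ∀ q n, |α (p * q) (p * (n + (A + 1))) - r * α q n| ≤ C * (n + 1) ^ D) :
    ∃ C' : ℝ, 0 ≤ C' ∧ ∀ q n i, i < p → |α (p * q) (p * n + i) - r * α q n| ≤ C' * (n + 1) ^ D := by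
  have hstep : ∀ q n, |α q (n + 1) - α q n| ≤ C * (1 + 2 ^ D) * (n + 1) ^ D := by
    intro q n
    have e₁ := h₁ q (n + 1)
    have e₂ := h₂ q n
    rw [show n + 1 + A = n + (A + 1) by ring] at e₁
    have e₃ : ((n + 1 : ℕ) + 1 : ℝ) ^ D ≤ 2 ^ D * (n + 1) ^ D := by
      rw [← mul_pow]
      gcongr
      push_cast
      linarith [(Nat.cast_nonneg n : (0 : ℝ) ≤ n)]
    have e₄ := mul_le_mul_of_nonneg_left e₃ hC
    have e₅ : r * |α q (n + 1) - α q n| ≤ C * (1 + 2 ^ D) * (n + 1) ^ D := by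
      rw [← abs_of_nonneg (by linarith : 0 ≤ r), ← abs_mul]
      rw [abs_le] at *
      constructor <;> nlinarith
    have e₆ := abs_nonneg (α q (n + 1) - α q n)
    nlinarith
  have hiter : ∀ q n j, |α q (n + j) - α q n| ≤
      j * (C * (1 + 2 ^ D) * ((n + j : ℕ) + 1) ^ D) := by
    intro q n j
    induction j with
    | zero => simp
    | succ j ih =>
      have e₁ := hstep q (n + j)
      have e₂ : (((n + j : ℕ) : ℝ) + 1) ^ D ≤ ((n + (j + 1) : ℕ) + 1 : ℝ) ^ D := by
        gcongr
        omega
      have e₃ : 0 ≤ C * (1 + 2 ^ D) := by positivity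
      have e₄ := mul_le_mul_of_nonneg_left e₂ e₃
      have e₅ := mul_le_mul_of_nonneg_left e₄ (Nat.cast_nonneg j : (0 : ℝ) ≤ j)
      have e₆ : α q (n + (j + 1)) - α q n =
          (α q (n + j + 1) - α q (n + j)) + (α q (n + j) - α q n) := by ring_nf
      rw [e₆]
      refine (abs_add_le _ _).trans ?_
      push_cast at *
      linarith
  refine ⟨C + (p * (A + 1)) * (C * (1 + 2 ^ D) * (p * (A + 2)) ^ D), by positivity,
    fun q n i hi => ?_⟩
  obtain ⟨j, hj⟩ : ∃ j, i + j = p * (A + 1) := Nat.exists_eq_add_of_le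
    (hi.le.trans (Nat.le_mul_of_pos_right p (Nat.succ_pos A))) |>.imp fun _ h => h.symm
  have e₁ := hiter (p * q) (p * n + i) j
  rw [add_assoc, hj, ← mul_add] at e₁
  have e₂ := h₂ q n
  have hp : (1 : ℝ) ≤ p := by exact_mod_cast (by omega : 1 ≤ p)
  have e₃ : ((p * (n + (A + 1)) : ℕ) + 1 : ℝ) ^ D ≤ (p * (A + 2)) ^ D * (n + 1) ^ D := by
    rw [← mul_pow]
    gcongr
    push_cast
    nlinarith [mul_nonneg (by positivity : (0 : ℝ) ≤ p)
      (mul_nonneg (Nat.cast_nonneg n : (0 : ℝ) ≤ n) (Nat.cast_nonneg A : (0 : ℝ) ≤ A)),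
      mul_nonneg (by positivity : (0 : ℝ) ≤ p) (Nat.cast_nonneg n : (0 : ℝ) ≤ n)]
  have e₄ : (j : ℝ) ≤ p * (A + 1) := by exact_mod_cast (by omega : j ≤ p * (A + 1))
  have e₅ : (j : ℝ) * (C * (1 + 2 ^ D) * ((p * (n + (A + 1)) : ℕ) + 1) ^ D) ≤
      (p * (A + 1)) * (C * (1 + 2 ^ D) * ((p * (A + 2)) ^ D * (n + 1) ^ D)) := by
    gcongr
  have e₆ : α (p * q) (p * n + i) - r * α q n =
      (α (p * q) (p * (n + (A + 1))) - r * α q n) -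
        (α (p * q) (p * (n + (A + 1))) - α (p * q) (p * n + i)) := by ring
  rw [e₆]
  refine (abs_sub _ _).trans ?_
  nlinarith

lemma eq_one_of_abs_sub_mul_le (b : ℕ → ℝ) (ρ B C : ℝ) (h1 : ∀ n, 1 ≤ b n) (hB : ∀ n, b n ≤ B)
    (hC : 0 ≤ C) (h : ∀ n, |b (n + 1) - ρ * b n| ≤ C * (1 / 2) ^ n) : ρ = 1 := by
  have key : ∀ n : ℕ, n * |1 - ρ| ≤ 2 * B + 2 * C := by
    intro n
    have e₁ : ∑ i ∈ Finset.range n, (b (i + 1) - ρ * b i) =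
        (b n - b 0) + (1 - ρ) * ∑ i ∈ Finset.range n, b i := by
      rw [← Finset.sum_range_sub b n, Finset.mul_sum, ← Finset.sum_add_distrib]
      exact Finset.sum_congr rfl fun i _ => by ring
    have e₂ : |∑ i ∈ Finset.range n, (b (i + 1) - ρ * b i)| ≤ 2 * C := by
      refine (Finset.abs_sum_le_sum_abs _ _).trans ((Finset.sum_le_sum fun i _ => h i).trans ?_)
      rw [← Finset.mul_sum]
      nlinarith [sum_geometric_two_le n]
    have e₃ : (n : ℝ) ≤ ∑ i ∈ Finset.range n, b i := by
      calc (n : ℝ) = ∑ i ∈ Finset.range n, (1 : ℝ) := by simp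
        _ ≤ _ := Finset.sum_le_sum fun i _ => h1 i
    have e₄ : n * |1 - ρ| ≤ |(1 - ρ) * ∑ i ∈ Finset.range n, b i| := by
      rw [abs_mul, abs_of_nonneg ((Nat.cast_nonneg n).trans e₃), mul_comm]
      exact mul_le_mul_of_nonneg_left e₃ (abs_nonneg _)
    have e₅ : |b n - b 0| ≤ 2 * B := by
      rw [abs_le]
      constructor <;> linarith [h1 n, h1 0, hB n, hB 0]
    have e₆ : (1 - ρ) * ∑ i ∈ Finset.range n, b i =
      ∑ i ∈ Finset.range n, (b (i + 1) - ρ * b i) - (b n - b 0) := by rw [e₁]; ring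
    rw [e₆] at e₄
    linarith [abs_sub (∑ i ∈ Finset.range n, (b (i + 1) - ρ * b i)) (b n - b 0)]
  by_contra hρ
  have hpos : 0 < |1 - ρ| := abs_pos.2 (sub_ne_zero.2 (Ne.symm hρ))
  obtain ⟨n, hn⟩ := exists_nat_gt ((2 * B + 2 * C) / |1 - ρ|)
  rw [div_lt_iff₀ hpos] at hn
  linarith [key n]

/-- If `∑_{n < N} a n` grows like `N ^ (D + 2)` and `a (p n + i) = r a n + O(n ^ D)` for `i < p`,
then `r = p ^ (D + 1)`. -/
lemma eq_pow_of_sum_growth (a : ℕ → ℝ) (ρ : ℝ) (p D K : ℕ) (hp : 2 ≤ p) (B C : ℝ) (hC : 0 ≤ C)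
    (hK : 0 < K)
    (hrec : ∀ n i, i < p → |a (p * n + i) - ρ * a n| ≤ C * (n + 1) ^ D)
    (hlow : ∀ N : ℕ, 0 < N → (N : ℝ) ^ (D + 2) ≤ ∑ m ∈ Finset.range (K * N), a m)
    (hup : ∀ N : ℕ, 0 < N → ∑ m ∈ Finset.range N, a m ≤ B * N ^ (D + 2)) :
    ρ = p ^ (D + 1) := by
  have hp0 : (0 : ℝ) < p := by exact_mod_cast (by omega : 0 < p)
  have hp2 : (2 : ℝ) ≤ p := by exact_mod_cast hp
  let s : ℕ → ℝ := fun N => ∑ m ∈ Finset.range N, a m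
  have hs : ∀ N : ℕ, |s (p * N) - p * ρ * s N| ≤ p * C * N ^ (D + 1) := by
    intro N
    induction N with
    | zero => simp [s]
    | succ N ih =>
      have e₁ : s (p * (N + 1)) - p * ρ * s (N + 1) = (s (p * N) - p * ρ * s N) +
          ∑ i ∈ Finset.range p, (a (p * N + i) - ρ * a N) := by
        simp only [s]
        rw [mul_add, mul_one, Finset.sum_range_add, Finset.sum_range_succ, Finset.sum_sub_distrib]
        simp
        ring
      have e₂ : |∑ i ∈ Finset.range p, (a (p * N + i) - ρ * a N)| ≤ p * (C * (N + 1) ^ D) := by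
        refine (Finset.abs_sum_le_sum_abs _ _).trans ((Finset.sum_le_sum fun i hi =>
          hrec N i (Finset.mem_range.1 hi)).trans_eq ?_)
        simp
      have e₃ : (N : ℝ) ^ (D + 1) ≤ N * (N + 1) ^ D := by
        rw [pow_succ, mul_comm]
        gcongr
        linarith
      have e₄ : p * C * (N : ℝ) ^ (D + 1) ≤ p * C * (N * (N + 1) ^ D) := by gcongr
      rw [e₁]
      refine (abs_add_le _ _).trans ?_
      push_cast
      rw [pow_succ]
      linarith
  have hpp : (p : ℝ) ^ (D + 2) ≠ 0 := by positivity
  have h1 : p * ρ / p ^ (D + 2) = 1 := by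
    refine eq_one_of_abs_sub_mul_le (fun e => s (K * p ^ e) / (p ^ e) ^ (D + 2)) _ (B * K ^ (D + 2))
      (p * C * K ^ (D + 1)) (fun e => ?_) (fun e => ?_) (by positivity) (fun e => ?_)
    · rw [one_le_div (by positivity)]
      have := hlow (p ^ e) (by positivity)
      push_cast at this
      exact this
    · rw [div_le_iff₀ (by positivity), mul_assoc, ← mul_pow]
      have := hup (K * p ^ e) (by positivity)
      push_cast at this
      exact this
    · have e₁ := hs (K * p ^ e)
      have e₂ : s (K * p ^ (e + 1)) / ((p : ℝ) ^ (e + 1)) ^ (D + 2) -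
          p * ρ / p ^ (D + 2) * (s (K * p ^ e) / ((p : ℝ) ^ e) ^ (D + 2)) =
          (s (p * (K * p ^ e)) - p * ρ * s (K * p ^ e)) / ((p : ℝ) ^ (e + 1)) ^ (D + 2) := by
        rw [show K * p ^ (e + 1) = p * (K * p ^ e) by ring]
        rw [pow_succ (p : ℝ) e, mul_pow]
        field_simp
      rw [e₂, abs_div, abs_of_nonneg (by positivity : (0 : ℝ) ≤ ((p : ℝ) ^ (e + 1)) ^ (D + 2)),
        div_le_iff₀ (by positivity)]
      refine e₁.trans ?_
      push_cast
      have e₃ : ((p : ℝ) ^ e) ^ (D + 1) ≤ (1 / 2) ^ e * ((p : ℝ) ^ (e + 1)) ^ (D + 2) := by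
        have e₄ : (1 : ℝ) ≤ (1 / 2) ^ e * p ^ e := by
          rw [← mul_pow]
          exact one_le_pow₀ (by linarith)
        have e₅ : ((p : ℝ) ^ e) ^ (D + 2) ≤ ((p : ℝ) ^ (e + 1)) ^ (D + 2) := by
          gcongr
          · linarith
          · omega
        calc ((p : ℝ) ^ e) ^ (D + 1) = 1 * ((p : ℝ) ^ e) ^ (D + 1) := (one_mul _).symm
          _ ≤ ((1 / 2) ^ e * p ^ e) * ((p : ℝ) ^ e) ^ (D + 1) := by gcongr
          _ = (1 / 2) ^ e * ((p : ℝ) ^ e) ^ (D + 2) := by ring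
          _ ≤ _ := by gcongr
      rw [mul_pow, ← mul_assoc, mul_assoc (p * C * (K : ℝ) ^ (D + 1))]
      gcongr
  rw [div_eq_one_iff_eq hpp, pow_succ', mul_right_inj' hp0.ne'] at h1
  exact h1

end Recursion

section Growth

variable {k R : Type*} [Field k] [CommRing R] [Algebra k R] (𝒜 : ℕ → Submodule k R)
  [GradedAlgebra 𝒜]

/-- Passing from `q` to `p q` multiplies the Hilbert function of the ideal generated by `q`-th
powers by a constant, up to an error of order `n ^ (d - 2)`. -/
lemma exists_abs_powSpanDim_sub_le [PerfectField k] (p : ℕ) [Fact p.Prime] [CharP k p] [CharP R p]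
    [Algebra.FiniteType k R] [IsDomain R] [IsNoetherianRing R]
    (h0 : 𝒜 0 ≤ Submodule.span k {1}) (d : ℕ) (hd : 2 ≤ d) (hdim : ringKrullDim R = d)
    (hgcd : ∀ c : ℕ, (∀ m, 0 < m → 𝒜 m ≠ ⊥ → c ∣ m) → c = 1) :
    ∃ r : ℕ, ∀ (M : ℕ) (f : Fin M → R) (δ : Fin M → ℕ), (∀ t, f t ∈ 𝒜 (δ t)) →
      ∃ C : ℝ, 0 ≤ C ∧ ∀ q n i : ℕ, i < p →
        |(powSpanDim 𝒜 f (p * q) (p * n + i) : ℝ) - r * powSpanDim 𝒜 f q n| ≤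
          C * (n + 1) ^ (d - 2) := by
  have hfd := finiteDimensional_gradedPiece 𝒜 h0
  have hF : (frobenius R p).Finite := frobenius_finite (k := k) p
  obtain ⟨N, u, b, hu, hgen⟩ := exists_homogeneous_frobenius_generators 𝒜 p hF
  obtain ⟨r, A₀, hr, hA⟩ := exists_frobenius_structure 𝒜 p hF hgcd u b hu
  refine ⟨r, fun M f δ hf => ?_⟩
  have key : ∀ A ≥ A₀, ∃ C : ℝ, 0 ≤ C ∧ ∀ q n : ℕ,
      |(powSpanDim 𝒜 f (p * q) (p * (n + A)) : ℝ) - r * powSpanDim 𝒜 f q n| ≤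
        C * (n + 1) ^ (d - 2) := by
    intro A hAA
    obtain ⟨m, hm, hind, a, h, ha, hh0, hspan⟩ := hA A hAA
    obtain ⟨C, hC⟩ := exists_gradedPieceLen_le 𝒜 h0 d hd hdim (Ideal.span {h})
      (Ideal.homogeneous_span 𝒜 _ (by rintro _ rfl; exact ⟨a, ha⟩))
      (by simpa using hh0)
    refine ⟨M * N * (C * (A + 1) ^ (d - 2)), by positivity, fun q n => ?_⟩
    have h1 : (r * powSpanDim 𝒜 f q n : ℝ) ≤ powSpanDim 𝒜 f (p * q) (p * (n + A)) := by
      exact_mod_cast mul_powSpanDim_le 𝒜 p f m hm hind q n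
    have h2 : (powSpanDim 𝒜 f (p * q) (p * (n + A)) : ℝ) ≤
        r * powSpanDim 𝒜 f q n + M * N * (C * (n + A + 1) ^ (d - 2)) := by
      exact_mod_cast powSpanDim_le_mul_add 𝒜 p u b hu hgen m hm h hspan hf C (d - 2) hC q n
    have h3 : ((n : ℝ) + A + 1) ^ (d - 2) ≤ (A + 1) ^ (d - 2) * (n + 1) ^ (d - 2) := by
      rw [← mul_pow]
      gcongr
      nlinarith [mul_nonneg (Nat.cast_nonneg n : (0 : ℝ) ≤ n) (Nat.cast_nonneg A : (0 : ℝ) ≤ A)]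
    have h4 : (M * N * (C * (n + A + 1) ^ (d - 2)) : ℝ) ≤
        M * N * (C * ((A + 1) ^ (d - 2) * (n + 1) ^ (d - 2))) := by gcongr
    rw [abs_of_nonneg (by linarith)]
    linarith
  obtain ⟨C₁, hC₁, h₁⟩ := key A₀ le_rfl
  obtain ⟨C₂, hC₂, h₂⟩ := key (A₀ + 1) (Nat.le_succ _)
  refine exists_abs_sub_le_of_two_shifts (fun q n => (powSpanDim 𝒜 f q n : ℝ)) r
    (by exact_mod_cast hr) p A₀ (d - 2) (C₁ + C₂) (by positivity)
    (fun q n => (h₁ q n).trans ?_) (fun q n => (h₂ q n).trans ?_)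
  · gcongr
    linarith
  · gcongr
    linarith

lemma GradedAlgebra.mul_mem_sup_range {a b : ℕ} {x y : R}
    (hx : x ∈ (Finset.range (a + 1)).sup 𝒜) (hy : y ∈ (Finset.range (b + 1)).sup 𝒜) :
    x * y ∈ (Finset.range (a + b + 1)).sup 𝒜 := by
  have h : (Finset.range (a + 1)).sup 𝒜 * (Finset.range (b + 1)).sup 𝒜 ≤
      (Finset.range (a + b + 1)).sup 𝒜 := by
    rw [Finset.sup_eq_iSup, Finset.sup_eq_iSup, Submodule.iSup_mul]
    refine iSup_le fun i => ?_
    rw [Submodule.iSup_mul]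
    refine iSup_le fun hi => ?_
    rw [Submodule.mul_iSup]
    refine iSup_le fun j => ?_
    rw [Submodule.mul_iSup]
    refine iSup_le fun hj => Submodule.mul_le.2 fun x hx y hy => ?_
    refine Finset.le_sup (f := 𝒜) (b := i + j) ?_ (SetLike.mul_mem_graded hx hy)
    simp only [Finset.mem_range] at *
    omega
  exact h (Submodule.mul_mem_mul hx hy)

lemma GradedAlgebra.one_mem_sup_range (a : ℕ) : (1 : R) ∈ (Finset.range (a + 1)).sup 𝒜 :=
  Finset.le_sup (f := 𝒜) (b := 0) (by simp) (SetLike.one_mem_graded 𝒜)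

lemma GradedAlgebra.pow_mem_sup_range {a : ℕ} {x : R} (hx : x ∈ (Finset.range (a + 1)).sup 𝒜)
    (n : ℕ) : x ^ n ∈ (Finset.range (n * a + 1)).sup 𝒜 := by
  induction n with
  | zero =>
    rw [pow_zero]
    exact GradedAlgebra.one_mem_sup_range 𝒜 _
  | succ n ih =>
    rw [pow_succ, Nat.succ_mul]
    exact GradedAlgebra.mul_mem_sup_range 𝒜 ih hx

lemma GradedAlgebra.prod_mem_sup_range {ι : Type*} (s : Finset ι) (x : ι → R) (a : ℕ)
    (hx : ∀ i ∈ s, x i ∈ (Finset.range (a + 1)).sup 𝒜) :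
    ∏ i ∈ s, x i ∈ (Finset.range (s.card * a + 1)).sup 𝒜 := by
  classical
  induction s using Finset.induction_on with
  | empty => simpa using GradedAlgebra.one_mem_sup_range 𝒜 0
  | insert i s hi ih =>
    rw [Finset.prod_insert hi, Finset.card_insert_of_notMem hi, Nat.succ_mul, add_comm (_ * a)]
    exact GradedAlgebra.mul_mem_sup_range 𝒜 (hx i (Finset.mem_insert_self _ _))
      (ih fun j hj => hx j (Finset.mem_insert_of_mem hj))

omit [GradedAlgebra 𝒜] in
lemma sup_range_mono {a b : ℕ} (h : a ≤ b) :
    (Finset.range a).sup 𝒜 ≤ (Finset.range b).sup 𝒜 :=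
  Finset.sup_mono (Finset.range_mono h)

lemma exists_pow_le_sum_finrank [Nontrivial R] [Algebra.FiniteType k R]
    [∀ n, FiniteDimensional k (𝒜 n)] (d : ℕ) (hdim : ringKrullDim R = d) :
    ∃ K : ℕ, 0 < K ∧ ∀ N, 0 < N → N ^ d ≤ ∑ m ∈ Finset.range (K * N), Module.finrank k (𝒜 m) := by
  obtain ⟨s, hs, g, hginj, -⟩ := exists_finite_inj_algHom_ringKrullDim k R
  obtain rfl : s = d := by
    rw [hdim] at hs
    exact_mod_cast hs.symm
  choose B hB using fun i => GradedAlgebra.sum_proj 𝒜 (g (MvPolynomial.X i))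
  let E := ∑ i, B i
  have hX : ∀ i, g (MvPolynomial.X i) ∈ (Finset.range (E + 1)).sup 𝒜 := by
    intro i
    rw [hB i]
    refine Submodule.sum_mem _ fun n hn => Finset.le_sup (f := 𝒜) (b := n) ?_
      (GradedAlgebra.proj_mem 𝒜 n _)
    have h1 : B i ≤ E := Finset.single_le_sum (f := B) (fun _ _ => Nat.zero_le _) (Finset.mem_univ i)
    simp only [Finset.mem_range] at *
    omega
  have hfr : ∀ L, Module.finrank k ((Finset.range L).sup 𝒜 : Submodule k R) ≤
      ∑ m ∈ Finset.range L, Module.finrank k (𝒜 m) := by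
    intro L
    induction L with
    | zero =>
      rw [Finset.range_zero, Finset.sup_empty]
      simp
    | succ L ih =>
      rw [Finset.sum_range_succ, Finset.range_add_one, Finset.sup_insert, add_comm]
      exact (Submodule.finrank_add_le_finrank_add_finrank _ _).trans (Nat.add_le_add_left ih _)
  refine ⟨s * E + 1, Nat.succ_pos _, fun N hN => ?_⟩
  obtain ⟨N, rfl⟩ := Nat.exists_eq_add_of_le' hN
  refine le_trans ?_ (hfr _)
  have hle := MvPolynomial.le_finrank_of_restrictDegree_le g hginj N
    ((Finset.range ((s * E + 1) * (N + 1))).sup 𝒜) ?_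
  · simpa using hle
  · rw [MvPolynomial.restrictDegree_eq_span, Submodule.map_span, Submodule.span_le]
    rintro _ ⟨_, ⟨e, rfl⟩, rfl⟩
    have h1 : g (MvPolynomial.monomial (Finsupp.equivFunOnFinite.symm fun i => (e i : ℕ)) (1 : k)) =
        ∏ i, g (MvPolynomial.X i) ^ (e i : ℕ) := by
      rw [MvPolynomial.monomial_eq, Finsupp.prod_fintype _ _ (fun i => pow_zero _)]
      simp
    change g _ ∈ _
    rw [h1]
    have h2 := GradedAlgebra.prod_mem_sup_range 𝒜 Finset.univ
      (fun i => g (MvPolynomial.X i) ^ (e i : ℕ)) (N * E) fun i _ => by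
        refine sup_range_mono 𝒜 ?_ (GradedAlgebra.pow_mem_sup_range 𝒜 (hX i) _)
        have h3 : (e i : ℕ) * E ≤ N * E := Nat.mul_le_mul_right _ (Nat.lt_succ_iff.1 (e i).2)
        omega
    refine sup_range_mono 𝒜 ?_ h2
    rw [Finset.card_univ, Fintype.card_fin]
    nlinarith

lemma exists_sum_finrank_le [Nontrivial R] [Algebra.FiniteType k R]
    (h0 : 𝒜 0 ≤ Submodule.span k {1}) (d : ℕ) (hdim : ringKrullDim R = d) :
    ∃ C : ℕ, ∀ N, 0 < N →
      ∑ m ∈ Finset.range N, Module.finrank k (𝒜 m) ≤ C * N ^ d := by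
  have hfd := finiteDimensional_gradedPiece 𝒜 h0
  obtain ⟨C, hC⟩ := exists_sum_gradedPieceLen_le 𝒜 h0 (J := ⊥) (Ideal.IsHomogeneous.bot 𝒜)
    bot_ne_top d ((ringKrullDim_quotient_le _).trans hdim.le)
  refine ⟨C, fun N hN => ?_⟩
  obtain ⟨N, rfl⟩ := Nat.exists_eq_add_of_le' hN
  refine le_of_eq_of_le (Finset.sum_congr rfl fun m _ => ?_) (hC N)
  have h1 := gradedPieceLen_add_finrank_inf 𝒜 ((⊥ : Ideal R).restrictScalars k) m
  rw [Submodule.restrictScalars_bot, inf_bot_eq, finrank_bot] at h1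
  rw [Submodule.restrictScalars_bot]
  omega

omit [GradedAlgebra 𝒜] in
lemma powSpanDim_one (q n : ℕ) :
    powSpanDim 𝒜 (fun _ : Fin 1 => (1 : R)) q n = Module.finrank k (𝒜 n) := by
  have h : powSpan (fun _ : Fin 1 => (1 : R)) q = ⊤ := by
    rw [powSpan, Ideal.eq_top_iff_one]
    exact Ideal.subset_span ⟨0, by simp⟩
  rw [powSpanDim, h, Submodule.restrictScalars_top, inf_top_eq]

/-- The Hilbert function of the quotient by the ideal generated by `q`-th powers scales by
`p ^ (d - 1)` when passing from `q` to `p q`, up to an error of order `n ^ (d - 2)`. -/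
lemma exists_abs_gradedPieceLen_powSpan_sub_le [PerfectField k] (p : ℕ) [Fact p.Prime] [CharP k p]
    [CharP R p] [Algebra.FiniteType k R] [IsDomain R] [IsNoetherianRing R]
    (h0 : 𝒜 0 ≤ Submodule.span k {1}) (d : ℕ) (hd : 2 ≤ d) (hdim : ringKrullDim R = d)
    (hgcd : ∀ c : ℕ, (∀ m, 0 < m → 𝒜 m ≠ ⊥ → c ∣ m) → c = 1)
    {M : ℕ} (f : Fin M → R) (δ : Fin M → ℕ) (hf : ∀ t, f t ∈ 𝒜 (δ t)) :
    ∃ C : ℝ, 0 ≤ C ∧ ∀ q n i : ℕ, i < p →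
      |(gradedPieceLen k 𝒜 ((powSpan f (p * q)).restrictScalars k) (p * n + i) : ℝ) -
        p ^ (d - 1) * gradedPieceLen k 𝒜 ((powSpan f q).restrictScalars k) n| ≤
          C * (n + 1) ^ (d - 2) := by
  have hfd := finiteDimensional_gradedPiece 𝒜 h0
  obtain ⟨r, hr⟩ := exists_abs_powSpanDim_sub_le 𝒜 p h0 d hd hdim hgcd
  obtain ⟨C₁, hC₁, h₁⟩ := hr 1 (fun _ => 1) (fun _ => 0) fun _ => SetLike.one_mem_graded 𝒜
  obtain ⟨C₂, hC₂, h₂⟩ := hr M f δ hf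
  simp only [powSpanDim_one] at h₁
  obtain ⟨K, hK, hlow⟩ := exists_pow_le_sum_finrank 𝒜 d hdim
  obtain ⟨B, hup⟩ := exists_sum_finrank_le 𝒜 h0 d hdim
  have hrp : (r : ℝ) = p ^ (d - 1) := by
    have h3 := eq_pow_of_sum_growth (fun n => (Module.finrank k (𝒜 n) : ℝ)) r p (d - 2) K
      (Fact.out : p.Prime).two_le B C₁ hC₁ hK (fun n i hi => h₁ 1 n i hi)
      (fun N hN => by
        rw [Nat.sub_add_cancel hd]
        exact_mod_cast hlow N hN)
      (fun N hN => by
        rw [Nat.sub_add_cancel hd]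
        exact_mod_cast hup N hN)
    rwa [show d - 2 + 1 = d - 1 by omega] at h3
  have hsub : ∀ q n, (gradedPieceLen k 𝒜 ((powSpan f q).restrictScalars k) n : ℝ) =
      Module.finrank k (𝒜 n) - powSpanDim 𝒜 f q n := by
    intro q n
    rw [eq_sub_iff_add_eq]
    exact_mod_cast gradedPieceLen_add_finrank_inf 𝒜 ((powSpan f q).restrictScalars k) n
  refine ⟨C₁ + C₂, by positivity, fun q n i hi => ?_⟩
  rw [hsub, hsub, ← hrp]
  have e₁ := h₁ q n i hi
  have e₂ := h₂ q n i hi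
  rw [abs_le] at *
  constructor <;> nlinarith

/-- If the ideal generated by `f` contains all large degrees, then so do the ideals generated by
the `p ^ e`-th powers, with a bound on the degree proportional to `p ^ e`. -/
lemma exists_le_powSpan (p : ℕ) [Fact p.Prime] [CharP R p] (hF : (frobenius R p).Finite)
    {M : ℕ} (f : Fin M → R) (C₀ : ℕ)
    (hC₀ : ∀ n ≥ C₀, 𝒜 n ≤ (powSpan f 1).restrictScalars k) :
    ∃ B : ℕ, ∀ e n, B * p ^ e ≤ n → 𝒜 n ≤ (powSpan f (p ^ e)).restrictScalars k := by
  obtain ⟨N, u, b, hu, hgen⟩ := exists_homogeneous_frobenius_generators 𝒜 p hF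
  have hp2 : 2 ≤ p := (Fact.out : p.Prime).two_le
  have key : ∀ e n, (C₀ + ∑ i, b i) * p ^ e - ∑ i, b i ≤ n →
      𝒜 n ≤ (powSpan f (p ^ e)).restrictScalars k := by
    intro e
    induction e with
    | zero => simpa using hC₀
    | succ e ih =>
      intro n hn x hx
      obtain ⟨z, hz⟩ := hgen x
      rw [← GradedAlgebra.proj_of_mem 𝒜 hx, hz, map_sum]
      refine Submodule.sum_mem _ fun i _ => ?_
      obtain ⟨c, hc, h | ⟨j, hj, hcj⟩⟩ := GradedAlgebra.exists_proj_pow_mul 𝒜 p (hu i) (z i) n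
      · rw [hc, h, zero_pow (by omega), zero_mul]
        exact Submodule.zero_mem _
      · rw [hc]
        refine Ideal.mul_mem_right _ _ ?_
        rw [pow_succ']
        refine pow_char_mem_powSpan p f _ (ih j ?_ hcj)
        have h1 : b i ≤ ∑ i, b i :=
          Finset.single_le_sum (f := b) (fun _ _ => Nat.zero_le _) (Finset.mem_univ i)
        generalize ∑ i, b i = S at *
        rw [Nat.sub_le_iff_le_add] at hn ⊢
        rw [pow_succ] at hn
        refine Nat.le_of_mul_le_mul_left ?_ (by omega : 0 < p)
        nlinarith
  exact ⟨C₀ + ∑ i, b i, fun e n hn => key e n ((Nat.sub_le _ _).trans hn)⟩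

end Growth

section Convergence

variable {k R : Type*} [Field k] [CommRing R] [Algebra k R] (𝒜 : ℕ → Submodule k R)
  [GradedAlgebra 𝒜]

lemma exists_homogeneous_generators [IsNoetherianRing R] {I : Ideal R} (hI : I.IsHomogeneous 𝒜) :
    ∃ (M : ℕ) (f : Fin M → R) (δ : Fin M → ℕ), (∀ t, f t ∈ 𝒜 (δ t)) ∧ I = powSpan f 1 := by
  classical
  let H : Set R := {x | SetLike.IsHomogeneousElem 𝒜 x ∧ x ∈ I}
  have hH : Submodule.span R H = I := by
    refine le_antisymm (Submodule.span_le.2 fun x hx => hx.2) fun x hx => ?_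
    rw [(GradedAlgebra.sum_proj 𝒜 x).choose_spec]
    exact Submodule.sum_mem _ fun i _ => Submodule.subset_span
      ⟨⟨i, GradedAlgebra.proj_mem 𝒜 i x⟩, GradedAlgebra.proj_mem_ideal 𝒜 hI i hx⟩
  obtain ⟨T, hTH, hT⟩ := (Submodule.fg_span_iff_fg_span_finset_subset (R := R) H).1
    (hH ▸ IsNoetherian.noetherian I)
  choose b hb using fun t : T => (hTH t.2).1
  let e := T.equivFin
  refine ⟨T.card, fun i => e.symm i, fun i => b (e.symm i), fun i => hb _, ?_⟩
  rw [← hH, hT, powSpan, Ideal.span]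
  congr 1
  simp only [pow_one]
  rw [← Function.comp_def, e.symm.surjective.range_comp]
  simp

lemma frobeniusPow_powSpan_one (p : ℕ) [Fact p.Prime] [CharP R p] {M : ℕ} (f : Fin M → R) (e : ℕ) :
    (powSpan f 1).frobeniusPow (p ^ e) = powSpan f (p ^ e) := by
  refine le_antisymm (Ideal.span_le.2 ?_) (Ideal.span_le.2 ?_)
  · rintro _ ⟨x, hx, rfl⟩
    change x ^ p ^ e ∈ powSpan f (p ^ e)
    induction e with
    | zero => simpa using hx
    | succ e ih =>
      rw [pow_succ, pow_mul, ← pow_succ, pow_succ']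
      exact pow_char_mem_powSpan p f _ ih
  · rintro _ ⟨t, rfl⟩
    exact Ideal.subset_span ⟨f t, Ideal.subset_span ⟨t, pow_one _⟩, rfl⟩

lemma exists_le_of_finiteDimensional_quotient [∀ n, FiniteDimensional k (𝒜 n)] {I : Ideal R}
    (hI : I.IsHomogeneous 𝒜) [FiniteDimensional k (R ⧸ I)] :
    ∃ C, ∀ n ≥ C, 𝒜 n ≤ I.restrictScalars k := by
  have : FiniteDimensional k (R ⧸ I.restrictScalars k) :=
    (Submodule.Quotient.restrictScalarsEquiv k I).symm.finiteDimensional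
  have hs : Summable fun m => (gradedPieceLen k 𝒜 (I.restrictScalars k) m : ℝ) := by
    refine summable_of_sum_range_le (c := Module.finrank k (R ⧸ I.restrictScalars k))
      (fun _ => Nat.cast_nonneg _) fun N => ?_
    exact_mod_cast (sum_gradedPieceLen_le 𝒜 hI N).trans (Submodule.finrank_le _)
  obtain ⟨C, hC⟩ := eventually_atTop.1 (hs.tendsto_atTop_zero.eventually_lt_const zero_lt_one)
  refine ⟨C, fun n hn => ?_⟩
  have h1 : gradedPieceLen k 𝒜 (I.restrictScalars k) n < 1 := by exact_mod_cast hC n hn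
  have h2 := gradedPieceLen_add_finrank_inf 𝒜 (I.restrictScalars k) n
  exact inf_eq_left.1 (Submodule.eq_of_le_of_finrank_eq inf_le_left (by omega))

/-- Rescalings of functions on `ℕ` that are supported on `[0, B p ^ e)` and satisfy an approximate
`p`-adic self-similarity converge uniformly. -/
lemma exists_tendstoUniformlyOn_of_selfSimilar (p D B : ℕ) (hp : 2 ≤ p) (C : ℝ) (hC : 0 ≤ C)
    (H : ℕ → ℕ → ℝ)
    (hrec : ∀ e n i, i < p → |H (e + 1) (p * n + i) - p ^ (D + 1) * H e n| ≤ C * (n + 1) ^ D)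
    (hzero : ∀ e n, B * p ^ e ≤ n → H e n = 0) :
    ∃ F : ℝ → ℝ, TendstoUniformlyOn
      (fun e (x : ℝ) => H e ⌊x * (p ^ e : ℕ)⌋₊ / ((p : ℝ) ^ e) ^ (D + 1)) F atTop (Set.Ici 0) := by
  have hp0 : (0 : ℝ) < p := by exact_mod_cast (by omega : 0 < p)
  have hp2 : (2 : ℝ) ≤ p := by exact_mod_cast hp
  let φ : ℕ → ℝ → ℝ := fun e x => H e ⌊x * (p ^ e : ℕ)⌋₊ / ((p : ℝ) ^ e) ^ (D + 1)
  let K : ℝ := C * B ^ D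
  have hK : 0 ≤ K := by positivity
  have hstep : ∀ e, ∀ x ∈ Set.Ici (0 : ℝ), dist (φ e x) (φ (e + 1) x) ≤ K * (1 / 2) ^ e := by
    intro e x hx
    rw [dist_comm, Real.dist_eq]
    let n := ⌊x * (p ^ e : ℕ)⌋₊
    let n' := ⌊x * (p ^ (e + 1) : ℕ)⌋₊
    have hn : n' / p = n := by
      have h1 : x * (p ^ e : ℕ) = x * (p ^ (e + 1) : ℕ) / p := by
        push_cast
        field_simp
        ring
      simp only [n, n']
      rw [h1, Nat.floor_div_natCast]
    have hdm : p * n + n' % p = n' := by rw [← hn, Nat.div_add_mod]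
    have hlt : n' % p < p := Nat.mod_lt _ (by omega)
    change |H (e + 1) n' / _ - H e n / _| ≤ _
    by_cases hB : B * p ^ e ≤ n
    · have hB' : B * p ^ (e + 1) ≤ n' := by
        have := Nat.mul_le_mul_left p hB
        rw [pow_succ', mul_left_comm, ← hdm]
        exact this.trans (Nat.le_add_right _ _)
      rw [hzero e n hB, hzero (e + 1) n' hB']
      simp only [zero_div, sub_zero, abs_zero]
      positivity
    · have h1 := hrec e n (n' % p) hlt
      rw [hdm] at h1
      have h2 : ((n : ℝ) + 1) ^ D ≤ (B * p ^ e) ^ D := by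
        gcongr
        exact_mod_cast (by omega : n + 1 ≤ B * p ^ e)
      have h3 : H (e + 1) n' / ((p : ℝ) ^ (e + 1)) ^ (D + 1) - H e n / ((p : ℝ) ^ e) ^ (D + 1) =
          (H (e + 1) n' - p ^ (D + 1) * H e n) / ((p : ℝ) ^ (e + 1)) ^ (D + 1) := by
        rw [pow_succ (p : ℝ) e, mul_pow]
        field_simp
      rw [h3, abs_div, abs_of_nonneg (by positivity : (0 : ℝ) ≤ ((p : ℝ) ^ (e + 1)) ^ (D + 1)),
        div_le_iff₀ (by positivity)]
      have h4 : C * ((n : ℝ) + 1) ^ D ≤ K * ((p : ℝ) ^ e) ^ D := by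
        simp only [K]
        rw [mul_assoc, ← mul_pow]
        gcongr
      have h5 : (1 : ℝ) ≤ (1 / 2) ^ e * p ^ e := by
        rw [← mul_pow]
        exact one_le_pow₀ (by linarith)
      have h6 : ((p : ℝ) ^ e) ^ (D + 1) ≤ ((p : ℝ) ^ (e + 1)) ^ (D + 1) := by
        gcongr
        · linarith
        · omega
      calc |H (e + 1) n' - p ^ (D + 1) * H e n| ≤ K * (1 * ((p : ℝ) ^ e) ^ D) := by
            rw [one_mul]
            exact h1.trans h4
        _ ≤ K * (((1 / 2) ^ e * p ^ e) * ((p : ℝ) ^ e) ^ D) := by gcongr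
        _ = K * (1 / 2) ^ e * ((p : ℝ) ^ e) ^ (D + 1) := by ring
        _ ≤ _ := by gcongr
  have hlim : ∀ x ∈ Set.Ici (0 : ℝ), ∃ y, Tendsto (fun e => φ e x) atTop (𝓝 y) := fun x hx =>
    cauchySeq_tendsto_of_complete
      (cauchySeq_of_le_geometric (1 / 2) K (by norm_num) fun e => hstep e x hx)
  choose! F hF using hlim
  refine ⟨F, Metric.tendstoUniformlyOn_iff.2 fun ε hε => ?_⟩
  have h0 : Tendsto (fun e : ℕ => K * (1 / 2 : ℝ) ^ e / (1 - 1 / 2)) atTop (𝓝 0) := by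
    have := ((tendsto_pow_atTop_nhds_zero_of_lt_one (r := (1 / 2 : ℝ)) (by norm_num)
      (by norm_num)).const_mul K).div_const (1 - 1 / 2)
    simpa using this
  filter_upwards [h0.eventually_lt_const hε] with e he x hx
  rw [dist_comm]
  exact (dist_le_of_le_geometric_of_tendsto (1 / 2) K (by norm_num) (fun e => hstep e x hx)
    (hF x hx) e).trans_lt he

end Convergence

/-- For a graded pair `(R, I)` with `R` a normal domain and
`gcd {n > 0 | R_n ≠ 0} = 1`, the sequence of step functions `{f_n(R, I)}` converges
uniformly on `[0, ∞)`. -/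
theorem statement8
    (k : Type*) [Field k] [PerfectField k] (p : ℕ) [Fact p.Prime] [CharP k p]
    (R : Type*) [CommRing R] [IsDomain R] [IsNoetherianRing R] [IsIntegrallyClosed R]
    [Algebra k R] [Algebra.FiniteType k R]
    (𝒜 : ℕ → Submodule k R) [GradedAlgebra 𝒜]
    (h𝒜0 : 𝒜 0 ≤ Submodule.span k {1})
    (d : ℕ) (hd : 2 ≤ d) (hdim : ringKrullDim R = d)
    (I : Ideal R) (hI : I.IsHomogeneous 𝒜) (hIcolen : FiniteDimensional k (R ⧸ I))
    (hgcd : ∀ c : ℕ, (∀ m, 0 < m → 𝒜 m ≠ ⊥ → c ∣ m) → c = 1) :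
    ∃ F : ℝ → ℝ, TendstoUniformlyOn (fun n => hkStep k 𝒜 I d 1 p n) F atTop (Set.Ici 0) := by
  have : CharP R p := charP_of_injective_algebraMap (algebraMap k R).injective p
  have hfd := finiteDimensional_gradedPiece 𝒜 h𝒜0
  have hF : (frobenius R p).Finite := frobenius_finite (k := k) p
  obtain ⟨C₀, hC₀⟩ := exists_le_of_finiteDimensional_quotient 𝒜 hI
  obtain ⟨M, f, δ, hf, rfl⟩ := exists_homogeneous_generators 𝒜 hI
  obtain ⟨B, hB⟩ := exists_le_powSpan 𝒜 p hF f C₀ hC₀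
  obtain ⟨C, hC, hrec⟩ :=
    exists_abs_gradedPieceLen_powSpan_sub_le 𝒜 p h𝒜0 d hd hdim hgcd f δ hf
  obtain ⟨D, rfl⟩ := Nat.exists_eq_add_of_le' hd
  obtain ⟨F, h⟩ := exists_tendstoUniformlyOn_of_selfSimilar p D B (Fact.out : p.Prime).two_le C hC
    (fun e n => (gradedPieceLen k 𝒜 ((powSpan f (p ^ e)).restrictScalars k) n : ℝ))
    (fun e n i hi => by
      rw [pow_succ']
      exact hrec (p ^ e) n i hi)
    (fun e n hn => by
      rw [Nat.cast_eq_zero, ← Nat.le_zero]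
      refine (gradedPieceLen_le_of_le_sup 𝒜 _ ⊥ n ?_).trans (by simp)
      rw [bot_sup_eq]
      exact hB e n hn)
  refine ⟨F, h.congr (Eventually.of_forall fun e x _ => ?_)⟩
  simp only [hkStep, frobeniusPow_powSpan_one p f e, smul_eq_mul, Ideal.mul_top]
  simp
end
end
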